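/- Let f(Z), g(Z) ∈ ℤ[Z] satisfy the nondegeneracy condition. Then for every ε > 0 there is a constant C (depending only on f, g, ε) such that for every positive integer T, every real x ≥ 2 and every sequence of integers 𝔄 = (a_p) indexed by the primes, one has Σ_{t ∈ I(T), Δ(t) ≠ 0} π_{E(t)}(𝔄; x) ≤ C (T² + T^{1/2} x^{5/4+ε}). -/

import Mathlib

open Polynomial Finset

attribute [local instance 10] Classical.propDecidable

noncomputable section

/-- The discriminant polynomial `Δ = -16(4f³+27g²)`. -/
def Dpoly (f g : Polynomial ℤ) : Polynomial ℤ := -16 * (4 * f ^ 3 + 27 * g ^ 2)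

/-- Nondegeneracy: `Δ ≠ 0` as a polynomial and the `j`-invariant
`j = -1728(4f)³/Δ` is not a constant rational function, i.e. `-1728(4f)³`
is not a rational multiple of `Δ`. -/
def Nondeg (f g : Polynomial ℤ) : Prop :=
  Dpoly f g ≠ 0 ∧
    ¬∃ c : ℚ, (-1728 : Polynomial ℚ) * (4 * f.map (Int.castRingHom ℚ)) ^ 3 =
      Polynomial.C c * (Dpoly f g).map (Int.castRingHom ℚ)

/-- The set `F(T) = {u/v ∈ ℚ : gcd(u,v) = 1, 1 ≤ u, v ≤ T}`. -/
def FT (T : ℝ) : Finset ℚ :=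
  ((Finset.Icc (1 : ℤ) ⌊T⌋ ×ˢ Finset.Icc (1 : ℤ) ⌊T⌋).filter
      fun w => Int.gcd w.1 w.2 = 1).image fun w => (w.1 : ℚ) / (w.2 : ℚ)

/-- Reduction of a rational number `t` modulo `p`, as `num·den⁻¹` in `ZMod p`. -/
def redQ (p : ℕ) (t : ℚ) : ZMod p := (t.num : ZMod p) * (t.den : ZMod p)⁻¹

/-- The number of `𝔽_p`-points of the curve `Y² = X³ + AX + B`
(affine points together with the point at infinity). -/
def numPoints (p : ℕ) (A B : ZMod p) : ℕ :=
  1 + Nat.card {P : ZMod p × ZMod p // P.2 ^ 2 = P.1 ^ 3 + A * P.1 + B}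

/-- The Frobenius trace `p + 1 - #E(𝔽_p)` of `Y² = X³ + AX + B` over `𝔽_p`. -/
def frobTrace (p : ℕ) (A B : ZMod p) : ℤ := (p : ℤ) + 1 - numPoints p A B

/-- `a_p(E(t))`: the Frobenius trace of the reduction modulo `p` of the curve
`E(t) : Y² = X³ + f(t)X + g(t)`. -/
def apE (f g : Polynomial ℤ) (p : ℕ) (t : ℚ) : ℤ :=
  frobTrace p ((f.map (Int.castRingHom (ZMod p))).eval (redQ p t))
    ((g.map (Int.castRingHom (ZMod p))).eval (redQ p t))

/-- Good reduction of `E(t)` at `p`: the denominator of `t` is coprime to `p`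
and `Δ(t) ≢ 0 (mod p)`. -/
def goodRed (f g : Polynomial ℤ) (p : ℕ) (t : ℚ) : Prop :=
  ¬(p ∣ t.den) ∧ ((Dpoly f g).map (Int.castRingHom (ZMod p))).eval (redQ p t) ≠ 0

/-- `π_{E(t)}(𝔄; x)`: the number of primes `p ≤ x` of good reduction for `E(t)`
with `a_p(E(t)) = a_p`. -/
def piSeq (f g : Polynomial ℤ) (a : ℕ → ℤ) (t : ℚ) (x : ℝ) : ℕ :=
  ((Finset.Icc 1 ⌊x⌋₊).filter fun p =>
      p.Prime ∧ goodRed f g p t ∧ apE f g p t = a p).card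

/-- `π_{E(t)}(K; x)` for `K = ℚ(√d)`: the number of primes `p ≤ x` of good
reduction for `E(t)` with `a_p(E(t)) ≠ 0` and `a_p(E(t))² - 4p = d·m²`. -/
def piK (f g : Polynomial ℤ) (d : ℤ) (t : ℚ) (x : ℝ) : ℕ :=
  ((Finset.Icc 1 ⌊x⌋₊).filter fun p =>
      p.Prime ∧ goodRed f g p t ∧ apE f g p t ≠ 0 ∧
        ∃ m : ℤ, 0 < m ∧ (apE f g p t) ^ 2 - 4 * (p : ℤ) = d * m ^ 2).card

/-- The Frobenius angle `ψ_p(E(t)) ∈ [0, π]`, with `cos ψ_p = a_p/(2√p)`. -/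
def psiE (f g : Polynomial ℤ) (p : ℕ) (t : ℚ) : ℝ :=
  Real.arccos ((apE f g p t : ℝ) / (2 * Real.sqrt p))

/-- `π_{E(t)}(α, β; x)`: the number of primes `p ≤ x` of good reduction for
`E(t)` with `ψ_p(E(t)) ∈ [α, β]`. -/
def piAngle (f g : Polynomial ℤ) (α β : ℝ) (t : ℚ) (x : ℝ) : ℕ :=
  ((Finset.Icc 1 ⌊x⌋₊).filter fun p =>
      p.Prime ∧ goodRed f g p t ∧ psiE f g p t ∈ Set.Icc α β).card

/-- The Sato–Tate density `μ_ST(α, β) = (2/π) ∫_α^β sin²θ dθ`. -/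
def muST (α β : ℝ) : ℝ := (2 / Real.pi) * ∫ θ in α..β, Real.sin θ ^ 2

/-- `π(x)`: the number of primes `p ≤ x`. -/
def primePi (x : ℝ) : ℕ := ((Finset.Icc 1 ⌊x⌋₊).filter Nat.Prime).card

/-- `e_p(w) = exp(2πi w/p)`. -/
def ep (p : ℕ) (w : ZMod p) : ℂ :=
  Complex.exp (2 * (Real.pi : ℂ) * Complex.I * (w.val : ℂ) / (p : ℂ))

theorem exists_coeff_minor_ne_zero {f g : Polynomial ℤ} (h : Nondeg f g) :
    ∃ i j, (f ^ 3).coeff i * (g ^ 2).coeff j - (f ^ 3).coeff j * (g ^ 2).coeff i ≠ 0 := by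
  by_contra! hc
  obtain ⟨hD, hj⟩ := h
  have hmap : (Dpoly f g).map (Int.castRingHom ℚ) =
      -16 * (4 * (f.map (Int.castRingHom ℚ)) ^ 3 + 27 * (g.map (Int.castRingHom ℚ)) ^ 2) := by
    simp [Dpoly, Polynomial.map_mul, Polynomial.map_add, Polynomial.map_pow]
  have hD' : (Dpoly f g).map (Int.castRingHom ℚ) ≠ 0 := by
    rwa [Ne, Polynomial.map_eq_zero_iff (RingHom.injective_int _)]
  apply hj
  by_cases hg : g ^ 2 = 0
  · refine ⟨1728, ?_⟩
    have hg0 : g = 0 := by simpa using hg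
    rw [hmap, hg0]
    have : (Polynomial.C (1728 : ℚ)) = (1728 : Polynomial ℚ) := rfl
    rw [this]
    simp
    ring
  · obtain ⟨j0, hj0⟩ : ∃ j, (g ^ 2).coeff j ≠ 0 := by
      by_contra! h0
      exact hg (Polynomial.ext (by simpa using h0))
    set s : ℚ := ((f ^ 3).coeff j0 : ℚ) / ((g ^ 2).coeff j0 : ℚ) with hs
    have hj0' : ((g ^ 2).coeff j0 : ℚ) ≠ 0 := by exact_mod_cast hj0
    have hf : (f.map (Int.castRingHom ℚ)) ^ 3 =
        Polynomial.C s * (g.map (Int.castRingHom ℚ)) ^ 2 := by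
      rw [← Polynomial.map_pow, ← Polynomial.map_pow]
      ext i
      rw [Polynomial.coeff_C_mul, Polynomial.coeff_map, Polynomial.coeff_map, hs]
      have := hc i j0
      have h2 : ((f ^ 3).coeff i : ℚ) * (g ^ 2).coeff j0 = (f ^ 3).coeff j0 * (g ^ 2).coeff i := by
        exact_mod_cast sub_eq_zero.mp this
      simp only [eq_intCast]
      field_simp
      linarith
    have h4 : 4 * s + 27 ≠ 0 := by
      intro h0
      apply hD'
      rw [hmap, hf]
      have : (Polynomial.C (4 * s + 27 : ℚ)) = 0 := by rw [h0]; simp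
      have h3 : (4 : Polynomial ℚ) * Polynomial.C s + 27 = 0 := by
        rw [← this]; simp; rfl
      linear_combination (-16 * (g.map (Int.castRingHom ℚ)) ^ 2) * h3
    refine ⟨1728 * 4 * s / (4 * s + 27), ?_⟩
    rw [hmap, mul_pow, hf]
    have h5 : Polynomial.C (1728 * 4 * s / (4 * s + 27)) *
        ((4 : Polynomial ℚ) * Polynomial.C s + 27) = 1728 * 4 * Polynomial.C s := by
      have e1 : (4 : Polynomial ℚ) * Polynomial.C s + 27 = Polynomial.C (4 * s + 27) := by simp; rfl
      rw [e1, ← Polynomial.C_mul, div_mul_cancel₀ _ h4]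
      simp only [Polynomial.C_mul]
      rfl
    linear_combination (16 * (g.map (Int.castRingHom ℚ)) ^ 2) * h5

/-- The residue classes of `A³/B²` over all curves `Y² = X³ + AX + B` over `𝔽_p` with `AB ≠ 0`
and Frobenius trace `a`. -/
def traceClasses (p : ℕ) [NeZero p] (a : ℤ) : Finset (ZMod p) :=
  Finset.univ.filter fun z => ∃ A B : ZMod p, A ≠ 0 ∧ B ≠ 0 ∧ 4 * A ^ 3 + 27 * B ^ 2 ≠ 0 ∧
    frobTrace p A B = a ∧ A ^ 3 = z * B ^ 2

theorem card_fiber_le {f g : Polynomial ℤ} {i j : ℕ} (p : ℕ) [Fact p.Prime]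
    (hij : (((f ^ 3).coeff i * (g ^ 2).coeff j - (f ^ 3).coeff j * (g ^ 2).coeff i : ℤ) : ZMod p)
      ≠ 0) (a : ℤ) :
    (Finset.univ.filter fun t : ZMod p =>
      ((Dpoly f g).map (Int.castRingHom (ZMod p))).eval t ≠ 0 ∧
      frobTrace p ((f.map (Int.castRingHom (ZMod p))).eval t)
        ((g.map (Int.castRingHom (ZMod p))).eval t) = a).card ≤
      (3 * f.natDegree + 2 * g.natDegree) * (2 + (traceClasses p a).card) := by
  set F := f.map (Int.castRingHom (ZMod p)) with hF
  set G := g.map (Int.castRingHom (ZMod p)) with hG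
  set D := 3 * f.natDegree + 2 * g.natDegree with hD
  have key : ∀ u v : ZMod p, (u ≠ 0 ∨ v ≠ 0) →
      Polynomial.C u * F ^ 3 + Polynomial.C v * G ^ 2 ≠ 0 := by
    intro u v huv h0
    have hc : ∀ n, u * ((f ^ 3).coeff n : ZMod p) + v * ((g ^ 2).coeff n : ZMod p) = 0 := by
      intro n
      have := congrArg (fun q => q.coeff n) h0
      simp only [Polynomial.coeff_add, Polynomial.coeff_C_mul, Polynomial.coeff_zero] at this
      rw [hF, hG, ← Polynomial.map_pow, ← Polynomial.map_pow, Polynomial.coeff_map,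
        Polynomial.coeff_map] at this
      simpa using this
    push_cast at hij
    have hi := hc i
    have hj := hc j
    rcases huv with hu | hv
    · apply hu
      have : u * ((((f ^ 3).coeff i : ℤ) : ZMod p) * ((g ^ 2).coeff j : ℤ) -
        (((f ^ 3).coeff j : ℤ) : ZMod p) * ((g ^ 2).coeff i : ℤ)) = 0 := by
        linear_combination (((g ^ 2).coeff j : ℤ) : ZMod p) * hi -
          (((g ^ 2).coeff i : ℤ) : ZMod p) * hj
      exact (mul_eq_zero.mp this).resolve_right hij
    · apply hv
      have : v * ((((f ^ 3).coeff i : ℤ) : ZMod p) * ((g ^ 2).coeff j : ℤ) -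
        (((f ^ 3).coeff j : ℤ) : ZMod p) * ((g ^ 2).coeff i : ℤ)) = 0 := by
        linear_combination (((f ^ 3).coeff i : ℤ) : ZMod p) * hj -
          (((f ^ 3).coeff j : ℤ) : ZMod p) * hi
      exact (mul_eq_zero.mp this).resolve_right hij
  have deg : ∀ u v : ZMod p, (Polynomial.C u * F ^ 3 + Polynomial.C v * G ^ 2).natDegree ≤ D := by
    intro u v
    have h1 : F.natDegree ≤ f.natDegree := Polynomial.natDegree_map_le
    have h2 : G.natDegree ≤ g.natDegree := Polynomial.natDegree_map_le
    refine (Polynomial.natDegree_add_le _ _).trans (max_le ?_ ?_)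
    · refine (Polynomial.natDegree_C_mul_le _ _).trans
        ((Polynomial.natDegree_pow_le).trans ?_)
      omega
    · refine (Polynomial.natDegree_C_mul_le _ _).trans
        ((Polynomial.natDegree_pow_le).trans ?_)
      omega
  have cardR : ∀ u v : ZMod p,
      (Polynomial.C u * F ^ 3 + Polynomial.C v * G ^ 2).roots.toFinset.card ≤ D := fun u v =>
    (Multiset.toFinset_card_le _).trans ((Polynomial.card_roots' _).trans (deg u v))
  have hsub : (Finset.univ.filter fun t : ZMod p =>
      ((Dpoly f g).map (Int.castRingHom (ZMod p))).eval t ≠ 0 ∧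
      frobTrace p (F.eval t) (G.eval t) = a) ⊆
      ((Polynomial.C 1 * F ^ 3 + Polynomial.C 0 * G ^ 2).roots.toFinset ∪
      (Polynomial.C 0 * F ^ 3 + Polynomial.C 1 * G ^ 2).roots.toFinset) ∪
      (traceClasses p a).biUnion fun z =>
        (Polynomial.C 1 * F ^ 3 + Polynomial.C (-z) * G ^ 2).roots.toFinset := by
    intro t ht
    simp only [Finset.mem_filter, Finset.mem_univ, true_and] at ht
    obtain ⟨h1, h2⟩ := ht
    rw [Finset.mem_union, Finset.mem_union, Multiset.mem_toFinset, Multiset.mem_toFinset,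
      Polynomial.mem_roots (key _ _ (by simp)), Polynomial.mem_roots (key _ _ (by simp))]
    by_cases hA : F.eval t = 0
    · left; left; simp [hA]
    by_cases hB : G.eval t = 0
    · left; right; simp [hB]
    right
    rw [Finset.mem_biUnion]
    refine ⟨(F.eval t) ^ 3 / (G.eval t) ^ 2, ?_, ?_⟩
    · simp only [traceClasses, Finset.mem_filter, Finset.mem_univ, true_and]
      refine ⟨F.eval t, G.eval t, hA, hB, ?_, h2, ?_⟩
      · intro h0
        apply h1
        simp only [Dpoly, Polynomial.map_mul, Polynomial.map_add, Polynomial.map_pow,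
          Polynomial.map_neg, Polynomial.map_ofNat, Polynomial.eval_mul, Polynomial.eval_add,
          Polynomial.eval_pow, Polynomial.eval_neg, Polynomial.eval_ofNat]
        rw [← hF, ← hG, h0, mul_zero]
      · field_simp
    · rw [Multiset.mem_toFinset, Polynomial.mem_roots (key _ _ (by simp))]
      simp [Polynomial.IsRoot]
      field_simp
      ring
  refine (Finset.card_le_card hsub).trans ?_
  refine (Finset.card_union_le _ _).trans ?_
  have e1 := (Finset.card_union_le
    (Polynomial.C (1 : ZMod p) * F ^ 3 + Polynomial.C 0 * G ^ 2).roots.toFinset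
    (Polynomial.C (0 : ZMod p) * F ^ 3 + Polynomial.C 1 * G ^ 2).roots.toFinset)
  have e2 := Finset.card_biUnion_le_card_mul (traceClasses p a) (fun z =>
        (Polynomial.C 1 * F ^ 3 + Polynomial.C (-z) * G ^ 2).roots.toFinset) D
        (fun z _ => cardR 1 (-z))
  have e3 := cardR 1 0
  have e4 := cardR 0 1
  nlinarith

theorem redQ_natCast (p t : ℕ) : redQ p (t : ℚ) = (t : ZMod p) := by
  simp [redQ]

theorem sum_filter_cast_eq (T : ℕ) (P : ℚ → Prop) [DecidablePred P] (F : ℚ → ℝ) :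
    (∑ t ∈ (Finset.Icc 1 T).filter fun t => P (t : ℚ), F (t : ℚ)) =
      ∑ t ∈ (Finset.Icc 1 T : Finset ℕ).filter (fun t : ℕ => P (t : ℚ)), F (t : ℚ) := by
  have h : ((Finset.Icc 1 T >>= fun a : ℕ => pure (a : ℚ)) : Finset ℚ) =
      (Finset.Icc 1 T).image (fun a : ℕ => (a : ℚ)) := by
    ext q
    simp [Finset.bind_def, eq_comm]
  rw [h, Finset.filter_image, Finset.sum_image (by simp)]

theorem sum_piSeq_le_of_card_traceClasses_le
    (hK : ∀ ε : ℝ, 0 < ε → ∃ C : ℝ, 0 < C ∧ ∃ P : ℕ, ∀ (p : ℕ) [Fact p.Prime], P ≤ p → ∀ a : ℤ,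
      ((traceClasses p a).card : ℝ) ≤ C * (p : ℝ) ^ (1 / 2 + ε))
    (f g : Polynomial ℤ) (hfg : Nondeg f g) (ε : ℝ) (hε : 0 < ε) :
    ∃ C : ℝ, 0 < C ∧ ∀ T : ℕ, 0 < T → ∀ x : ℝ, 2 ≤ x → ∀ a : ℕ → ℤ,
      (∑ t ∈ (Finset.Icc 1 T).filter fun t => aeval (t : ℚ) (Dpoly f g) ≠ 0,
          (piSeq f g a (t : ℚ) x : ℝ)) ≤
        C * ((T : ℝ) ^ 2 + (T : ℝ) ^ ((1 : ℝ) / 2) * x ^ (5 / 4 + ε)) := by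
  obtain ⟨C, hC, P, hP⟩ := hK (2 * ε) (by positivity)
  obtain ⟨i, j, hij⟩ := exists_coeff_minor_ne_zero hfg
  set m : ℤ := (f ^ 3).coeff i * (g ^ 2).coeff j - (f ^ 3).coeff j * (g ^ 2).coeff i with hm
  set B : ℕ := P + m.natAbs with hB
  set D : ℕ := 3 * f.natDegree + 2 * g.natDegree with hD
  set K : ℝ := ((D : ℝ) * (2 + C)) ^ ((1 : ℝ) / 2) with hKdef
  have hK0 : 0 ≤ K := by positivity
  refine ⟨1 + B + K, by positivity, ?_⟩
  intro T hT x hx a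
  have hx0 : 0 < x := by linarith
  rw [sum_filter_cast_eq T (fun t => aeval t (Dpoly f g) ≠ 0) (fun t => (piSeq f g a t x : ℝ))]
  set S : Finset ℕ := (Finset.Icc 1 T : Finset ℕ).filter
    (fun t : ℕ => aeval (t : ℚ) (Dpoly f g) ≠ 0) with hS
  set M : ℕ → ℕ := fun p => (S.filter fun t : ℕ =>
    p.Prime ∧ goodRed f g p (t : ℚ) ∧ apE f g p (t : ℚ) = a p).card with hM
  have hswap : (∑ t ∈ S, (piSeq f g a (t : ℚ) x : ℝ)) =
      ∑ p ∈ Finset.Icc 1 ⌊x⌋₊, (M p : ℝ) := by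
    simp only [piSeq, hM, Finset.card_filter, Nat.cast_sum]
    exact Finset.sum_comm
  rw [hswap]
  have hMT : ∀ p, (M p : ℝ) ≤ T := by
    intro p
    have h1 : M p ≤ (Finset.Icc 1 T).card :=
      Finset.card_le_card ((Finset.filter_subset _ _).trans (Finset.filter_subset _ _))
    rw [Nat.card_Icc] at h1
    exact_mod_cast h1
  have hmain : ∀ p ∈ Finset.Icc 1 ⌊x⌋₊, (M p : ℝ) ≤
      (if p ≤ B + T then (T : ℝ) else 0) + (T : ℝ) ^ ((1 : ℝ) / 2) * (K * x ^ (1 / 4 + ε)) := by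
    intro p hp
    have hpos : 0 ≤ (T : ℝ) ^ ((1 : ℝ) / 2) * (K * x ^ (1 / 4 + ε)) := by positivity
    by_cases hpB : p ≤ B + T
    · rw [if_pos hpB]
      linarith [hMT p]
    rw [if_neg hpB, zero_add]
    by_cases hpp : p.Prime
    swap
    · have : M p = 0 := by simp [hM, hpp]
      rw [this]; simpa using hpos
    have : Fact p.Prime := ⟨hpp⟩
    have hmp : ((m : ℤ) : ZMod p) ≠ 0 := by
      rw [Ne, ZMod.intCast_zmod_eq_zero_iff_dvd]
      intro hd
      have := Nat.le_of_dvd (Int.natAbs_pos.mpr hij) (Int.natCast_dvd.mp hd)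
      omega
    have h1 := card_fiber_le p hmp (a p)
    have h2 : M p ≤ (Finset.univ.filter fun t : ZMod p =>
      ((Dpoly f g).map (Int.castRingHom (ZMod p))).eval t ≠ 0 ∧
      frobTrace p ((f.map (Int.castRingHom (ZMod p))).eval t)
        ((g.map (Int.castRingHom (ZMod p))).eval t) = a p).card := by
      refine Finset.card_le_card_of_injOn (fun t : ℕ => (t : ZMod p)) ?_ ?_
      · intro t ht
        simp only [Finset.coe_filter, Set.mem_ofPred_eq] at ht
        obtain ⟨-, -, ⟨-, h3⟩, h4⟩ := ht
        simp only [Finset.coe_filter, Set.mem_ofPred_eq, Finset.mem_univ, true_and]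
        rw [redQ_natCast] at h3
        rw [apE, redQ_natCast] at h4
        exact ⟨h3, h4⟩
      · intro s hs t ht hst
        have hs' := (Finset.mem_Icc.mp (Finset.mem_filter.mp (Finset.mem_filter.mp hs).1).1).2
        have ht' := (Finset.mem_Icc.mp (Finset.mem_filter.mp (Finset.mem_filter.mp ht).1).1).2
        have := (ZMod.natCast_eq_natCast_iff' s t p).mp hst
        rwa [Nat.mod_eq_of_lt (by omega), Nat.mod_eq_of_lt (by omega)] at this
    have hpx : (p : ℝ) ≤ x :=
      (Nat.cast_le.mpr (Finset.mem_Icc.mp hp).2).trans (Nat.floor_le hx0.le)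
    have hx1 : 1 ≤ x ^ (1 / 2 + 2 * ε) := Real.one_le_rpow (by linarith) (by positivity)
    have h3 : (M p : ℝ) ≤ D * (2 + C) * x ^ (1 / 2 + 2 * ε) := by
      have h4 : (M p : ℝ) ≤ D * (2 + (traceClasses p (a p)).card) := by
        exact_mod_cast h2.trans h1
      have h5 := hP p (by omega) (a p)
      have h6 : (p : ℝ) ^ (1 / 2 + 2 * ε) ≤ x ^ (1 / 2 + 2 * ε) :=
        Real.rpow_le_rpow (by positivity) hpx (by positivity)
      have h7 : C * (p : ℝ) ^ (1 / 2 + 2 * ε) ≤ C * x ^ (1 / 2 + 2 * ε) :=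
        mul_le_mul_of_nonneg_left h6 hC.le
      calc (M p : ℝ) ≤ D * (2 + (traceClasses p (a p)).card) := h4
        _ ≤ D * (2 * x ^ (1 / 2 + 2 * ε) + C * x ^ (1 / 2 + 2 * ε)) := by
          apply mul_le_mul_of_nonneg_left _ (by positivity)
          linarith
        _ = _ := by ring
    have h0 : (0 : ℝ) ≤ M p := by positivity
    calc (M p : ℝ) = (M p : ℝ) ^ ((1 : ℝ) / 2) * (M p : ℝ) ^ ((1 : ℝ) / 2) := by
          rw [← Real.sqrt_eq_rpow, Real.mul_self_sqrt h0]
      _ ≤ (T : ℝ) ^ ((1 : ℝ) / 2) * (D * (2 + C) * x ^ (1 / 2 + 2 * ε)) ^ ((1 : ℝ) / 2) := by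
          gcongr
          exact_mod_cast hMT p
      _ = _ := by
          rw [Real.mul_rpow (by positivity) (by positivity), ← Real.rpow_mul hx0.le]
          congr 3
          ring
  refine (Finset.sum_le_sum hmain).trans ?_
  rw [Finset.sum_add_distrib, Finset.sum_const, Nat.card_Icc, nsmul_eq_mul, Nat.add_sub_cancel]
  have hfirst : (∑ p ∈ Finset.Icc 1 ⌊x⌋₊, (if p ≤ B + T then (T : ℝ) else 0)) ≤
      (B + T) * T := by
    rw [← Finset.sum_filter, Finset.sum_const, nsmul_eq_mul]
    have : ((Finset.Icc 1 ⌊x⌋₊).filter (fun p => p ≤ B + T)).card ≤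
        (Finset.Icc 1 (B + T)).card := by
      apply Finset.card_le_card
      intro p hp
      simp only [Finset.mem_filter, Finset.mem_Icc] at hp ⊢
      exact ⟨hp.1.1, hp.2⟩
    rw [Nat.card_Icc, Nat.add_sub_cancel] at this
    have h2 : (((Finset.Icc 1 ⌊x⌋₊).filter (fun p => p ≤ B + T)).card : ℝ) ≤ B + T := by
      exact_mod_cast this
    exact mul_le_mul_of_nonneg_right h2 (by positivity)
  have hsecond : (⌊x⌋₊ : ℝ) * ((T : ℝ) ^ ((1 : ℝ) / 2) * (K * x ^ (1 / 4 + ε))) ≤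
      K * ((T : ℝ) ^ ((1 : ℝ) / 2) * x ^ (5 / 4 + ε)) := by
    have h1 : x ^ (5 / 4 + ε) = x * x ^ (1 / 4 + ε) := by
      rw [show (5 / 4 + ε : ℝ) = 1 + (1 / 4 + ε) by ring, Real.rpow_add hx0, Real.rpow_one]
    rw [h1]
    calc (⌊x⌋₊ : ℝ) * ((T : ℝ) ^ ((1 : ℝ) / 2) * (K * x ^ (1 / 4 + ε))) ≤
        x * ((T : ℝ) ^ ((1 : ℝ) / 2) * (K * x ^ (1 / 4 + ε))) :=
          mul_le_mul_of_nonneg_right (Nat.floor_le hx0.le) (by positivity)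
      _ = _ := by ring
  have hT1 : (1 : ℝ) ≤ T := by exact_mod_cast hT
  have hR : 0 ≤ (T : ℝ) ^ ((1 : ℝ) / 2) * x ^ (5 / 4 + ε) := by positivity
  have hBT : (B : ℝ) * T ≤ B * T ^ 2 := by
    apply mul_le_mul_of_nonneg_left _ (by positivity)
    nlinarith
  have hB0 : (0 : ℝ) ≤ B := by positivity
  nlinarith [mul_nonneg hK0 (sq_nonneg (T : ℝ)), mul_nonneg hB0 hR]

theorem exists_card_divisors_le_rpow (ε : ℝ) (hε : 0 < ε) :
    ∃ C : ℝ, 0 < C ∧ ∀ n : ℕ, n ≠ 0 → (n.divisors.card : ℝ) ≤ C * (n : ℝ) ^ ε := by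
  have hl : 0 < Real.log 2 := Real.log_pos (by norm_num)
  set K : ℝ := 1 + 1 / (ε * Real.log 2) with hK
  have hK1 : 1 ≤ K := by
    have : 0 < 1 / (ε * Real.log 2) := by positivity
    linarith
  set Q : ℕ := ⌈(2 : ℝ) ^ (1 / ε)⌉₊ with hQ
  refine ⟨K ^ Q, by positivity, ?_⟩
  intro n hn
  rw [Nat.card_divisors hn]
  push_cast
  have hn' : (n : ℝ) ^ ε = ∏ q ∈ n.primeFactors, ((q : ℝ) ^ ε) ^ (n.factorization q) := by
    conv_lhs => rw [← Nat.prod_factorization_pow_eq_self hn]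
    rw [Finsupp.prod, Nat.support_factorization, Nat.cast_prod,
      ← Real.finsetProd_rpow _ _ (fun i _ => by positivity)]
    refine Finset.prod_congr rfl fun q _ => ?_
    rw [Nat.cast_pow, ← Real.rpow_natCast, ← Real.rpow_natCast, ← Real.rpow_mul (by positivity),
      ← Real.rpow_mul (by positivity), mul_comm]
  have hstep : ∀ q ∈ n.primeFactors, ((n.factorization q : ℝ) + 1) ≤
      (if q < Q then K else 1) * ((q : ℝ) ^ ε) ^ (n.factorization q) := by
    intro q hq
    have hq2 : 2 ≤ q := (Nat.prime_of_mem_primeFactors hq).two_le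
    have hq2' : (2 : ℝ) ≤ q := by exact_mod_cast hq2
    set e := n.factorization q
    split_ifs with h
    · have h1 : ((2 : ℝ) ^ ε) ^ e ≤ ((q : ℝ) ^ ε) ^ e := by gcongr
      have h2 : 1 + e * (ε * Real.log 2) ≤ ((2 : ℝ) ^ ε) ^ e := by
        rw [← Real.rpow_natCast, ← Real.rpow_mul (by norm_num),
          Real.rpow_def_of_pos (by norm_num)]
        have := Real.add_one_le_exp (Real.log 2 * (ε * e))
        linarith
      have h3 : (e : ℝ) + 1 ≤ K * (1 + e * (ε * Real.log 2)) := by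
        rw [hK]
        have h4 : (1 + 1 / (ε * Real.log 2)) * (1 + e * (ε * Real.log 2)) =
          1 + e + e * (ε * Real.log 2) + 1 / (ε * Real.log 2) := by
          field_simp
          ring
        rw [h4]
        have : 0 ≤ e * (ε * Real.log 2) + 1 / (ε * Real.log 2) := by positivity
        linarith
      exact h3.trans (mul_le_mul_of_nonneg_left (h2.trans h1) (by linarith))
    · rw [one_mul]
      have h1 : (2 : ℝ) ≤ (q : ℝ) ^ ε := by
        have h2 : (2 : ℝ) ^ (1 / ε) ≤ q :=
          (Nat.le_ceil _).trans (by exact_mod_cast not_lt.mp h)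
        calc (2 : ℝ) = ((2 : ℝ) ^ (1 / ε)) ^ ε := by
              rw [← Real.rpow_mul (by norm_num), one_div_mul_cancel hε.ne', Real.rpow_one]
          _ ≤ _ := Real.rpow_le_rpow (by positivity) h2 hε.le
      calc ((e : ℝ) + 1) ≤ (2 : ℝ) ^ e := by exact_mod_cast Nat.lt_two_pow_self
        _ ≤ _ := by gcongr
  refine (Finset.prod_le_prod (fun _ _ => by positivity) hstep).trans ?_
  rw [Finset.prod_mul_distrib, ← hn']
  refine mul_le_mul_of_nonneg_right ?_ (by positivity)
  rw [← Finset.prod_filter, Finset.prod_const]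
  refine pow_le_pow_right₀ hK1 ?_
  calc (n.primeFactors.filter (fun q => q < Q)).card ≤ (Finset.range Q).card := by
        apply Finset.card_le_card
        intro q hq
        simpa using (Finset.mem_filter.mp hq).2
    _ = Q := Finset.card_range Q

/-- Integer matrices of determinant `p` with prescribed fourth power of the trace modulo `p`
fixing a point of the standard fundamental domain. -/
def IsReducedMatrix (p : ℕ) (t : ℤ) (M : Matrix (Fin 2) (Fin 2) ℤ) : Prop :=
  M.det = p ∧ M.trace ^ 2 < 4 * p ∧ ((M.trace : ℤ) : ZMod p) ^ 4 = ((t : ℤ) : ZMod p) ^ 4 ∧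
    |M 0 0 - M 1 1| ≤ |M 1 0| ∧ |M 1 0| ≤ |M 0 1|

theorem card_traces_le (p : ℕ) [Fact p.Prime] (hp : 17 ≤ p) (t : ℤ) :
    ((Finset.Icc (-(2 * p : ℤ)) (2 * p)).filter fun r : ℤ =>
      r ^ 2 < 4 * p ∧ ((r : ℤ) : ZMod p) ^ 4 = ((t : ℤ) : ZMod p) ^ 4).card ≤ 4 := by
  have h1 : (Polynomial.nthRoots 4 (((t : ℤ) : ZMod p) ^ 4)).toFinset.card ≤ 4 :=
    (Multiset.toFinset_card_le _).trans (Polynomial.card_nthRoots 4 _)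
  refine le_trans (Finset.card_le_card_of_injOn (fun r : ℤ => (r : ZMod p)) ?_ ?_) h1
  · intro r hr
    simp only [Finset.coe_filter, Set.mem_ofPred_eq] at hr
    simp only [Finset.mem_coe, Multiset.mem_toFinset]
    rw [Polynomial.mem_nthRoots (by norm_num)]
    exact hr.2.2
  · intro r hr s hs hrs
    simp only [Finset.coe_filter, Set.mem_ofPred_eq] at hr hs
    have hp' : (17 : ℤ) ≤ p := by exact_mod_cast hp
    have hd : (p : ℤ) ∣ s - r := (ZMod.intCast_eq_intCast_iff_dvd_sub r s p).mp hrs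
    by_contra hne
    have hle : (p : ℤ) ≤ |s - r| :=
      Int.le_of_dvd (abs_pos.mpr (sub_ne_zero.mpr (Ne.symm hne))) ((dvd_abs _ _).mpr hd)
    have h2 : (s - r) ^ 2 < 16 * p := by nlinarith [sq_nonneg (s + r), hr.2.1, hs.2.1]
    have h3 : (p : ℤ) ^ 2 ≤ (s - r) ^ 2 := by
      rw [← sq_abs (s - r)]
      exact pow_le_pow_left₀ (by positivity) hle 2
    nlinarith

theorem IsReducedMatrix.bounds {p : ℕ} {t : ℤ} {M : Matrix (Fin 2) (Fin 2) ℤ} (hp : 0 < p)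
    (h : IsReducedMatrix p t M) :
    (M 0 0 - M 1 1) ^ 2 ≤ 2 * p ∧ M 0 0 * M 1 1 - p ≠ 0 ∧ |M 0 0 * M 1 1 - p| ≤ 2 * p ∧
      M 0 1 * M 1 0 = M 0 0 * M 1 1 - p := by
  obtain ⟨h1, h2, -, h4, h5⟩ := h
  rw [Matrix.det_fin_two] at h1
  rw [Matrix.trace_fin_two] at h2
  have hp' : (0 : ℤ) < p := by exact_mod_cast hp
  have e : M 0 1 * M 1 0 = M 0 0 * M 1 1 - p := by linarith
  set s := M 0 0 - M 1 1
  have e2 : 4 * (M 0 1 * M 1 0) = (M 0 0 + M 1 1) ^ 2 - 4 * p - s ^ 2 := by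
    rw [e]; simp only [s]; ring
  have hneg : M 0 1 * M 1 0 < 0 := by nlinarith [sq_nonneg s]
  have hs : s ^ 2 ≤ -(M 0 1 * M 1 0) := by
    rw [← abs_of_neg hneg, abs_mul, ← sq_abs s]
    nlinarith [abs_nonneg s, abs_nonneg (M 1 0)]
  have hb : 3 * (-(M 0 1 * M 1 0)) ≤ 4 * p := by nlinarith [sq_nonneg (M 0 0 + M 1 1)]
  refine ⟨by linarith, by rw [← e]; exact hneg.ne, ?_, e⟩
  rw [← e, abs_of_neg hneg]
  linarith

theorem exists_ncard_isReducedMatrix_le (ε : ℝ) (hε : 0 < ε) :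
    ∃ C : ℝ, 0 < C ∧ ∀ (p : ℕ) [Fact p.Prime], 17 ≤ p → ∀ t : ℤ,
      {M | IsReducedMatrix p t M}.Finite ∧
      ({M | IsReducedMatrix p t M}.ncard : ℝ) ≤ C * (p : ℝ) ^ (1 / 2 + ε) := by
  obtain ⟨C, hC, hdiv⟩ := exists_card_divisors_le_rpow ε hε
  refine ⟨4 * 5 * (2 * (C * 2 ^ ε)), by positivity, ?_⟩
  intro p hpp hp t
  have hp0 : 0 < p := hpp.out.pos
  set R := (Finset.Icc (-(2 * p : ℤ)) (2 * p)).filter fun r : ℤ =>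
      r ^ 2 < 4 * p ∧ ((r : ℤ) : ZMod p) ^ 4 = ((t : ℤ) : ZMod p) ^ 4 with hR
  set q : ℕ := Nat.sqrt (2 * p) with hq
  set c : ℤ × ℤ → Finset ℤ := fun rs =>
    if ((rs.1 ^ 2 - rs.2 ^ 2) / 4 - p).natAbs ≠ 0 ∧
      ((rs.1 ^ 2 - rs.2 ^ 2) / 4 - p).natAbs ≤ 2 * p then
    (((rs.1 ^ 2 - rs.2 ^ 2) / 4 - p).natAbs.divisors.image (fun n : ℕ => (n : ℤ))) ∪
    (((rs.1 ^ 2 - rs.2 ^ 2) / 4 - p).natAbs.divisors.image (fun n : ℕ => -(n : ℤ))) else ∅ with hc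
  set U : Finset ((ℤ × ℤ) × ℤ) :=
    (R ×ˢ Finset.Icc (-(q : ℤ)) q).biUnion fun rs => (c rs).image fun z => (rs, z) with hU
  set F : Matrix (Fin 2) (Fin 2) ℤ → (ℤ × ℤ) × ℤ := fun M =>
    ((M.trace, M 0 0 - M 1 1), M 1 0) with hF
  have hmaps : ∀ M ∈ {M | IsReducedMatrix p t M}, F M ∈ (U : Set ((ℤ × ℤ) × ℤ)) := by
    intro M hM
    obtain ⟨b1, b2, b3, b4⟩ := hM.bounds hp0
    obtain ⟨h1, h2, h3, h4, h5⟩ := hM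
    have e4 : (M.trace ^ 2 - (M 0 0 - M 1 1) ^ 2) / 4 = M 0 0 * M 1 1 := by
      rw [Matrix.trace_fin_two]
      apply Int.ediv_eq_of_eq_mul_right (by norm_num)
      ring
    simp only [hU, Finset.coe_biUnion, Set.mem_iUnion, Finset.coe_image, Finset.mem_coe]
    refine ⟨(M.trace, M 0 0 - M 1 1), ?_, ?_⟩
    · rw [Finset.mem_product]
      constructor
      · simp only [hR, Finset.mem_filter]
        refine ⟨?_, h2, h3⟩
        have : |M.trace| ≤ 2 * p := by
          apply abs_le_of_sq_le_sq _ (by positivity)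
          have : (17 : ℤ) ≤ p := by exact_mod_cast hp
          nlinarith
        rw [Finset.mem_Icc]
        exact abs_le.mp this
      · rw [Finset.mem_Icc, ← abs_le]
        have : (M 0 0 - M 1 1).natAbs ≤ q := by
          rw [hq, Nat.le_sqrt']
          zify
          rw [sq_abs]
          exact b1
        show |M 0 0 - M 1 1| ≤ q
        rw [Int.abs_eq_natAbs]
        exact_mod_cast this
    · refine ⟨M 1 0, ?_, rfl⟩
      simp only [hc, e4]
      rw [if_pos]
      · have hdvd : (M 1 0).natAbs ∈ (M 0 0 * M 1 1 - (p : ℤ)).natAbs.divisors := by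
          rw [Nat.mem_divisors]
          exact ⟨Int.natAbs_dvd_natAbs.mpr ⟨M 0 1, by rw [← b4]; ring⟩, Int.natAbs_ne_zero.mpr b2⟩
        rw [Finset.mem_coe, Finset.mem_union, Finset.mem_image, Finset.mem_image]
        rcases Int.natAbs_eq (M 1 0) with h | h
        · left; exact ⟨_, hdvd, h.symm⟩
        · right; exact ⟨_, hdvd, h.symm⟩
      · refine ⟨Int.natAbs_ne_zero.mpr b2, ?_⟩
        rw [Int.abs_eq_natAbs] at b3
        exact_mod_cast b3
  have hinj : Set.InjOn F {M | IsReducedMatrix p t M} := by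
    intro M hM N hN hMN
    obtain ⟨-, b2, -, b4⟩ := hM.bounds hp0
    obtain ⟨-, -, -, b4'⟩ := hN.bounds hp0
    simp only [hF, Prod.mk.injEq, Matrix.trace_fin_two] at hMN
    obtain ⟨⟨e1, e2⟩, e3⟩ := hMN
    have e00 : M 0 0 = N 0 0 := by linarith
    have e11 : M 1 1 = N 1 1 := by linarith
    have e01 : M 0 1 = N 0 1 := by
      have h0 : M 1 0 ≠ 0 := by
        intro h; rw [h, mul_zero] at b4; exact b2 b4.symm
      apply mul_right_cancel₀ h0
      rw [b4, e3, b4', e00, e11]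
    ext i j
    fin_cases i <;> fin_cases j <;> assumption
  have hcard : ({M | IsReducedMatrix p t M}.ncard) ≤ U.card := by
    rw [← Set.ncard_coe_finset]
    exact Set.ncard_le_ncard_of_injOn F hmaps hinj U.finite_toSet
  refine ⟨Set.Finite.of_injOn hmaps hinj U.finite_toSet, ?_⟩
  have hcb : ∀ rs, ((c rs).card : ℝ) ≤ 2 * (C * (2 * p : ℝ) ^ ε) := by
    intro rs
    simp only [hc]
    split_ifs with h
    · have h1 := (Finset.card_union_le
        (((rs.1 ^ 2 - rs.2 ^ 2) / 4 - p).natAbs.divisors.image (fun n : ℕ => (n : ℤ)))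
        (((rs.1 ^ 2 - rs.2 ^ 2) / 4 - p).natAbs.divisors.image (fun n : ℕ => -(n : ℤ)))).trans
        (add_le_add Finset.card_image_le Finset.card_image_le)
      set n := ((rs.1 ^ 2 - rs.2 ^ 2) / 4 - (p : ℤ)).natAbs
      have h2 := hdiv n h.1
      have h3 : (n : ℝ) ^ ε ≤ (2 * p : ℝ) ^ ε := by
        apply Real.rpow_le_rpow (by positivity) _ hε.le
        exact_mod_cast h.2
      refine (Nat.cast_le.mpr h1).trans ?_
      push_cast
      have h4 := mul_le_mul_of_nonneg_left h3 hC.le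
      linarith
    · simp only [Finset.card_empty, Nat.cast_zero]
      positivity
  have hUc : (U.card : ℝ) ≤ (4 * (2 * q + 1)) * (2 * (C * (2 * p : ℝ) ^ ε)) := by
    calc (U.card : ℝ) ≤ ∑ rs ∈ R ×ˢ Finset.Icc (-(q : ℤ)) q,
          (((c rs).image fun z => (rs, z)).card : ℝ) := by
          exact_mod_cast Finset.card_biUnion_le
      _ ≤ ∑ rs ∈ R ×ˢ Finset.Icc (-(q : ℤ)) q, 2 * (C * (2 * p : ℝ) ^ ε) := by
          refine Finset.sum_le_sum fun rs _ => ?_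
          exact (Nat.cast_le.mpr Finset.card_image_le).trans (hcb rs)
      _ = ((R ×ˢ Finset.Icc (-(q : ℤ)) q).card : ℝ) * (2 * (C * (2 * p : ℝ) ^ ε)) := by
          rw [Finset.sum_const, nsmul_eq_mul]
      _ ≤ _ := by
          apply mul_le_mul_of_nonneg_right _ (by positivity)
          rw [Finset.card_product, Int.card_Icc]
          have hR4 : R.card ≤ 4 := card_traces_le p hp t
          have : ((q : ℤ) + 1 - -q).toNat = 2 * q + 1 := by omega
          rw [this]
          have := Nat.mul_le_mul_right (2 * q + 1) hR4
          exact_mod_cast this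
  have hqp : (2 * q + 1 : ℝ) ≤ 5 * (p : ℝ) ^ ((1 : ℝ) / 2) := by
    rw [← Real.sqrt_eq_rpow]
    have hp1 : (1 : ℝ) ≤ √p := by
      rw [Real.one_le_sqrt]
      exact_mod_cast hp0
    have h1 : (q : ℝ) ≤ 2 * √p := by
      apply le_of_sq_le_sq _ (by positivity)
      rw [mul_pow, Real.sq_sqrt (by positivity)]
      have : q ^ 2 ≤ 2 * p := Nat.sqrt_le' _
      have h2 : (q : ℝ) ^ 2 ≤ 2 * p := by exact_mod_cast this
      nlinarith
    linarith
  have hpR : (0 : ℝ) < p := by exact_mod_cast hp0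
  calc ({M | IsReducedMatrix p t M}.ncard : ℝ) ≤ U.card := by exact_mod_cast hcard
    _ ≤ _ := hUc
    _ ≤ (4 * (5 * (p : ℝ) ^ ((1 : ℝ) / 2))) * (2 * (C * (2 * p : ℝ) ^ ε)) := by
      apply mul_le_mul_of_nonneg_right _ (by positivity)
      linarith
    _ = _ := by
      rw [Real.mul_rpow (by norm_num) hpR.le, Real.rpow_add hpR]
      ring

theorem sum_pow_zmod (p : ℕ) [Fact p.Prime] (i : ℕ) (hi : i < 2 * (p - 1)) :
    ∑ x : ZMod p, x ^ i = if i = p - 1 then -1 else 0 := by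
  have hp := (Fact.out : p.Prime).two_le
  by_cases h0 : i < p - 1
  · have h1 := FiniteField.sum_pow_lt_card_sub_one (ZMod p) i (by rwa [ZMod.card])
    rw [h1, if_neg (by omega)]
  have hi0 : i ≠ 0 := by omega
  have h2 := FiniteField.sum_pow_units (ZMod p) i
  rw [ZMod.card] at h2
  have h3 : ∑ x : ZMod p, x ^ i = ∑ x : (ZMod p)ˣ, (x ^ i : ZMod p) := by
    rw [← Finset.sum_subset (Finset.subset_univ ((Finset.univ : Finset (ZMod p)).erase 0))]
    · symm
      refine Finset.sum_bij (fun u _ => (u : ZMod p)) (by simp) ?_ ?_ (by simp)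
      · intro u _ v _ h; exact Units.ext h
      · intro x hx
        exact ⟨Units.mk0 x (Finset.ne_of_mem_erase hx), Finset.mem_univ _, rfl⟩
    · intro x _ hx
      have : x = 0 := by simpa using hx
      rw [this, zero_pow hi0]
  rw [h3, h2]
  congr 1
  rw [eq_iff_iff]
  constructor
  · rintro ⟨k, hk⟩
    have : k = 1 := by
      have h4 : k < 2 := by
        by_contra! h5
        have := Nat.mul_le_mul_left (p - 1) h5
        omega
      have h5 : k ≠ 0 := by rintro rfl; omega
      omega
    rw [hk, this, mul_one]
  · intro h; rw [h]

theorem sum_eval_eq_neg_coeff (p : ℕ) [Fact p.Prime] (G : Polynomial (ZMod p))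
    (hdeg : G.natDegree < 2 * (p - 1)) : ∑ x : ZMod p, G.eval x = -G.coeff (p - 1) := by
  have hp2 := (Fact.out : p.Prime).two_le
  simp_rw [Polynomial.eval_eq_sum_range' hdeg]
  rw [Finset.sum_comm]
  simp_rw [← Finset.mul_sum]
  rw [Finset.sum_congr rfl (fun i hi => by rw [sum_pow_zmod p i (Finset.mem_range.mp hi)])]
  simp only [mul_ite, mul_neg, mul_one, mul_zero]
  rw [Finset.sum_ite_eq' (Finset.range (2 * (p - 1))) (p - 1), if_pos]
  rw [Finset.mem_range]; omega

/-- The Frobenius trace modulo `p` is the Hasse invariant. -/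
theorem frobTrace_cast (p : ℕ) [Fact p.Prime] (hp : p ≠ 2) (A B : ZMod p) :
    ((frobTrace p A B : ℤ) : ZMod p) =
      (((Polynomial.X ^ 3 + Polynomial.C A * Polynomial.X + Polynomial.C B) ^ ((p - 1) / 2) :
        Polynomial (ZMod p))).coeff (p - 1) := by
  set F : Polynomial (ZMod p) :=
    Polynomial.X ^ 3 + Polynomial.C A * Polynomial.X + Polynomial.C B with hF
  have hp2 := (Fact.out : p.Prime).two_le
  have hodd : p % 2 = 1 := (Fact.out : p.Prime).eq_two_or_odd.resolve_left hp
  have hm : p / 2 = (p - 1) / 2 := by omega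
  have hrc : ringChar (ZMod p) ≠ 2 := by rwa [ZMod.ringChar_zmod_n]
  have hcount : (Nat.card {P : ZMod p × ZMod p // P.2 ^ 2 = P.1 ^ 3 + A * P.1 + B} : ℤ) =
      ∑ x : ZMod p, (quadraticChar (ZMod p) (F.eval x) + 1) := by
    rw [Nat.card_eq_fintype_card, Fintype.card_subtype]
    have : (Finset.univ.filter fun P : ZMod p × ZMod p => P.2 ^ 2 = P.1 ^ 3 + A * P.1 + B).card =
        ∑ x : ZMod p, (Finset.univ.filter fun y : ZMod p => y ^ 2 = F.eval x).card := by
      rw [Finset.card_eq_sum_card_fiberwise (f := Prod.fst) (t := Finset.univ) (by simp)]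
      refine Finset.sum_congr rfl fun x _ => ?_
      refine Finset.card_bij' (fun P _ => P.2) (fun y _ => (x, y)) ?_ ?_ ?_ ?_
      · rintro ⟨a, b⟩ h
        simp only [Finset.mem_filter, Finset.mem_univ, true_and] at h
        obtain ⟨h1, rfl⟩ := h
        simp [hF, h1]
      · intro y h
        simp only [Finset.mem_filter, Finset.mem_univ, true_and] at h
        simp [hF, h]
      · rintro ⟨a, b⟩ h
        simp only [Finset.mem_filter, Finset.mem_univ, true_and] at h
        simp [h.2]
      · intro y h; rfl
    rw [this]
    push_cast
    refine Finset.sum_congr rfl fun x _ => ?_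
    rw [← quadraticChar_card_sqrts hrc (F.eval x)]
    congr 2
    ext y; simp
  have hsum : ((Nat.card {P : ZMod p × ZMod p // P.2 ^ 2 = P.1 ^ 3 + A * P.1 + B} : ℕ) : ZMod p) =
      ∑ x : ZMod p, (F ^ ((p - 1) / 2)).eval x := by
    have h1 := congrArg (fun z : ℤ => (z : ZMod p)) hcount
    simp only [Int.cast_natCast, Int.cast_sum, Int.cast_add, Int.cast_one] at h1
    rw [h1, Finset.sum_add_distrib]
    simp only [Finset.sum_const, Finset.card_univ, ZMod.card, nsmul_eq_mul, CharP.cast_eq_zero,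
      zero_mul, add_zero]
    refine Finset.sum_congr rfl fun x _ => ?_
    rw [quadraticChar_eq_pow_of_char_ne_two' hrc, ZMod.card, hm, Polynomial.eval_pow]
  have hdeg : (F ^ ((p - 1) / 2)).natDegree < 2 * (p - 1) := by
    have h3 : F.natDegree ≤ 3 := by rw [hF]; compute_degree
    have h4 : (F ^ ((p - 1) / 2)).natDegree ≤ (p - 1) / 2 * F.natDegree :=
      Polynomial.natDegree_pow_le
    have h5 := Nat.mul_le_mul_left ((p - 1) / 2) h3
    omega
  have heval := sum_eval_eq_neg_coeff p _ hdeg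
  rw [frobTrace, numPoints]
  push_cast
  rw [hsum, heval]
  simp

theorem coeff_cube_pow_eq (p : ℕ) [Fact p.Prime] (hp : p ≠ 2) :
    (((Polynomial.X ^ 3 + Polynomial.C (-3) * Polynomial.X + Polynomial.C (-2)) ^ ((p - 1) / 2) :
        Polynomial (ZMod p))).coeff (p - 1) = (-3) ^ ((p - 1) / 2) := by
  have hp2 := (Fact.out : p.Prime).two_le
  have hodd : p % 2 = 1 := (Fact.out : p.Prime).eq_two_or_odd.resolve_left hp
  set F : Polynomial (ZMod p) :=
    Polynomial.X ^ 3 + Polynomial.C (-3) * Polynomial.X + Polynomial.C (-2) with hF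
  have hdeg : (F ^ ((p - 1) / 2)).natDegree < 2 * (p - 1) := by
    have h3 : F.natDegree ≤ 3 := by rw [hF]; compute_degree
    have h4 : (F ^ ((p - 1) / 2)).natDegree ≤ (p - 1) / 2 * F.natDegree :=
      Polynomial.natDegree_pow_le
    have h5 := Nat.mul_le_mul_left ((p - 1) / 2) h3
    omega
  have h1 := sum_eval_eq_neg_coeff p _ hdeg
  have h2 : ∀ x : ZMod p, (F ^ ((p - 1) / 2)).eval x =
      (x - 2) ^ ((p - 1) / 2) - if x = -1 then (-3) ^ ((p - 1) / 2) else 0 := by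
    intro x
    have e : F.eval x = (x + 1) ^ 2 * (x - 2) := by
      simp [hF]; ring
    rw [Polynomial.eval_pow, e, mul_pow, ← pow_mul, show 2 * ((p - 1) / 2) = p - 1 by omega]
    split_ifs with h
    · subst h
      rw [neg_add_cancel, zero_pow (by omega)]
      ring
    · rw [ZMod.pow_card_sub_one_eq_one (fun h0 => h (by linear_combination h0))]
      ring
  have h3 : ∑ x : ZMod p, (x - 2) ^ ((p - 1) / 2) = 0 := by
    rw [Fintype.sum_equiv (Equiv.subRight (2 : ZMod p)) (fun x => (x - 2) ^ ((p - 1) / 2))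
      (fun x => x ^ ((p - 1) / 2)) (fun x => rfl)]
    exact FiniteField.sum_pow_lt_card_sub_one (ZMod p) _ (by rw [ZMod.card]; omega)
  simp_rw [h2] at h1
  rw [Finset.sum_sub_distrib, h3, Finset.sum_ite_eq' Finset.univ (-1 : ZMod p),
    if_pos (Finset.mem_univ _)] at h1
  linear_combination h1

/-- Polynomials in `X 0, X 1` that are homogeneous of weight `k` for the weights `4, 6`. -/
def homPoly (R : Type*) [CommRing R] (k : ℕ) : Submodule R (MvPolynomial (Fin 2) R) :=
  Submodule.span R {P | ∃ a b : ℕ, 4 * a + 6 * b = k ∧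
    P = MvPolynomial.X 0 ^ a * MvPolynomial.X 1 ^ b}

namespace homPoly

variable {R : Type*} [CommRing R]

theorem monomial_mem {k : ℕ} (a b : ℕ) (h : 4 * a + 6 * b = k) :
    (MvPolynomial.X 0 ^ a * MvPolynomial.X 1 ^ b : MvPolynomial (Fin 2) R) ∈ homPoly R k :=
  Submodule.subset_span ⟨a, b, h, rfl⟩

theorem mul_mem {k l : ℕ} {P Q : MvPolynomial (Fin 2) R} (hP : P ∈ homPoly R k)
    (hQ : Q ∈ homPoly R l) : P * Q ∈ homPoly R (k + l) := by
  have h : P * Q ∈ homPoly R k * homPoly R l := Submodule.mul_mem_mul hP hQ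
  rw [homPoly, homPoly, Submodule.span_mul_span] at h
  refine Submodule.span_mono ?_ h
  rintro _ ⟨_, ⟨a, b, h1, rfl⟩, _, ⟨c, d, h2, rfl⟩, rfl⟩
  exact ⟨a + c, b + d, by omega, by simp only; ring⟩

theorem one_mem : (1 : MvPolynomial (Fin 2) R) ∈ homPoly R 0 := by
  simpa using monomial_mem (R := R) 0 0 rfl

theorem pow_mem {k : ℕ} {P : MvPolynomial (Fin 2) R} (hP : P ∈ homPoly R k) (n : ℕ) :
    P ^ n ∈ homPoly R (n * k) := by
  induction n with
  | zero => simpa using one_mem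
  | succ n ih => rw [pow_succ, Nat.add_mul, one_mul]; exact mul_mem ih hP

theorem C_mul_mem {k : ℕ} {P : MvPolynomial (Fin 2) R} (hP : P ∈ homPoly R k) (c : R) :
    MvPolynomial.C c * P ∈ homPoly R k := by
  rw [← MvPolynomial.smul_eq_C_mul]
  exact Submodule.smul_mem _ _ hP

theorem X0_mem : (MvPolynomial.X 0 : MvPolynomial (Fin 2) R) ∈ homPoly R 4 := by
  simpa using monomial_mem (R := R) 1 0 rfl

theorem X1_mem : (MvPolynomial.X 1 : MvPolynomial (Fin 2) R) ∈ homPoly R 6 := by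
  simpa using monomial_mem (R := R) 0 1 rfl

theorem map_mem {S : Type*} [CommRing S] (φ : R →+* S) {k : ℕ} {P : MvPolynomial (Fin 2) R}
    (hP : P ∈ homPoly R k) : MvPolynomial.map φ P ∈ homPoly S k := by
  induction hP using Submodule.span_induction with
  | mem P h =>
    obtain ⟨a, b, h, rfl⟩ := h
    simpa using monomial_mem (R := S) a b h
  | zero => simp
  | add P Q _ _ h1 h2 => rw [map_add]; exact add_mem h1 h2
  | smul c P _ h =>
    rw [MvPolynomial.smul_eq_C_mul, map_mul, MvPolynomial.map_C]
    exact C_mul_mem h _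

theorem eval₂_scale {S : Type*} [CommRing S] (φ : R →+* S) {k : ℕ} {P : MvPolynomial (Fin 2) R}
    (hP : P ∈ homPoly R k) (t x y : S) :
    MvPolynomial.eval₂ φ ![t ^ 4 * x, t ^ 6 * y] P = t ^ k * MvPolynomial.eval₂ φ ![x, y] P := by
  induction hP using Submodule.span_induction with
  | mem P h =>
    obtain ⟨a, b, rfl, rfl⟩ := h
    simp only [MvPolynomial.eval₂_mul, MvPolynomial.eval₂_pow, MvPolynomial.eval₂_X,
      Matrix.cons_val_zero, Matrix.cons_val_one]
    ring
  | zero => simp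
  | add P Q _ _ h1 h2 => rw [MvPolynomial.eval₂_add, MvPolynomial.eval₂_add, h1, h2]; ring
  | smul c P _ h =>
    rw [MvPolynomial.smul_eq_C_mul, MvPolynomial.eval₂_mul, MvPolynomial.eval₂_mul, h,
      MvPolynomial.eval₂_C, MvPolynomial.eval₂_C]
    ring

/-- The polynomial `X³ - Y²`, i.e. `1728 Δ`. -/
def disc (R : Type*) [CommRing R] : MvPolynomial (Fin 2) R :=
  MvPolynomial.X 0 ^ 3 - MvPolynomial.X 1 ^ 2

theorem disc_mem : disc R ∈ homPoly R 12 :=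
  sub_mem (pow_mem X0_mem 3) (pow_mem X1_mem 2)

theorem exists_eq_add_disc_mul {k : ℕ} {P : MvPolynomial (Fin 2) R} (hP : P ∈ homPoly R k) :
    ∃ (c : R) (a b : ℕ) (Q : MvPolynomial (Fin 2) R),
      Q ∈ (if 12 ≤ k then homPoly R (k - 12) else ⊥) ∧
      P = MvPolynomial.C c * (MvPolynomial.X 0 ^ a * MvPolynomial.X 1 ^ b) + disc R * Q := by
  by_cases hk : ∃ a b : ℕ, 4 * a + 6 * b = k ∧ a ≤ 2
  · obtain ⟨a₀, b₀, h₀, ha₀⟩ := hk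
    suffices h : ∃ (c : R) (Q : MvPolynomial (Fin 2) R),
      Q ∈ (if 12 ≤ k then homPoly R (k - 12) else ⊥) ∧
      P = MvPolynomial.C c * (MvPolynomial.X 0 ^ a₀ * MvPolynomial.X 1 ^ b₀) + disc R * Q by
      obtain ⟨c, Q, h⟩ := h
      exact ⟨c, a₀, b₀, Q, h⟩
    induction hP using Submodule.span_induction with
    | mem P h =>
      obtain ⟨a, b, h, rfl⟩ := h
      refine ⟨1, ?_⟩
      induction a using Nat.strong_induction_on generalizing b with
      | _ a ih =>
        by_cases ha : a ≤ 2
        · have h1 : a = a₀ := by omega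
          have h2 : b = b₀ := by omega
          subst h1 h2
          exact ⟨0, Submodule.zero_mem _, by simp⟩
        · obtain ⟨Q, hQ, h3⟩ := ih (a - 3) (by omega) (b + 2) (by omega)
          refine ⟨Q + MvPolynomial.X 0 ^ (a - 3) * MvPolynomial.X 1 ^ b, add_mem hQ ?_, ?_⟩
          · rw [if_pos (by omega)]
            exact monomial_mem _ _ (by omega)
          · obtain ⟨a', rfl⟩ : ∃ a', a = a' + 3 := ⟨a - 3, by omega⟩
            rw [Nat.add_sub_cancel] at h3 ⊢
            rw [disc] at h3 ⊢
            linear_combination h3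
    | zero => exact ⟨0, 0, Submodule.zero_mem _, by simp⟩
    | add P P' _ _ h1 h2 =>
      obtain ⟨c, Q, h1, rfl⟩ := h1
      obtain ⟨c', Q', h1', rfl⟩ := h2
      exact ⟨c + c', Q + Q', add_mem h1 h1', by rw [MvPolynomial.C_add]; ring⟩
    | smul d P _ h1 =>
      obtain ⟨c, Q, h1, rfl⟩ := h1
      exact ⟨d * c, d • Q, Submodule.smul_mem _ _ h1, by
        rw [MvPolynomial.C_mul, MvPolynomial.smul_eq_C_mul, MvPolynomial.smul_eq_C_mul]; ring⟩
  · have hP0 : P = 0 := by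
      have : homPoly R k = ⊥ := by
        rw [homPoly, Submodule.span_eq_bot]
        rintro _ ⟨a, b, h, rfl⟩
        exact absurd ⟨a % 3, b + 2 * (a / 3), by omega, by omega⟩ hk
      rwa [this, Submodule.mem_bot] at hP
    exact ⟨0, 0, 0, 0, Submodule.zero_mem _, by simp [hP0]⟩

/-- A homogeneous polynomial in two power series that behave like `E₄, E₆` vanishes as soon as
its value vanishes to order larger than `k / 12`. -/
theorem eq_zero_of_X_pow_dvd {κ : Type*} [Field κ] {E F : PowerSeries κ}
    (hE : PowerSeries.constantCoeff E = 1) (hF : PowerSeries.constantCoeff F = 1)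
    {u : PowerSeries κ} (hu : PowerSeries.constantCoeff u ≠ 0)
    (hEF : E ^ 3 - F ^ 2 = PowerSeries.X * u) {k m : ℕ} (hkm : k < 12 * m)
    {P : MvPolynomial (Fin 2) κ} (hP : P ∈ homPoly κ k)
    (h : PowerSeries.X ^ m ∣ MvPolynomial.aeval ![E, F] P) : P = 0 := by
  induction k using Nat.strong_induction_on generalizing m P with
  | _ k ih =>
    obtain ⟨c, a, b, Q, hQ, rfl⟩ := exists_eq_add_disc_mul hP
    have hd : MvPolynomial.aeval ![E, F] (disc κ) = PowerSeries.X * u := by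
      simp [disc, hEF]
    obtain ⟨m, rfl⟩ : ∃ n, m = n + 1 := ⟨m - 1, by omega⟩
    rw [map_add, map_mul (MvPolynomial.aeval ![E, F]) (disc κ), hd] at h
    have hc : c = 0 := by
      have h1 : PowerSeries.X ∣ MvPolynomial.aeval ![E, F]
          (MvPolynomial.C c * (MvPolynomial.X 0 ^ a * MvPolynomial.X 1 ^ b)) := by
        have h2 := (dvd_pow_self (PowerSeries.X : PowerSeries κ) (Nat.succ_ne_zero m)).trans h
        rw [mul_assoc] at h2
        exact (dvd_add_left (Dvd.intro _ rfl)).mp h2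
      rw [PowerSeries.X_dvd_iff] at h1
      simpa [hE, hF, PowerSeries.algebraMap_apply] using h1
    subst hc
    simp only [map_zero, zero_mul, zero_add] at h ⊢
    split_ifs at hQ with h12
    · have hQ0 : Q = 0 := by
        refine @ih (k - 12) (by omega) m (by omega) Q hQ ?_
        rw [pow_succ', mul_assoc] at h
        have h3 := (mul_dvd_mul_iff_left PowerSeries.X_ne_zero).mp h
        have hunit : IsUnit u := PowerSeries.isUnit_iff_constantCoeff.mpr
          (isUnit_iff_ne_zero.mpr hu)
        exact (hunit.dvd_mul_left).mp h3
      rw [hQ0, mul_zero]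
    · rw [Submodule.mem_bot] at hQ
      rw [hQ, mul_zero]

end homPoly

section HasseDerivative

open scoped Differential

variable {S : Type*} [CommRing S]

/-- The cubic `x³ - 3Ex - 2F`. -/
def weierstrassCubic (E F : S) : Polynomial S :=
  Polynomial.X ^ 3 - Polynomial.C (3 * E) * Polynomial.X - Polynomial.C (2 * F)

theorem derivative_weierstrassCubic (E F : S) :
    Polynomial.derivative (weierstrassCubic E F) = 3 * Polynomial.X ^ 2 - Polynomial.C (3 * E) := by
  have : (3 : Polynomial S) = Polynomial.C 3 := rfl
  have h2 : (2 : Polynomial S) = Polynomial.C 2 := rfl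
  simp [weierstrassCubic, this]
  rw [← this, ← h2]
  ring

theorem mapCoeffs_weierstrassCubic_pow [Differential S] {E F P : S} {m : ℕ}
    (hp : (2 * m + 1 : S) = 0)
    (hE : 3 * E′ = P * E - F) (hF : 2 * F′ = P * F - E ^ 2) :
    12 * Differential.mapCoeffs (weierstrassCubic E F ^ m) =
      weierstrassCubic E F ^ m * (-Polynomial.C P - Polynomial.X) -
      2 * Polynomial.derivative ((-Polynomial.X ^ 2 + 2 * Polynomial.C E +
        Polynomial.C P * Polynomial.X) * weierstrassCubic E F ^ m) := by
  have hw : Polynomial.derivative (-Polynomial.X ^ 2 + 2 * Polynomial.C E +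
        Polynomial.C P * Polynomial.X) = -2 * Polynomial.X + Polynomial.C P := by
    have : (2 : Polynomial S) = Polynomial.C 2 := rfl
    simp [this]
    rw [← this]
    ring
  have hθ : Differential.mapCoeffs (weierstrassCubic E F) =
      -3 * Polynomial.C E′ * Polynomial.X - 2 * Polynomial.C F′ := by
    have e3 : (3 : Polynomial S) = Polynomial.C 3 := rfl
    have e2 : (2 : Polynomial S) = Polynomial.C 2 := rfl
    have d3 : (3 : S)′ = 0 := Derivation.map_natCast _ 3
    have d2 : (2 : S)′ = 0 := Derivation.map_natCast _ 2
    rw [weierstrassCubic, map_sub, map_sub, Derivation.leibniz_pow, Derivation.leibniz,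
      Differential.mapCoeffs_X, Differential.mapCoeffs_C, Differential.mapCoeffs_C,
      Derivation.leibniz, Derivation.leibniz, d3, d2, e3, e2]
    simp
    ring
  have hEC : 3 * Polynomial.C E′ = Polynomial.C P * Polynomial.C E - Polynomial.C F := by
    rw [← Polynomial.C_mul, ← Polynomial.C_sub, ← hE, Polynomial.C_mul]; rfl
  have hFC : 2 * Polynomial.C F′ = Polynomial.C P * Polynomial.C F - Polynomial.C E ^ 2 := by
    rw [← Polynomial.C_mul, ← Polynomial.C_pow, ← Polynomial.C_sub, ← hF, Polynomial.C_mul]; rfl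
  have hδ := derivative_weierstrassCubic E F
  have hpC : (2 * (m : Polynomial S) + 1) = 0 := by
    have := congrArg (Polynomial.C : S → Polynomial S) hp
    rw [Polynomial.C_add, Polynomial.C_mul, Polynomial.C_0, Polynomial.C_1] at this
    exact this
  have hA : 6 * Differential.mapCoeffs (weierstrassCubic E F) =
      3 * weierstrassCubic E F * (Polynomial.C P - Polynomial.X) -
      (-Polynomial.X ^ 2 + 2 * Polynomial.C E + Polynomial.C P * Polynomial.X) *
        Polynomial.derivative (weierstrassCubic E F) := by
    have e3 : Polynomial.C (3 * E) = 3 * Polynomial.C E := by rw [Polynomial.C_mul]; rfl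
    have e2 : Polynomial.C (2 * F) = 2 * Polynomial.C F := by rw [Polynomial.C_mul]; rfl
    rw [hθ, hδ, weierstrassCubic, e3, e2]
    linear_combination (-6 * Polynomial.X) * hEC - 6 * hFC
  rw [Polynomial.derivative_mul, hw]
  rcases m with _ | n
  · simp only [pow_zero, Polynomial.derivative_one, Nat.cast_zero, mul_zero, zero_add] at hpC ⊢
    have h1 : ∀ Q : Polynomial S, Q = 0 := fun Q => by rw [← one_mul Q, hpC, zero_mul]
    rw [h1 (12 * _), h1 (_ - _)]
  · rw [Derivation.leibniz_pow, Polynomial.derivative_pow]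
    simp only [Nat.add_sub_cancel, nsmul_eq_mul, smul_eq_mul, Polynomial.C_eq_natCast]
    push_cast at hpC ⊢
    linear_combination (2 * (n + 1) * weierstrassCubic E F ^ n) * hA +
      (3 * weierstrassCubic E F ^ (n + 1) * (Polynomial.C P - Polynomial.X)) * hpC

theorem deriv_deriv_hasse [Differential S] {E F P : S} {m : ℕ}
    (hp : (2 * m + 1 : S) = 0)
    (hE : 3 * E′ = P * E - F) (hF : 2 * F′ = P * F - E ^ 2) (hP : 12 * P′ = P ^ 2 - E) :
    144 * ((weierstrassCubic E F ^ m).coeff (2 * m))′′ = 0 := by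
  set φ := weierstrassCubic E F with hφ
  have key := mapCoeffs_weierstrassCubic_pow hp hE hF
  rw [← hφ] at key
  have hcd : ∀ Q : Polynomial S, (Polynomial.derivative Q).coeff (2 * m) = 0 := by
    intro Q
    rw [Polynomial.coeff_derivative]
    push_cast
    rw [hp, mul_zero]
  set H := (φ ^ m).coeff (2 * m) with hH
  set H1 := (Polynomial.X * φ ^ m).coeff (2 * m) with hH1
  set H2 := (Polynomial.X ^ 2 * φ ^ m).coeff (2 * m) with hH2
  have hnum : ∀ (n : ℕ) (Q : Polynomial S),
      ((n : Polynomial S) * Q).coeff (2 * m) = n * Q.coeff (2 * m) := by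
    intro n Q
    rw [← Polynomial.C_eq_natCast, Polynomial.coeff_C_mul]
  have e1 : 12 * H′ = -(P * H) - H1 := by
    have h := congrArg (fun Q => Polynomial.coeff Q (2 * m)) key
    simp only [Polynomial.coeff_sub] at h
    have h12 := hnum 12 (Differential.mapCoeffs (φ ^ m))
    have h2 := hnum 2 (Polynomial.derivative ((-Polynomial.X ^ 2 + 2 * Polynomial.C E +
        Polynomial.C P * Polynomial.X) * φ ^ m))
    rw [hcd] at h2
    push_cast at h12 h2
    rw [h12, h2, Differential.coeff_mapCoeffs,
      show φ ^ m * (-Polynomial.C P - Polynomial.X) =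
        -(Polynomial.C P * φ ^ m) - Polynomial.X * φ ^ m by ring, Polynomial.coeff_sub,
      Polynomial.coeff_neg, Polynomial.coeff_C_mul] at h
    rw [h]
    ring
  have e3 : 3 * H2 = 3 * (E * H) := by
    have h1 := hcd (φ ^ (m + 1))
    rw [Polynomial.derivative_pow, Nat.add_sub_cancel, hφ, derivative_weierstrassCubic, ← hφ,
      show Polynomial.C ((m + 1 : ℕ) : S) * φ ^ m * (3 * Polynomial.X ^ 2 - Polynomial.C (3 * E)) =
        Polynomial.C (3 * (m + 1 : S)) * (Polynomial.X ^ 2 * φ ^ m - Polynomial.C E * φ ^ m) by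
        have : (3 : Polynomial S) = Polynomial.C 3 := rfl
        push_cast [this]
        simp only [map_mul, map_add]
        ring,
      Polynomial.coeff_C_mul, Polynomial.coeff_sub, Polynomial.coeff_C_mul] at h1
    linear_combination 2 * h1 - 3 * (H2 - E * H) * hp
  have e2 : 12 * H1′ = P * H1 + E * H := by
    have h := congrArg (fun Q => Polynomial.coeff (Polynomial.X * Q) (2 * m)) key
    have hexp : Polynomial.X * (φ ^ m * (-Polynomial.C P - Polynomial.X) -
        2 * Polynomial.derivative ((-Polynomial.X ^ 2 + 2 * Polynomial.C E +
        Polynomial.C P * Polynomial.X) * φ ^ m)) =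
        Polynomial.C P * (Polynomial.X * φ ^ m) - ((3 : ℕ) : Polynomial S) *
          (Polynomial.X ^ 2 * φ ^ m) +
          ((4 : ℕ) : Polynomial S) * (Polynomial.C E * φ ^ m) -
        ((2 : ℕ) : Polynomial S) * Polynomial.derivative (Polynomial.X *
          ((-Polynomial.X ^ 2 + 2 * Polynomial.C E +
        Polynomial.C P * Polynomial.X) * φ ^ m)) := by
      rw [Polynomial.derivative_mul (f := Polynomial.X), Polynomial.derivative_X]
      push_cast
      ring
    have hXθ : Polynomial.X * (12 * Differential.mapCoeffs (φ ^ m)) =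
        ((12 : ℕ) : Polynomial S) * Differential.mapCoeffs (Polynomial.X * φ ^ m) := by
      rw [Derivation.leibniz, Differential.mapCoeffs_X]
      simp only [smul_eq_mul, mul_zero, add_zero]
      push_cast
      ring
    beta_reduce at h
    rw [hexp, hXθ, Polynomial.coeff_sub, Polynomial.coeff_add, Polynomial.coeff_sub, hnum, hnum,
      hnum, hnum, hcd, Differential.coeff_mapCoeffs, Polynomial.coeff_C_mul,
      Polynomial.coeff_C_mul] at h
    push_cast at h
    linear_combination h - e3
  have d12 : (12 : S)′ = 0 := Derivation.map_natCast _ 12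
  have d1 := congrArg (fun y : S => y′) e1
  simp only [Derivation.leibniz, map_sub, map_neg, smul_eq_mul, d12] at d1
  linear_combination 12 * d1 - H * hP - P * e1 - e2

end HasseDerivative

section HasseInvariant

/-- The Hasse invariant of `y² = x³ - 3Ex - 2F` in characteristic `2m + 1`. -/
def hasse {S : Type*} [CommRing S] (m : ℕ) (E F : S) : S :=
  (weierstrassCubic E F ^ m).coeff (2 * m)

theorem map_hasse {S T : Type*} [CommRing S] [CommRing T] (φ : S →+* T) (m : ℕ) (E F : S) :
    φ (hasse m E F) = hasse m (φ E) (φ F) := by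
  rw [hasse, hasse, ← Polynomial.coeff_map]
  congr 1
  have h3 : φ 3 = 3 := map_ofNat φ 3
  have h2 : φ 2 = 2 := map_ofNat φ 2
  simp [weierstrassCubic, h3, h2]

/-- The operator `q d/dq` on power series. -/
def qDeriv {R : Type*} [CommRing R] (f : PowerSeries R) : PowerSeries R :=
  PowerSeries.X * PowerSeries.derivative (R := R) f

/-- The differential ring structure given by an additive map satisfying the Leibniz rule. -/
abbrev differentialOfLeibniz {S : Type*} [CommRing S] (d : S →+ S)
    (h : ∀ a b, d (a * b) = a * d b + b * d a) : Differential S :=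
  ⟨Derivation.mk' d.toIntLinearMap h⟩

/-- Power series with the derivation `q d/dq`, as a differential ring. -/
abbrev qDifferential (R : Type*) [CommRing R] : Differential (PowerSeries R) :=
  differentialOfLeibniz
    { toFun := qDeriv
      map_zero' := by simp [qDeriv]
      map_add' := fun f g => by simp [qDeriv, mul_add] } fun f g => by
      change qDeriv (f * g) = f * qDeriv g + g * qDeriv f
      simp only [qDeriv, Derivation.leibniz, smul_eq_mul]
      ring

theorem coeff_qDeriv {R : Type*} [CommRing R] (f : PowerSeries R) (n : ℕ) :
    PowerSeries.coeff n (qDeriv f) = n * PowerSeries.coeff n f := by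
  rw [qDeriv]
  rcases n with _ | n
  · simp
  · rw [PowerSeries.coeff_succ_X_mul, PowerSeries.coeff_derivative]
    push_cast
    ring

theorem hasse_one_one (p : ℕ) [Fact p.Prime] (hp : p ≠ 2) (κ : Type*) [Field κ] [CharP κ p]
    (hp3 : p ≠ 3) : hasse ((p - 1) / 2) (1 : κ) 1 ^ 4 = 1 := by
  have hp2 := (Fact.out : p.Prime).two_le
  have hodd : p % 2 = 1 := (Fact.out : p.Prime).eq_two_or_odd.resolve_left hp
  have h1 : hasse ((p - 1) / 2) (1 : ZMod p) 1 = (-3) ^ ((p - 1) / 2) := by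
    rw [← coeff_cube_pow_eq p hp, hasse, show 2 * ((p - 1) / 2) = p - 1 by omega]
    congr 2
    rw [weierstrassCubic, Polynomial.C_neg, Polynomial.C_neg]
    simp only [mul_one]
    ring
  have h2 := map_hasse (ZMod.castHom (dvd_refl p) κ) ((p - 1) / 2) 1 1
  rw [map_one] at h2
  rw [← h2, ← map_pow, h1, ← pow_mul,
    show (p - 1) / 2 * 4 = (p - 1) * 2 by omega, pow_mul, ZMod.pow_card_sub_one_eq_one, one_pow,
    map_one]
  have h3 : ((3 : ℕ) : ZMod p) ≠ 0 := by
    rw [Ne, ZMod.natCast_eq_zero_iff]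
    intro h
    exact hp3 ((Nat.prime_dvd_prime_iff_eq Fact.out Nat.prime_three).mp h)
  simpa using h3

/-- The Hasse invariant evaluated at series satisfying Ramanujan's differential equations is
constant modulo `q ^ p`. -/
theorem X_pow_dvd_hasse_pow_four_sub_one (p : ℕ) [Fact p.Prime] (hp : 5 ≤ p) {κ : Type*} [Field κ]
    [CharP κ p] {E F P : PowerSeries κ}
    (hE0 : PowerSeries.constantCoeff E = 1) (hF0 : PowerSeries.constantCoeff F = 1)
    (hE : 3 * qDeriv E = P * E - F) (hF : 2 * qDeriv F = P * F - E ^ 2)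
    (hP : 12 * qDeriv P = P ^ 2 - E) :
    PowerSeries.X ^ p ∣ hasse ((p - 1) / 2) E F ^ 4 - 1 := by
  have hodd : p % 2 = 1 := (Fact.out : p.Prime).eq_two_or_odd.resolve_left (by omega)
  let _ := qDifferential κ
  have hpm : (2 * (((p - 1) / 2 : ℕ)) + 1 : PowerSeries κ) = 0 := by
    have h1 : ((p : ℕ) : κ) = 0 := CharP.cast_eq_zero κ p
    have h2 : ((p : ℕ) : PowerSeries κ) = 0 := by
      rw [← map_natCast (PowerSeries.C (R := κ)), h1, map_zero]
    rw [← h2]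
    conv_rhs => rw [show p = 2 * ((p - 1) / 2) + 1 by omega]
    push_cast
    rfl
  have key := deriv_deriv_hasse hpm hE hF hP
  change 144 * qDeriv (qDeriv (hasse ((p - 1) / 2) E F)) = 0 at key
  set H := hasse ((p - 1) / 2) E F with hH
  have h144 : ((144 : ℕ) : κ) ≠ 0 := by
    rw [Ne, CharP.cast_eq_zero_iff κ p]
    intro h
    replace h : p ∣ 2 ^ 4 * 3 ^ 2 := h
    rcases (Nat.Prime.dvd_mul Fact.out).mp h with h | h
    · have := Nat.le_of_dvd (by norm_num) ((Fact.out : p.Prime).dvd_of_dvd_pow h); omega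
    · have := Nat.le_of_dvd (by norm_num) ((Fact.out : p.Prime).dvd_of_dvd_pow h); omega
  have hcoeff : ∀ n, 0 < n → n < p → PowerSeries.coeff n H = 0 := by
    intro n hn hnp
    have h := congrArg (PowerSeries.coeff n) key
    have h1 : (144 : PowerSeries κ) = PowerSeries.C ((144 : ℕ) : κ) := by
      rw [map_natCast]; rfl
    rw [h1, PowerSeries.coeff_C_mul, coeff_qDeriv, coeff_qDeriv, map_zero] at h
    have hn0 : (n : κ) ≠ 0 := by
      rw [Ne, CharP.cast_eq_zero_iff κ p]
      exact fun h => absurd (Nat.le_of_dvd hn h) (by omega)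
    exact (mul_eq_zero.mp ((mul_eq_zero.mp ((mul_eq_zero.mp h).resolve_left h144)).resolve_left
      hn0)).resolve_left hn0
  set c := PowerSeries.constantCoeff H with hc
  have h1 : PowerSeries.X ^ p ∣ H - PowerSeries.C c := by
    rw [PowerSeries.X_pow_dvd_iff]
    intro n hn
    rcases Nat.eq_zero_or_pos n with rfl | hpos
    · simp [hc]
    · rw [map_sub, hcoeff n hpos hn, PowerSeries.coeff_C, if_neg hpos.ne', sub_zero]
  have hc4 : c ^ 4 = 1 := by
    rw [hc, hH, map_hasse, hE0, hF0]
    exact hasse_one_one p (by omega) κ (by omega)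
  have h2 : H ^ 4 - 1 = (H - PowerSeries.C c) *
      (H ^ 3 + H ^ 2 * PowerSeries.C c + H * PowerSeries.C c ^ 2 + PowerSeries.C c ^ 3) := by
    have : (1 : PowerSeries κ) = PowerSeries.C c ^ 4 := by rw [← map_pow, hc4, map_one]
    rw [this]
    ring
  rw [h2]
  exact Dvd.dvd.mul_right h1 _

theorem hasse_mem_homPoly (R : Type*) [CommRing R] (m : ℕ) :
    hasse m (MvPolynomial.X 0 : MvPolynomial (Fin 2) R) (MvPolynomial.X 1) ∈ homPoly R (2 * m) := by
  suffices h : ∀ m e : ℕ, ((weierstrassCubic (MvPolynomial.X 0 : MvPolynomial (Fin 2) R)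
      (MvPolynomial.X 1)) ^ m).coeff e ∈ (if 2 * e ≤ 6 * m then homPoly R (6 * m - 2 * e) else ⊥) by
    have := h m (2 * m)
    rw [if_pos (by omega)] at this
    rwa [show 6 * m - 2 * (2 * m) = 2 * m by omega] at this
  intro m
  induction m with
  | zero =>
    intro e
    rw [pow_zero, Polynomial.coeff_one]
    rcases e with _ | e
    · simpa using homPoly.one_mem
    · simp
  | succ m ih =>
    intro e
    have hexp : (weierstrassCubic (MvPolynomial.X 0 : MvPolynomial (Fin 2) R)
        (MvPolynomial.X 1)) ^ (m + 1) =
        (weierstrassCubic (MvPolynomial.X 0 : MvPolynomial (Fin 2) R) (MvPolynomial.X 1)) ^ m *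
          Polynomial.X ^ 3 -
        Polynomial.C (3 * MvPolynomial.X 0 : MvPolynomial (Fin 2) R) *
          ((weierstrassCubic (MvPolynomial.X 0 : MvPolynomial (Fin 2) R) (MvPolynomial.X 1)) ^ m *
            Polynomial.X) -
        Polynomial.C (2 * MvPolynomial.X 1 : MvPolynomial (Fin 2) R) *
          (weierstrassCubic (MvPolynomial.X 0 : MvPolynomial (Fin 2) R) (MvPolynomial.X 1)) ^
            m := by
      rw [pow_succ]
      generalize weierstrassCubic (MvPolynomial.X 0 : MvPolynomial (Fin 2) R)
        (MvPolynomial.X 1) ^ m = W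
      rw [weierstrassCubic]
      ring
    rw [hexp, Polynomial.coeff_sub, Polynomial.coeff_sub, Polynomial.coeff_C_mul,
      Polynomial.coeff_C_mul]
    have e3 : (3 : MvPolynomial (Fin 2) R) = MvPolynomial.C 3 := rfl
    have e2 : (2 : MvPolynomial (Fin 2) R) = MvPolynomial.C 2 := rfl
    refine sub_mem (sub_mem ?_ ?_) ?_
    · rcases lt_or_ge e 3 with h | h
      · rw [Polynomial.coeff_mul_X_pow', if_neg (by omega : ¬ 3 ≤ e)]
        exact zero_mem _
      · obtain ⟨d, rfl⟩ := Nat.exists_eq_add_of_le' h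
        rw [Polynomial.coeff_mul_X_pow]
        have := ih d
        split_ifs at this with h1
        · rwa [if_pos (by omega), show 6 * (m + 1) - 2 * (d + 3) = 6 * m - 2 * d by omega]
        · rwa [if_neg (by omega)]
    · rcases e with _ | d
      · simp
      · rw [Polynomial.coeff_mul_X, e3]
        have := ih d
        split_ifs at this with h
        · rw [if_pos (by omega), show 6 * (m + 1) - 2 * (d + 1) = 4 + (6 * m - 2 * d) by omega]
          exact homPoly.mul_mem (homPoly.C_mul_mem homPoly.X0_mem 3) this
        · rw [(Submodule.mem_bot R).mp this, mul_zero]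
          exact zero_mem _
    · have := ih e
      rw [e2]
      split_ifs at this with h
      · rw [if_pos (by omega), show 6 * (m + 1) - 2 * e = 6 + (6 * m - 2 * e) by omega]
        exact homPoly.mul_mem (homPoly.C_mul_mem homPoly.X1_mem 2) this
      · rw [(Submodule.mem_bot R).mp this, mul_zero]
        exact zero_mem _

end HasseInvariant

section QSeries

open UpperHalfPlane hiding I
open Function.Periodic Filter Topology
open scoped Manifold

/-- `F : ℍ → ℂ` is the sum of the power series `f` in `q = exp (2πiτ/h)`. -/
def HasQSeries (h : ℝ) (F : ℍ → ℂ) (f : PowerSeries ℂ) : Prop :=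
  ∀ τ : ℍ, HasSum (fun n => PowerSeries.coeff n f * qParam h τ ^ n) (F τ)

namespace HasQSeries

variable {h : ℝ} {F G : ℍ → ℂ} {f g : PowerSeries ℂ}

theorem isBounded (hh : 0 < h) (hF : HasQSeries h F f) : IsBoundedAtImInfty F :=
  isBoundedAtImInfty_of_hasSum_qExpansion hh hF

theorem add (hF : HasQSeries h F f) (hG : HasQSeries h G g) : HasQSeries h (F + G) (f + g) :=
  fun τ => by simpa [add_mul] using (hF τ).add (hG τ)

theorem sub (hF : HasQSeries h F f) (hG : HasQSeries h G g) : HasQSeries h (F - G) (f - g) :=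
  fun τ => by simpa [sub_mul] using (hF τ).sub (hG τ)

theorem const_mul (c : ℂ) (hF : HasQSeries h F f) :
    HasQSeries h (fun τ => c * F τ) (PowerSeries.C c * f) :=
  fun τ => by simpa [mul_assoc] using (hF τ).mul_left c

theorem const (c : ℂ) : HasQSeries h (fun _ => c) (PowerSeries.C c) := fun τ => by
  convert hasSum_ite_eq 0 c using 2 with n
  rw [PowerSeries.coeff_C]
  split_ifs with hn
  · rw [hn, pow_zero, mul_one]
  · rw [zero_mul]

theorem mul (hF : HasQSeries h F f) (hG : HasQSeries h G g) : HasQSeries h (F * G) (f * g) :=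
  fun τ => by
  have h1 := summable_norm_sum_mul_antidiagonal_of_summable_norm (hF τ).summable.norm
    (hG τ).summable.norm
  have h2 := tsum_mul_tsum_eq_tsum_sum_antidiagonal_of_summable_norm (hF τ).summable.norm
    (hG τ).summable.norm
  rw [(hF τ).tsum_eq, (hG τ).tsum_eq] at h2
  have h3 := h1.of_norm.hasSum
  rw [← h2] at h3
  refine h3.congr_fun fun n => ?_
  rw [PowerSeries.coeff_mul, Finset.sum_mul]
  refine Finset.sum_congr rfl fun x hx => ?_
  rw [← HasAntidiagonal.mem_antidiagonal.mp hx, pow_add]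
  ring

theorem pow (hF : HasQSeries h F f) (n : ℕ) : HasQSeries h (F ^ n) (f ^ n) := by
  induction n with
  | zero => simpa using! const (h := h) 1
  | succ n ih => rw [pow_succ, pow_succ]; exact ih.mul hF

theorem prod {ι : Type*} (s : Finset ι) {F : ι → ℍ → ℂ} {f : ι → PowerSeries ℂ}
    (hF : ∀ i ∈ s, HasQSeries h (F i) (f i)) : HasQSeries h (∏ i ∈ s, F i) (∏ i ∈ s, f i) := by
  induction s using Finset.induction_on with
  | empty => simpa using! const (h := h) 1
  | insert a s ha ih =>
    rw [Finset.prod_insert ha, Finset.prod_insert ha]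
    exact (hF a (by simp)).mul (ih fun i hi => hF i (by simp [hi]))

theorem unique_right (hh : 0 < h) (hF : HasQSeries h F f) (hG : HasQSeries h F g) : f = g := by
  have hd := hF.sub hG
  rw [sub_self] at hd
  rw [← sub_eq_zero]
  have hc : UpperHalfPlane.cuspFunction h 0 = 0 := by
    funext q
    rcases eq_or_ne q 0 with rfl | hq
    · simpa [UpperHalfPlane.cuspFunction, Function.Periodic.cuspFunction] using!
        tendsto_const_nhds.limUnder_eq
    · simp [UpperHalfPlane.cuspFunction, Function.Periodic.cuspFunction_eq_of_nonzero _ _ hq]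
  have h1 := hasFPowerSeriesOnBall_cuspFunction hh
    (c := fun n => PowerSeries.coeff n (f - g)) (f := 0) (by rw [hc]; exact analyticAt_const) hd
  rw [hc] at h1
  have h2 := h1.hasFPowerSeriesAt.eq_zero
  ext m
  have h3 := congrArg (fun s => FormalMultilinearSeries.coeff s m) h2
  simpa using! h3

theorem unique_left (hF : HasQSeries h F f) (hG : HasQSeries h G f) : F = G :=
  funext fun τ => (hF τ).unique (hG τ)

theorem summable_norm (hF : HasQSeries h F f) {t : ℝ} (ht : 0 < t) :
    Summable fun n => ‖PowerSeries.coeff n f‖ * Real.exp (-2 * Real.pi * t / h) ^ n := by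
  have := (hF ⟨t * Complex.I, by simpa⟩).summable.norm
  simp only [norm_mul, norm_pow, norm_qParam] at this
  simpa using this

theorem differentiable_aux (hF : HasQSeries h F f) (hh : 0 < h) (τ : ℍ) :
    DifferentiableAt ℂ (F ∘ ofComplex) τ ∧
    HasSum (fun n => PowerSeries.coeff n f * (n * (2 * Real.pi * Complex.I / h) * qParam h τ ^ n))
      (deriv (F ∘ ofComplex) τ) := by
  set t := τ.im / 2 with ht
  have htpos : 0 < t := by have := τ.im_pos; rw [ht]; linarith
  set U : Set ℂ := {w | t < w.im} with hU
  have hUo : IsOpen U := isOpen_lt continuous_const Complex.continuous_im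
  have hτU : (τ : ℂ) ∈ U := by
    change t < τ.im
    have := τ.im_pos
    rw [ht]; linarith
  have hqd : Differentiable ℂ (qParam h) := differentiable_qParam
  have hdiff : ∀ n : ℕ, DifferentiableOn ℂ (fun w => PowerSeries.coeff n f * qParam h w ^ n) U :=
    fun n => ((hqd.pow n).const_mul _).differentiableOn
  have hbound : ∀ (n : ℕ) (w : ℂ), w ∈ U → ‖PowerSeries.coeff n f * qParam h w ^ n‖ ≤
      ‖PowerSeries.coeff n f‖ * Real.exp (-2 * Real.pi * t / h) ^ n := by
    intro n w hw
    rw [norm_mul, norm_pow, norm_qParam]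
    have hw' : t < w.im := hw
    gcongr ?_ * ?_ ^ n
    rw [Real.exp_le_exp]
    apply div_le_div_of_nonneg_right _ hh.le
    nlinarith [Real.pi_pos]
  have hsum := hF.summable_norm htpos
  have heq : Set.EqOn (fun w => ∑' n, PowerSeries.coeff n f * qParam h w ^ n)
      (F ∘ ofComplex) U := by
    intro w hw
    have hw0 : 0 < w.im := htpos.trans hw
    have := (hF ⟨w, hw0⟩).tsum_eq
    simpa [ofComplex_apply_of_im_pos hw0] using this
  have hev := heq.eventuallyEq_of_mem (hUo.mem_nhds hτU)
  refine ⟨((Complex.differentiableOn_tsum_of_summable_norm hsum hdiff hUo hbound).differentiableAt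
    (hUo.mem_nhds hτU)).congr_of_eventuallyEq hev.symm, ?_⟩
  have h1 := Complex.hasSum_deriv_of_summable_norm hsum hdiff hUo hbound hτU
  rw [hev.deriv_eq] at h1
  refine h1.congr_fun fun n => ?_
  have hq1 : HasDerivAt (qParam h) (qParam h τ * (2 * Real.pi * Complex.I / h)) τ := by
    have h2 : HasDerivAt (fun z : ℂ => 2 * Real.pi * Complex.I * z / h)
      (2 * Real.pi * Complex.I / h) (τ : ℂ) := by
      simpa using! ((hasDerivAt_id (τ : ℂ)).const_mul (2 * Real.pi * Complex.I)).div_const (h : ℂ)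
    exact h2.cexp
  have h3 := ((hq1.pow n).const_mul (PowerSeries.coeff n f)).deriv
  rw [show deriv (fun w => PowerSeries.coeff n f * qParam h w ^ n) (τ : ℂ) = _ from h3]
  rcases n with _ | n
  · simp
  · simp only [Nat.add_sub_cancel, pow_succ]
    ring

theorem mdifferentiable (hF : HasQSeries h F f) (hh : 0 < h) : MDiff F := fun τ =>
  mdifferentiableAt_iff.mpr (hF.differentiable_aux hh τ).1

theorem normalizedDeriv (hF : HasQSeries 1 F f) :
    HasQSeries 1 (Derivative.normalizedDerivOfComplex F) (qDeriv f) := fun τ => by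
  have h1 := (hF.differentiable_aux one_pos τ).2.mul_left ((2 * Real.pi * Complex.I)⁻¹)
  have h0 : (2 * Real.pi * Complex.I) ≠ 0 := Complex.two_pi_I_ne_zero
  refine h1.congr_fun fun n => ?_
  rw [coeff_qDeriv, Complex.ofReal_one]
  field_simp

end HasQSeries

end QSeries

section LevelOne

open UpperHalfPlane hiding I
open Function.Periodic Filter Topology ModularForm
open scoped Manifold MatrixGroups

/-- `F` is a modular form of weight `k` for `SL(2, ℤ)` with `q`-expansion `f`. -/
structure IsLevelOne (k : ℕ) (F : ℍ → ℂ) (f : PowerSeries ℂ) : Prop where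
  hasQSeries : HasQSeries 1 F f
  smul_S : ∀ τ : ℍ, F (ModularGroup.S • τ) = (τ : ℂ) ^ k * F τ

theorem slash_S_apply (F : ℍ → ℂ) (k : ℤ) (τ : ℍ) :
    (F ∣[k] ModularGroup.S) τ = F (ModularGroup.S • τ) * (τ : ℂ) ^ (-k) := by
  rw [SL_slash_apply, ModularGroup.denom_S]

theorem HasQSeries.slash_T {F : ℍ → ℂ} {f : PowerSeries ℂ} (hF : HasQSeries 1 F f) (k : ℤ) :
    F ∣[k] ModularGroup.T = F := by
  funext τ
  rw [SL_slash_apply]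
  have h1 : denom ModularGroup.T τ = 1 := by
    rw [ModularGroup.denom_apply]
    simp [ModularGroup.T]
  rw [h1, one_zpow, mul_one]
  refine (hF (ModularGroup.T • τ)).unique ((hF τ).congr_fun fun n => ?_)
  congr 2
  rw [modular_T_smul, UpperHalfPlane.coe_vadd, add_comm]
  rw [qParam, qParam, Complex.exp_eq_exp_iff_exists_int]
  exact ⟨1, by push_cast; ring⟩

namespace IsLevelOne

variable {k l : ℕ} {F G : ℍ → ℂ} {f g : PowerSeries ℂ}

theorem add (hF : IsLevelOne k F f) (hG : IsLevelOne k G g) : IsLevelOne k (F + G) (f + g) :=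
  ⟨hF.1.add hG.1, fun τ => by simp only [Pi.add_apply, hF.2, hG.2]; ring⟩

theorem sub (hF : IsLevelOne k F f) (hG : IsLevelOne k G g) : IsLevelOne k (F - G) (f - g) :=
  ⟨hF.1.sub hG.1, fun τ => by simp only [Pi.sub_apply, hF.2, hG.2]; ring⟩

theorem const_mul (c : ℂ) (hF : IsLevelOne k F f) :
    IsLevelOne k (fun τ => c * F τ) (PowerSeries.C c * f) :=
  ⟨hF.1.const_mul c, fun τ => by simp only [hF.2]; ring⟩

theorem const (c : ℂ) : IsLevelOne 0 (fun _ => c) (PowerSeries.C c) :=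
  ⟨.const c, fun τ => by simp⟩

theorem mul (hF : IsLevelOne k F f) (hG : IsLevelOne l G g) :
    IsLevelOne (k + l) (F * G) (f * g) :=
  ⟨hF.1.mul hG.1, fun τ => by simp only [Pi.mul_apply, hF.2, hG.2]; ring⟩

theorem pow (hF : IsLevelOne k F f) (n : ℕ) : IsLevelOne (n * k) (F ^ n) (f ^ n) :=
  ⟨hF.1.pow n, fun τ => by simp only [Pi.pow_apply, hF.2]; ring⟩

theorem of_slash_eq (hF : HasQSeries 1 F f) (h : F ∣[(k : ℤ)] ModularGroup.S = F) :
    IsLevelOne k F f := by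
  refine ⟨hF, fun τ => ?_⟩
  have h1 := congrFun h τ
  rw [slash_S_apply, zpow_neg, zpow_natCast] at h1
  have h2 : (τ : ℂ) ^ k ≠ 0 := pow_ne_zero _ (ne_zero τ)
  rw [← h1]
  field_simp

theorem slash_eq (hF : IsLevelOne k F f) (γ : SL(2, ℤ)) : F ∣[(k : ℤ)] γ = F := by
  refine SlashInvariantForm.slash_action_generators_SL2Z ?_ (hF.1.slash_T k) γ
  funext τ
  have h2 : (τ : ℂ) ^ k ≠ 0 := pow_ne_zero _ (ne_zero τ)
  rw [slash_S_apply, zpow_neg, zpow_natCast, hF.2]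
  field_simp

theorem exists_modularForm (hF : IsLevelOne k F f) :
    ∃ M : ModularForm 𝒮ℒ k, ⇑M = F ∧ qExpansion 1 M = f := by
  let M : ModularForm 𝒮ℒ k :=
    { toFun := F
      slash_action_eq' := fun _ ⟨γ, hγ⟩ ↦ hγ ▸ hF.slash_eq γ
      holo' := hF.1.mdifferentiable one_pos
      bdd_at_cusps' := fun {c} hc => by
        rw [Subgroup.IsArithmetic.isCusp_iff_isCusp_SL2Z] at hc
        rw [OnePoint.isBoundedAt_iff_forall_SL2Z hc]
        intro γ _
        rw [hF.slash_eq γ]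
        exact hF.1.isBounded one_pos }
  refine ⟨M, rfl, HasQSeries.unique_right one_pos (F := F) (fun τ => ?_) hF.1⟩
  exact ModularForm.hasSum_qExpansion M one_pos one_mem_strictPeriods_SL τ

theorem of_modularForm (M : ModularForm 𝒮ℒ k) : IsLevelOne k M (qExpansion 1 M) :=
  of_slash_eq (fun τ => ModularForm.hasSum_qExpansion M one_pos one_mem_strictPeriods_SL τ)
    (M.slash_action_eq' _ ⟨_, rfl⟩)

end IsLevelOne

end LevelOne

section Ramanujan

open UpperHalfPlane hiding I
open Function.Periodic Filter Topology ModularForm EisensteinSeries Derivative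
open scoped Manifold MatrixGroups ArithmeticFunction.sigma

/-- The power series `1 + c ∑ σ_s(m) q^m`. -/
def eisSeries (R : Type*) [CommRing R] (c : ℤ) (s : ℕ) : PowerSeries R :=
  PowerSeries.mk fun m => if m = 0 then 1 else c * (σ s m : ℕ)

theorem map_eisSeries {R S : Type*} [CommRing R] [CommRing S] (φ : R →+* S) (c : ℤ) (s : ℕ) :
    PowerSeries.map φ (eisSeries R c s) = eisSeries S c s := by
  ext m
  simp only [eisSeries, PowerSeries.coeff_map, PowerSeries.coeff_mk]
  split_ifs <;> simp

theorem constantCoeff_eisSeries {R : Type*} [CommRing R] (c : ℤ) (s : ℕ) :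
    PowerSeries.constantCoeff (eisSeries R c s) = 1 := by
  simp [eisSeries, ← PowerSeries.coeff_zero_eq_constantCoeff_apply]

theorem coeff_one_eisSeries {R : Type*} [CommRing R] (c : ℤ) (s : ℕ) :
    PowerSeries.coeff 1 (eisSeries R c s) = c := by
  simp [eisSeries]

theorem isLevelOne_E₄ : IsLevelOne 4 E₄ (eisSeries ℂ 240 3) := by
  convert IsLevelOne.of_modularForm (k := 4) E₄
  ext m
  rw [E_qExpansion_coeff (by norm_num) ⟨2, rfl⟩]
  simp only [eisSeries, PowerSeries.coeff_mk, show _root_.bernoulli 4 = -1 / 30 by decide +kernel]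
  split_ifs <;> norm_num

theorem isLevelOne_E₆ : IsLevelOne 6 E₆ (eisSeries ℂ (-504) 5) := by
  convert IsLevelOne.of_modularForm (k := 6) E₆
  ext m
  rw [E_qExpansion_coeff (by norm_num) ⟨3, rfl⟩]
  simp only [eisSeries, PowerSeries.coeff_mk, show _root_.bernoulli 6 = 1 / 42 by decide +kernel]
  split_ifs <;> norm_num

theorem hasQSeries_E2 : HasQSeries 1 E2 (eisSeries ℂ (-24) 1) := fun τ => by
  have h := hasSum_qExpansion_E2 (z := τ)
  simpa [eisSeries, qParam] using h

namespace IsLevelOne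

variable {k : ℕ} {F : ℍ → ℂ} {f : PowerSeries ℂ}

theorem eq_zero_of_lt (hF : IsLevelOne k F f) (hk : k < 12) (h0 : PowerSeries.coeff 0 f = 0) :
    f = 0 := by
  obtain ⟨M, rfl, rfl⟩ := hF.exists_modularForm
  have : M = 0 := sturm_bound_levelOne_nat (by
    rw [Nat.div_eq_of_lt hk]
    refine lt_of_lt_of_le (b := ((1 : ℕ) : ℕ∞)) (by norm_num) ?_
    refine PowerSeries.nat_le_order _ _ fun i hi => ?_
    obtain rfl : i = 0 := by omega
    exact h0)
  rw [this]
  exact qExpansion_zero 1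

theorem exists_eq_disc_mul (hF : IsLevelOne (k + 12) F f) (h0 : PowerSeries.coeff 0 f = 0) :
    ∃ G g, IsLevelOne k G g ∧
      PowerSeries.C 1728 * f = (eisSeries ℂ 240 3 ^ 3 - eisSeries ℂ (-504) 5 ^ 2) * g := by
  obtain ⟨M, hM, rfl⟩ := hF.exists_modularForm
  let N : ModularForm 𝒮ℒ k := ModularForm.mcast (by push_cast; ring)
    (CuspForm.discriminantEquiv (toCuspForm M h0))
  refine ⟨N, _, of_modularForm N, ?_⟩
  have h1 := ((isLevelOne_E₄.pow 3).sub (isLevelOne_E₆.pow 2)).mul (of_modularForm N)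
  refine HasQSeries.unique_right one_pos (hF.const_mul 1728).1 ?_
  convert! h1.1 using 1
  funext τ
  have h2 := discriminant_mul_discriminantEquiv_apply (toCuspForm M h0) τ
  rw [discriminant_eq_E₄_cube_sub_E₆_sq] at h2
  simp only [Pi.mul_apply, Pi.sub_apply, Pi.pow_apply, ← hM]
  rw [show M τ = toCuspForm M h0 τ from rfl, ← h2]
  change _ = _ * (CuspForm.discriminantEquiv (toCuspForm M h0)) τ
  ring

theorem coeff_zero_eq_zero (hF : IsLevelOne 2 F f) : f = 0 := by
  obtain ⟨M, rfl, rfl⟩ := hF.exists_modularForm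
  rw [rank_zero_iff_forall_zero.mp levelOne_weight_two_rank_zero M]
  exact qExpansion_zero 1

theorem eq_zero_of_odd (hF : IsLevelOne k F f) (hk : Odd k) : f = 0 := by
  obtain ⟨M, rfl, rfl⟩ := hF.exists_modularForm
  rw [ModularForm.levelOne_odd_weight_eq_zero (by exact_mod_cast hk) M]
  exact qExpansion_zero 1

end IsLevelOne

theorem E2_smul_S (τ : ℍ) : E2 (ModularGroup.S • τ) =
    (τ : ℂ) ^ 2 * E2 τ + 12 / (2 * Real.pi * Complex.I) * τ := by
  have h := congrFun (E2_slash_action ModularGroup.S) τ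
  have h2 : (τ : ℂ) ≠ 0 := ne_zero τ
  have hpi : (Real.pi : ℂ) ≠ 0 := by exact_mod_cast Real.pi_ne_zero
  rw [slash_S_apply, Pi.sub_apply, Pi.smul_apply, D2_S, riemannZeta_two, smul_eq_mul,
    show -(2 : ℤ) = -((2 : ℕ) : ℤ) from rfl, zpow_neg, zpow_natCast] at h
  have h3 : E2 (ModularGroup.S • τ) = (E2 (ModularGroup.S • τ) * ((τ : ℂ) ^ 2)⁻¹) * τ ^ 2 := by
    field_simp
  rw [h3, h]
  field_simp
  linear_combination (-12) * Complex.I_sq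


theorem HasQSeries.serreDerivative {F : ℍ → ℂ} {f : PowerSeries ℂ} (k : ℂ)
    (hF : HasQSeries 1 F f) : HasQSeries 1 (serreDerivative k F)
      (qDeriv f - PowerSeries.C (k * 12⁻¹) * (eisSeries ℂ (-24) 1 * f)) := by
  convert! hF.normalizedDeriv.sub ((hasQSeries_E2.mul hF).const_mul (k * 12⁻¹)) using 1
  funext τ
  simp [mul_assoc]

theorem IsLevelOne.serreDerivative {k : ℕ} {F : ℍ → ℂ} {f : PowerSeries ℂ}
    (hF : IsLevelOne k F f) : IsLevelOne (k + 2) (serreDerivative k F)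
      (qDeriv f - PowerSeries.C (k * 12⁻¹ : ℂ) * (eisSeries ℂ (-24) 1 * f)) := by
  refine IsLevelOne.of_slash_eq (hF.1.serreDerivative k) ?_
  have h := serreDerivative_slash_invariant (hF.1.mdifferentiable one_pos)
    (hF.slash_eq ModularGroup.S)
  exact_mod_cast h

theorem isLevelOne_deriv_E2 : IsLevelOne 4
    (normalizedDerivOfComplex E2 - fun τ => 12⁻¹ * (E2 * E2) τ)
    (qDeriv (eisSeries ℂ (-24) 1) -
      PowerSeries.C 12⁻¹ * (eisSeries ℂ (-24) 1 * eisSeries ℂ (-24) 1)) := by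
  refine ⟨hasQSeries_E2.normalizedDeriv.sub ((hasQSeries_E2.mul hasQSeries_E2).const_mul _),
    fun τ => ?_⟩
  have h1 := congrFun (normalizedDerivOfComplex_SL_slash (k := 2) E2_mdifferentiable
    (γ := ModularGroup.S)) τ
  have hτ : (τ : ℂ) ≠ 0 := ne_zero τ
  have hpi := Complex.two_pi_I_ne_zero
  have h2 : E2 ∣[(2 : ℤ)] ModularGroup.S =
      fun τ : ℍ => E2 τ + 12 / (2 * Real.pi * Complex.I) * (τ : ℂ)⁻¹ := by
    funext τ
    have hτ : (τ : ℂ) ≠ 0 := ne_zero τ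
    rw [slash_S_apply, E2_smul_S]
    field_simp
  have h3 : normalizedDerivOfComplex (E2 ∣[(2 : ℤ)] ModularGroup.S) τ =
      normalizedDerivOfComplex E2 τ - 12 / (2 * Real.pi * Complex.I) ^ 2 / (τ : ℂ) ^ 2 := by
    have hd := mdifferentiableAt_iff.mp (E2_mdifferentiable τ)
    have hd2 : HasDerivAt (fun z : ℂ => 12 / (2 * Real.pi * Complex.I) * z⁻¹)
        (12 / (2 * Real.pi * Complex.I) * -((τ : ℂ) ^ 2)⁻¹) τ :=
      (hasDerivAt_inv hτ).const_mul _
    have he : (E2 ∣[(2 : ℤ)] ModularGroup.S) ∘ ofComplex =ᶠ[𝓝 (τ : ℂ)]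
        fun z => (E2 ∘ ofComplex) z + 12 / (2 * Real.pi * Complex.I) * z⁻¹ := by
      filter_upwards [(isOpen_lt continuous_const Complex.continuous_im).mem_nhds τ.im_pos]
        with z hz
      simp only [h2, Function.comp, ofComplex_apply_of_im_pos hz]
    rw [normalizedDerivOfComplex, normalizedDerivOfComplex, he.deriv_eq,
      show deriv (fun z => (E2 ∘ ofComplex) z + 12 / (2 * Real.pi * Complex.I) * z⁻¹) (τ : ℂ) = _
        from (hd.hasDerivAt.add hd2).deriv]
    field_simp
    ring
  rw [h3, Pi.sub_apply, slash_S_apply, ModularGroup.denom_S, h2] at h1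
  have h10 : ((ModularGroup.S 1 0 : ℤ) : ℂ) = 1 := by simp [ModularGroup.S]
  rw [h10, show -(2 + 2 : ℤ) = -((4 : ℕ) : ℤ) from rfl, zpow_neg, zpow_natCast] at h1
  simp only [Pi.sub_apply, Pi.mul_apply, E2_smul_S]
  push_cast at h1
  field_simp at h1 ⊢
  linear_combination -12 * h1

theorem map_qDeriv {R S : Type*} [CommRing R] [CommRing S] (φ : R →+* S) (f : PowerSeries R) :
    PowerSeries.map φ (qDeriv f) = qDeriv (PowerSeries.map φ f) := by
  ext n
  simp [coeff_qDeriv]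

theorem coeff_zero_qDeriv {R : Type*} [CommRing R] (f : PowerSeries R) :
    PowerSeries.constantCoeff (qDeriv f) = 0 := by
  simp [qDeriv]

theorem map_intCast_injective :
    Function.Injective (PowerSeries.map (Int.castRingHom ℂ)) := by
  intro f g h
  ext n
  have := congrArg (PowerSeries.coeff n) h
  simpa using this

theorem ramanujan_E₄ (R : Type*) [CommRing R] :
    3 * qDeriv (eisSeries R 240 3) =
      eisSeries R (-24) 1 * eisSeries R 240 3 - eisSeries R (-504) 5 := by
  have hZ : 3 * qDeriv (eisSeries ℤ 240 3) =
      eisSeries ℤ (-24) 1 * eisSeries ℤ 240 3 - eisSeries ℤ (-504) 5 := by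
    apply map_intCast_injective
    have h := (isLevelOne_E₄.serreDerivative.add (isLevelOne_E₆.const_mul 3⁻¹)).eq_zero_of_lt
      (by norm_num) (by
        simp [coeff_zero_qDeriv, constantCoeff_eisSeries]; norm_num)
    have h3 : (PowerSeries.C 3⁻¹ : PowerSeries ℂ) * 3 = 1 := by
      rw [← map_ofNat (PowerSeries.C (R := ℂ)) 3, ← map_mul]; norm_num
    have h4 : (PowerSeries.C ((4 : ℕ) * 12⁻¹) : PowerSeries ℂ) = PowerSeries.C 3⁻¹ := by norm_num
    rw [h4] at h
    simp only [map_mul, map_sub, map_ofNat, map_qDeriv, map_eisSeries]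
    linear_combination 3 * h + (eisSeries ℂ (-24) 1 * eisSeries ℂ 240 3 - eisSeries ℂ (-504) 5) * h3
  simpa only [map_mul, map_sub, map_pow, map_ofNat, map_qDeriv, map_eisSeries] using
    congrArg (PowerSeries.map (Int.castRingHom R)) hZ

theorem ramanujan_E₆ (R : Type*) [CommRing R] :
    2 * qDeriv (eisSeries R (-504) 5) =
      eisSeries R (-24) 1 * eisSeries R (-504) 5 - eisSeries R 240 3 ^ 2 := by
  have hZ : 2 * qDeriv (eisSeries ℤ (-504) 5) =
      eisSeries ℤ (-24) 1 * eisSeries ℤ (-504) 5 - eisSeries ℤ 240 3 ^ 2 := by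
    apply map_intCast_injective
    have h := (isLevelOne_E₆.serreDerivative.add
      ((isLevelOne_E₄.pow 2).const_mul 2⁻¹)).eq_zero_of_lt
      (by norm_num) (by
        simp [coeff_zero_qDeriv, constantCoeff_eisSeries]; norm_num)
    have h3 : (PowerSeries.C 2⁻¹ : PowerSeries ℂ) * 2 = 1 := by
      rw [← map_ofNat (PowerSeries.C (R := ℂ)) 2, ← map_mul]; norm_num
    have h4 : (PowerSeries.C ((6 : ℕ) * 12⁻¹) : PowerSeries ℂ) = PowerSeries.C 2⁻¹ := by norm_num
    rw [h4] at h
    simp only [map_mul, map_sub, map_pow, map_ofNat, map_qDeriv, map_eisSeries]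
    linear_combination 2 * h +
      (eisSeries ℂ (-24) 1 * eisSeries ℂ (-504) 5 - eisSeries ℂ 240 3 ^ 2) * h3
  simpa only [map_mul, map_sub, map_pow, map_ofNat, map_qDeriv, map_eisSeries] using
    congrArg (PowerSeries.map (Int.castRingHom R)) hZ

theorem ramanujan_E2 (R : Type*) [CommRing R] :
    12 * qDeriv (eisSeries R (-24) 1) =
      eisSeries R (-24) 1 ^ 2 - eisSeries R 240 3 := by
  have hZ : 12 * qDeriv (eisSeries ℤ (-24) 1) =
      eisSeries ℤ (-24) 1 ^ 2 - eisSeries ℤ 240 3 := by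
    apply map_intCast_injective
    have h := (isLevelOne_deriv_E2.add (isLevelOne_E₄.const_mul 12⁻¹)).eq_zero_of_lt
      (by norm_num) (by simp [coeff_zero_qDeriv, constantCoeff_eisSeries])
    have h3 : (PowerSeries.C 12⁻¹ : PowerSeries ℂ) * 12 = 1 := by
      rw [← map_ofNat (PowerSeries.C (R := ℂ)) 12, ← map_mul]; norm_num
    simp only [map_mul, map_sub, map_pow, map_ofNat, map_qDeriv, map_eisSeries]
    linear_combination 12 * h + (eisSeries ℂ (-24) 1 ^ 2 - eisSeries ℂ 240 3) * h3
  simpa only [map_mul, map_sub, map_pow, map_ofNat, map_qDeriv, map_eisSeries] using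
    congrArg (PowerSeries.map (Int.castRingHom R)) hZ

end Ramanujan

section IntegralForms

open UpperHalfPlane hiding I

variable {R : Type*} [CommRing R]

theorem exists_eisSeries_disc (h6 : IsUnit (6 : R)) : ∃ u : PowerSeries R,
    IsUnit (PowerSeries.constantCoeff u) ∧
      eisSeries R 240 3 ^ 3 - eisSeries R (-504) 5 ^ 2 = PowerSeries.X * u := by
  have h0 : PowerSeries.constantCoeff (eisSeries R 240 3 ^ 3 - eisSeries R (-504) 5 ^ 2) = 0 := by
    simp [constantCoeff_eisSeries]
  obtain ⟨u, hu⟩ := PowerSeries.X_dvd_iff.mpr h0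
  refine ⟨u, ?_, hu⟩
  have h1 := congrArg (PowerSeries.coeff 1) hu
  have e4 : ∀ f : PowerSeries R, PowerSeries.constantCoeff f = 1 →
      PowerSeries.coeff 1 (f ^ 2) = 2 * PowerSeries.coeff 1 f := by
    intro f hf
    rw [pow_two, PowerSeries.coeff_mul, Finset.Nat.antidiagonal_succ]
    simp [hf]
    ring
  have e5 : ∀ f : PowerSeries R, PowerSeries.constantCoeff f = 1 →
      PowerSeries.coeff 1 (f ^ 3) = 3 * PowerSeries.coeff 1 f := by
    intro f hf
    rw [pow_succ, PowerSeries.coeff_mul, Finset.Nat.antidiagonal_succ]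
    simp [hf, e4 f hf]
    ring
  rw [map_sub, e5 _ (constantCoeff_eisSeries _ _), e4 _ (constantCoeff_eisSeries _ _),
    coeff_one_eisSeries, coeff_one_eisSeries,
    show PowerSeries.coeff 1 (PowerSeries.X * u) = _ from PowerSeries.coeff_succ_X_mul 0 u,
      PowerSeries.coeff_zero_eq_constantCoeff_apply] at h1
  rw [← h1]
  have h2 : IsUnit (2 : R) := isUnit_of_mul_isUnit_left (y := 3) (by norm_num; exact h6)
  have h3 : IsUnit (3 : R) := isUnit_of_mul_isUnit_left (y := 2) (by norm_num; exact h6)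
  have : (3 * ((240 : ℤ) : R) - 2 * ((-504 : ℤ) : R)) = 2 ^ 6 * 3 ^ 3 := by push_cast; norm_num
  rw [this]
  exact (h2.pow 6).mul (h3.pow 3)

theorem isUnit_1728 (h6 : IsUnit (6 : R)) : IsUnit (1728 : R) := by
  have h2 : IsUnit (2 : R) := isUnit_of_mul_isUnit_left (y := 3) (by norm_num; exact h6)
  have : (1728 : R) = 6 ^ 3 * 2 ^ 3 := by norm_num
  rw [this]
  exact (h6.pow 3).mul (h2.pow 3)

/-- The `q`-expansion principle: a level one form with coefficients in `R` is an isobaric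
polynomial over `R` in the Eisenstein series. -/
theorem IsLevelOne.exists_homPoly {ι : R →+* ℂ} (hι : Function.Injective ι) (h6 : IsUnit (6 : R))
    (k : ℕ) : ∀ {F : ℍ → ℂ} {f : PowerSeries R}, IsLevelOne k F (PowerSeries.map ι f) →
    ∃ P ∈ homPoly R k, f = MvPolynomial.aeval ![eisSeries R 240 3, eisSeries R (-504) 5] P := by
  have hιX : Function.Injective (PowerSeries.map ι) := fun f g h => by
    ext n
    have := congrArg (PowerSeries.coeff n) h
    simpa using hι (by simpa using this)
  induction k using Nat.strong_induction_on with
  | _ k ih =>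
  intro F f hF
  by_cases hk : Odd k ∨ k = 2
  · have hf : f = 0 := hιX (by
      rw [map_zero]
      rcases hk with hk | rfl
      · exact hF.eq_zero_of_odd hk
      · exact hF.coeff_zero_eq_zero)
    exact ⟨0, zero_mem _, by rw [hf, map_zero]⟩
  · obtain ⟨hk1, hk2⟩ := not_or.mp hk
    obtain ⟨j, rfl⟩ := Nat.not_odd_iff_even.mp hk1
    obtain ⟨a, b, hab⟩ : ∃ a b, 4 * a + 6 * b = j + j := by
      rcases Nat.even_or_odd' j with ⟨i, rfl | rfl⟩
      · exact ⟨i, 0, by ring⟩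
      · exact ⟨i - 1, 1, by omega⟩
    set c := PowerSeries.coeff 0 f with hc
    set e := eisSeries R 240 3 with he
    set e' := eisSeries R (-504) 5 with he'
    set g := f - PowerSeries.C c * (e ^ a * e' ^ b) with hg
    have hg0 : PowerSeries.coeff 0 g = 0 := by
      simp [hg, hc, he, he', constantCoeff_eisSeries]
    have hmon : IsLevelOne (j + j) _ _ :=
      hab ▸ mul_comm a 4 ▸ mul_comm b 6 ▸ (isLevelOne_E₄.pow a).mul (isLevelOne_E₆.pow b)
    have hG := hF.sub (hmon.const_mul (ι c))
    have hgmap : PowerSeries.map ι f - PowerSeries.C (ι c) *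
        (eisSeries ℂ 240 3 ^ a * eisSeries ℂ (-504) 5 ^ b) = PowerSeries.map ι g := by
      simp [hg, he, he', map_eisSeries]
    rw [hgmap] at hG
    have hg0' : PowerSeries.coeff 0 (PowerSeries.map ι g) = 0 := by
      rw [PowerSeries.coeff_map, hg0, map_zero]
    have hmain : ∃ Q ∈ homPoly R (j + j), g = MvPolynomial.aeval ![e, e'] Q := by
      by_cases hlt : j + j < 12
      · refine ⟨0, zero_mem _, ?_⟩
        rw [map_zero]
        exact hιX (by rw [hG.eq_zero_of_lt hlt hg0', map_zero])
      · obtain ⟨l, hl⟩ := Nat.exists_eq_add_of_le' (not_lt.mp hlt)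
        rw [hl] at hG ⊢
        obtain ⟨H, h, hH, hHg⟩ := hG.exists_eq_disc_mul hg0'
        obtain ⟨u, hu, hdu⟩ := exists_eisSeries_disc h6
        obtain ⟨v, hv⟩ := PowerSeries.isUnit_iff_constantCoeff.mpr hu
        obtain ⟨g', hg'⟩ := PowerSeries.X_dvd_iff (φ := g).mpr
          (by rw [← PowerSeries.coeff_zero_eq_constantCoeff_apply, hg0])
        have hh : h = PowerSeries.map ι (PowerSeries.C 1728 * g' * (↑v⁻¹ : PowerSeries R)) := by
          have h1 : (PowerSeries.X : PowerSeries ℂ) ≠ 0 := PowerSeries.X_ne_zero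
          have h2 : PowerSeries.map ι u * PowerSeries.map ι (↑v⁻¹ : PowerSeries R) = 1 := by
            rw [← map_mul, ← hv, Units.mul_inv, map_one]
          have h3 : eisSeries ℂ 240 3 ^ 3 - eisSeries ℂ (-504) 5 ^ 2 =
              PowerSeries.X * PowerSeries.map ι u := by
            have := congrArg (PowerSeries.map ι) hdu
            simpa [map_eisSeries] using this
          rw [h3, hg', map_mul, PowerSeries.map_X] at hHg
          apply mul_left_cancel₀ h1
          simp only [map_mul, map_ofNat] at hHg ⊢
          linear_combination (-PowerSeries.map ι (↑v⁻¹ : PowerSeries R)) * hHg -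
            PowerSeries.X * h * h2
        rw [hh] at hH
        obtain ⟨Q, hQ, hQe⟩ := ih l (by omega) hH
        obtain ⟨w, hw⟩ := isUnit_1728 h6
        refine ⟨MvPolynomial.C ↑w⁻¹ * (homPoly.disc R * Q),
          homPoly.C_mul_mem (add_comm 12 l ▸ homPoly.mul_mem homPoly.disc_mem hQ) _, ?_⟩
        have hwC : (PowerSeries.C (↑w⁻¹ : R)) * PowerSeries.C 1728 = 1 := by
          rw [← map_mul, ← hw, Units.inv_mul, map_one]
        have hvu : u * (↑v⁻¹ : PowerSeries R) = 1 := by rw [← hv, Units.mul_inv]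
        rw [map_mul, map_mul, ← hQe, MvPolynomial.aeval_C, PowerSeries.algebraMap_apply,
          show MvPolynomial.aeval ![e, e'] (homPoly.disc R) = PowerSeries.X * u by
            rw [← hdu]; simp [homPoly.disc, he, he'], hg']
        simp only [Algebra.algebraMap_self, RingHom.id_apply]
        linear_combination (-PowerSeries.X * g') * hwC -
          PowerSeries.C (↑w⁻¹ : R) * PowerSeries.C 1728 * PowerSeries.X * g' * hvu
    obtain ⟨Q, hQ, hQe⟩ := hmain
    refine ⟨MvPolynomial.C c * (MvPolynomial.X 0 ^ a * MvPolynomial.X 1 ^ b) + Q,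
      add_mem (homPoly.C_mul_mem (homPoly.monomial_mem a b hab) c) hQ, ?_⟩
    rw [map_add, ← hQe]
    simp [hg]

/-- A form whose `q`-expansion is an isobaric polynomial in the Eisenstein series takes the
corresponding values. -/
theorem HasQSeries.eq_eval₂ {ι : R →+* ℂ} {F : ℍ → ℂ} {P : MvPolynomial (Fin 2) R}
    (hF : HasQSeries 1 F (PowerSeries.map ι
      (MvPolynomial.aeval ![eisSeries R 240 3, eisSeries R (-504) 5] P))) (τ : ℍ) :
    F τ = MvPolynomial.eval₂ ι ![ModularForm.E₄ τ, ModularForm.E₆ τ] P := by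
  have h : HasQSeries 1 (fun τ => MvPolynomial.eval₂ ι ![ModularForm.E₄ τ, ModularForm.E₆ τ] P)
      (PowerSeries.map ι (MvPolynomial.aeval ![eisSeries R 240 3, eisSeries R (-504) 5] P)) := by
    clear hF
    induction P using MvPolynomial.induction_on with
    | C c =>
      simpa [PowerSeries.algebraMap_apply] using HasQSeries.const (h := 1) (ι c)
    | add P Q hP hQ =>
      simp only [map_add, MvPolynomial.eval₂_add]
      exact hP.add hQ
    | mul_X P i hP =>
      simp only [map_mul, MvPolynomial.eval₂_mul, MvPolynomial.eval₂_X, MvPolynomial.aeval_X]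
      refine HasQSeries.mul hP ?_
      fin_cases i
      · simpa [map_eisSeries] using! isLevelOne_E₄.1
      · simpa [map_eisSeries] using! isLevelOne_E₆.1
  exact congrFun (hF.unique_left h) τ

end IntegralForms

section HeckeNorm

open UpperHalfPlane hiding I
open Function.Periodic Filter Topology ModularForm
open scoped Manifold MatrixGroups

namespace HasQSeries

theorem comp {h h' : ℝ} {F : ℍ → ℂ} {f : PowerSeries ℂ} (hF : HasQSeries h F f) {φ : ℍ → ℍ}
    {m : ℕ} (hm : m ≠ 0) {ζ : ℂ} (hφ : ∀ τ, qParam h (φ τ) = ζ * qParam h' τ ^ m) :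
    HasQSeries h' (fun τ => F (φ τ)) (PowerSeries.expand m hm (PowerSeries.rescale ζ f)) := by
  intro τ
  have h1 := hF (φ τ)
  have h2 : Function.Injective fun n : ℕ => m * n := mul_right_injective₀ hm
  refine (h2.hasSum_iff ?_).mp (h1.congr_fun fun n => ?_)
  · intro n hn
    rw [PowerSeries.coeff_expand_of_not_dvd _ _ _ (fun ⟨k, hk⟩ => hn ⟨k, hk.symm⟩), zero_mul]
  · simp only [Function.comp_apply]
    rw [PowerSeries.coeff_expand_mul, PowerSeries.coeff_rescale, hφ]
    ring

theorem apply_eq_of_qParam_eq {h : ℝ} {F : ℍ → ℂ} {f : PowerSeries ℂ} (hF : HasQSeries h F f)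
    {τ τ' : ℍ} (hτ : qParam h τ = qParam h τ') : F τ = F τ' :=
  (hF τ).unique ((hF τ').congr_fun fun n => by rw [hτ])

end HasQSeries

theorem qParam_eq_of_eq_add_intCast {x y : ℂ} (n : ℤ) (h : x = y + n) :
    qParam 1 x = qParam 1 y := by
  rw [qParam, qParam, Complex.exp_eq_exp_iff_exists_int]
  exact ⟨n, by rw [h]; push_cast; ring⟩

theorem IsLevelOne.apply_smul {k : ℕ} {F : ℍ → ℂ} {f : PowerSeries ℂ} (hF : IsLevelOne k F f)
    (γ : SL(2, ℤ)) (τ : ℍ) : F (γ • τ) = denom γ τ ^ k * F τ := by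
  have h := congrFun (hF.slash_eq γ) τ
  rw [SL_slash_apply, zpow_neg, zpow_natCast] at h
  have h2 : denom γ τ ^ k ≠ 0 := pow_ne_zero _ (denom_ne_zero _ _)
  rw [← h]
  field_simp

theorem HasQSeries.expand (p : ℕ) {F : ℍ → ℂ} {f : PowerSeries ℂ}
    (hF : HasQSeries 1 F f) (hp : p ≠ 0) : HasQSeries p F (PowerSeries.expand p hp f) := by
  have hp' : (p : ℂ) ≠ 0 := by exact_mod_cast hp
  have h := hF.comp (φ := id) (h' := p) hp (ζ := 1) fun τ => by
      rw [one_mul, qParam, qParam, ← Complex.exp_nat_mul]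
      congr 1
      push_cast
      simp only [id]
      field_simp
  rwa [PowerSeries.rescale_one, RingHom.id_apply] at h

theorem HasQSeries.exists_expand (p : ℕ) {R : Type*} [CommRing R] {ι : R →+* ℂ}
    (hι : Function.Injective ι) {F : ℍ → ℂ} {f : PowerSeries R}
    (hF : HasQSeries p F (PowerSeries.map ι f)) (hp : p ≠ 0)
    (hT : ∀ τ, F (ModularGroup.T • τ) = F τ) :
    ∃ g, f = PowerSeries.expand p hp g ∧ HasQSeries 1 F (PowerSeries.map ι g) := by
  have hp' : (p : ℂ) ≠ 0 := by exact_mod_cast hp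
  set ζ := Complex.exp (2 * Real.pi * Complex.I / p) with hζ
  have hprim : IsPrimitiveRoot ζ p := Complex.isPrimitiveRoot_exp p hp
  have h1 := hF.comp (φ := fun τ => ModularGroup.T • τ) (h' := p) one_ne_zero (ζ := ζ) fun τ => by
    rw [pow_one, hζ, qParam, qParam, ← Complex.exp_add, modular_T_smul, UpperHalfPlane.coe_vadd]
    congr 1
    push_cast
    field_simp
  simp only [hT, PowerSeries.expand_one_apply] at h1
  have h2 := HasQSeries.unique_right (by positivity) h1 hF
  have hf (n : ℕ) (hn : ¬ p ∣ n) : PowerSeries.coeff n f = 0 := by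
    have h3 := congrArg (PowerSeries.coeff n) h2
    rw [PowerSeries.coeff_rescale, PowerSeries.coeff_map] at h3
    have h4 : ζ ^ n ≠ 1 := fun h => hn ((hprim.pow_eq_one_iff_dvd n).mp h)
    apply hι
    rw [map_zero]
    by_contra h5
    exact h4 (mul_right_cancel₀ h5 (h3.trans (one_mul _).symm))
  have hfg : f = PowerSeries.expand p hp (PowerSeries.mk fun n => PowerSeries.coeff (p * n) f) := by
    ext n
    rw [PowerSeries.coeff_expand]
    split_ifs with hn
    · rw [PowerSeries.coeff_mk, Nat.mul_div_cancel' hn]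
    · exact hf n hn
  refine ⟨_, hfg, fun τ => ?_⟩
  have h2 : Function.Injective fun n : ℕ => p * n := mul_right_injective₀ hp
  refine ((h2.hasSum_iff ?_).mpr (hF τ)).congr_fun fun n => ?_
  · intro n hn
    rw [PowerSeries.coeff_map, hf n (fun ⟨k, hk⟩ => hn ⟨k, hk.symm⟩), map_zero, zero_mul]
  · simp only [Function.comp_apply, PowerSeries.coeff_map, PowerSeries.coeff_mk]
    rw [pow_mul, qParam, qParam, ← Complex.exp_nat_mul _ p]
    congr 3
    push_cast
    field_simp

theorem coe_smul_eq (γ : SL(2, ℤ)) (τ : ℍ) : ((γ • τ : ℍ) : ℂ) =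
    ((γ 0 0 : ℤ) * τ + (γ 0 1 : ℤ)) / ((γ 1 0 : ℤ) * τ + (γ 1 1 : ℤ)) := by
  rw [UpperHalfPlane.specialLinearGroup_apply, coe_mk]
  simp

variable (p : ℕ) [Fact p.Prime]

/-- The points `(τ + b) / p` and `p τ` of the upper half plane. -/
def heckePoint : Option (ZMod p) → ℍ → ℍ
  | none, τ => ⟨p * τ, by
      have : (0 : ℝ) < p := by exact_mod_cast (Fact.out : p.Prime).pos
      have h2 := τ.im_pos
      simpa using by positivity⟩
  | some b, τ => ⟨(τ + b.val) / p, by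
      have : (0 : ℝ) < p := by exact_mod_cast (Fact.out : p.Prime).pos
      have h2 := τ.im_pos
      rw [Complex.div_natCast_im, Complex.add_im, Complex.natCast_im, add_zero]
      exact div_pos h2 this⟩

theorem coe_heckePoint_none (τ : ℍ) : (heckePoint p none τ : ℂ) = p * τ := rfl

theorem coe_heckePoint_some (b : ZMod p) (τ : ℍ) :
    (heckePoint p (some b) τ : ℂ) = (τ + b.val) / p := rfl

/-- The value at `τ` of the weight `k` transform of `F` by a representative of an
integral matrix of determinant `p`. -/
def heckeTerm (k : ℕ) (F : ℍ → ℂ) (i : Option (ZMod p)) (τ : ℍ) : ℂ :=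
  (i.elim (p : ℂ) fun _ => 1) ^ k * F (heckePoint p i τ)

/-- The action of `τ ↦ -1 / τ` on the representatives of the integral matrices of determinant
`p`. -/
def heckeInv : Option (ZMod p) → Option (ZMod p)
  | none => some 0
  | some b => if b = 0 then none else some (-b⁻¹)

theorem heckeInv_involutive : Function.Involutive (heckeInv p) := by
  rintro (_ | b)
  · simp [heckeInv]
  · by_cases hb : b = 0
    · simp [heckeInv, hb]
    · simp [heckeInv, hb]

theorem heckeTerm_smul_S {k : ℕ} {F : ℍ → ℂ} {f : PowerSeries ℂ} (hF : IsLevelOne k F f)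
    (i : Option (ZMod p)) (τ : ℍ) : heckeTerm p k F i (ModularGroup.S • τ) =
      (τ : ℂ) ^ k * heckeTerm p k F (heckeInv p i) τ := by
  have hp : (p : ℂ) ≠ 0 := by exact_mod_cast (Fact.out : p.Prime).ne_zero
  have hτ : (τ : ℂ) ≠ 0 := ne_zero τ
  have hS : ((ModularGroup.S • τ : ℍ) : ℂ) = -(τ : ℂ)⁻¹ := by
    rw [modular_S_smul, coe_mk, inv_neg]
  have hS' (σ : ℍ) : ((ModularGroup.S • σ : ℍ) : ℂ) = -(σ : ℂ)⁻¹ := by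
    rw [modular_S_smul, coe_mk, inv_neg]
  rcases i with _ | b
  · have h1 : heckePoint p none (ModularGroup.S • τ) =
        ModularGroup.S • heckePoint p (some 0) τ := by
      apply UpperHalfPlane.ext
      rw [hS', coe_heckePoint_none, coe_heckePoint_some, hS, ZMod.val_zero]
      rw [Nat.cast_zero, add_zero, inv_div]
      ring
    rw [heckeTerm, h1, hF.2, coe_heckePoint_some, ZMod.val_zero, heckeInv, heckeTerm]
    simp only [Option.elim, Nat.cast_zero, add_zero, one_pow, one_mul]
    rw [← mul_assoc, ← mul_pow, mul_div_cancel₀ _ hp]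
  · by_cases hb : b = 0
    · subst hb
      have h1 : heckePoint p (some 0) (ModularGroup.S • τ) =
          ModularGroup.S • heckePoint p none τ := by
        apply UpperHalfPlane.ext
        rw [hS', coe_heckePoint_none, coe_heckePoint_some, hS, ZMod.val_zero]
        field_simp
        simp
      rw [heckeTerm, h1, hF.2, coe_heckePoint_none, heckeInv, if_pos rfl, heckeTerm]
      simp only [Option.elim, one_pow, one_mul]
      rw [mul_pow]
      ring
    · obtain ⟨n, hn⟩ : (p : ℤ) ∣ b.val * (-b⁻¹).val + 1 := by
        rw [← ZMod.intCast_zmod_eq_zero_iff_dvd]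
        push_cast
        rw [ZMod.natCast_zmod_val, ZMod.natCast_zmod_val]
        field_simp
        ring
      set c := (-b⁻¹).val with hc
      have hn' : (b.val : ℂ) * c + 1 = p * n := by exact_mod_cast hn
      let γ : SL(2, ℤ) := ⟨!![(b.val : ℤ), -n; p, -c], by
        rw [Matrix.det_fin_two_of]; linarith⟩
      have h1 : heckePoint p (some b) (ModularGroup.S • τ) =
          γ • heckePoint p (some (-b⁻¹)) τ := by
        apply UpperHalfPlane.ext
        rw [coe_smul_eq, coe_heckePoint_some, hS, coe_heckePoint_some, ← hc]
        simp only [γ, Matrix.of_apply, Matrix.cons_val',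
          Matrix.cons_val_zero, Matrix.cons_val_one, Matrix.cons_val_fin_one]
        push_cast
        rw [mul_div_cancel₀ _ hp, add_neg_cancel_right]
        field_simp
        linear_combination -hn'
      have h2 : denom γ (heckePoint p (some (-b⁻¹)) τ) = τ := by
        rw [ModularGroup.denom_apply, coe_heckePoint_some]
        simp only [γ, Matrix.of_apply, Matrix.cons_val', Matrix.cons_val_zero, Matrix.cons_val_one,
          Matrix.cons_val_fin_one]
        push_cast
        rw [mul_div_cancel₀ _ hp, ← hc, add_neg_cancel_right]
      rw [heckeTerm, h1, hF.apply_smul, h2, heckeInv, if_neg hb, heckeTerm]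
      simp

theorem heckeTerm_none_smul_T {k : ℕ} {F : ℍ → ℂ} {f : PowerSeries ℂ} (hF : IsLevelOne k F f)
    (τ : ℍ) : heckeTerm p k F none (ModularGroup.T • τ) = heckeTerm p k F none τ := by
  rw [heckeTerm, heckeTerm]
  congr 1
  refine hF.1.apply_eq_of_qParam_eq (qParam_eq_of_eq_add_intCast p ?_)
  rw [coe_heckePoint_none, coe_heckePoint_none, modular_T_smul, UpperHalfPlane.coe_vadd]
  push_cast
  ring

theorem heckeTerm_some_smul_T {k : ℕ} {F : ℍ → ℂ} {f : PowerSeries ℂ} (hF : IsLevelOne k F f)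
    (b : ZMod p) (τ : ℍ) :
    heckeTerm p k F (some b) (ModularGroup.T • τ) = heckeTerm p k F (some (b + 1)) τ := by
  have hp : (p : ℂ) ≠ 0 := by exact_mod_cast (Fact.out : p.Prime).ne_zero
  rw [heckeTerm, heckeTerm]
  congr 1
  obtain ⟨n, hn⟩ : (p : ℤ) ∣ b.val + 1 - (b + 1).val := by
    rw [← ZMod.intCast_zmod_eq_zero_iff_dvd]
    push_cast
    rw [ZMod.natCast_zmod_val, ZMod.natCast_zmod_val]
    ring
  have hn' : (b.val : ℂ) + 1 - (b + 1).val = p * n := by exact_mod_cast hn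
  refine hF.1.apply_eq_of_qParam_eq (qParam_eq_of_eq_add_intCast n ?_)
  rw [coe_heckePoint_some, coe_heckePoint_some, modular_T_smul, UpperHalfPlane.coe_vadd]
  push_cast
  field_simp
  linear_combination hn'

theorem HasQSeries.heckeTerm_none {k : ℕ} {F : ℍ → ℂ} {f : PowerSeries ℂ}
    (hF : HasQSeries 1 F f) (hp : p ≠ 0) : HasQSeries 1 (heckeTerm p k F none)
      (PowerSeries.C ((p : ℂ) ^ k) * PowerSeries.expand p hp f) := by
  have h := hF.comp (φ := heckePoint p none) (h' := 1) hp (ζ := 1) fun τ => by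
    rw [coe_heckePoint_none, one_mul, qParam, qParam, ← Complex.exp_nat_mul]
    congr 1
    push_cast
    ring
  rw [PowerSeries.rescale_one, RingHom.id_apply] at h
  exact h.const_mul _

theorem HasQSeries.heckeTerm_some {k : ℕ} {F : ℍ → ℂ} {f : PowerSeries ℂ}
    (hF : HasQSeries 1 F f) (b : ZMod p) : HasQSeries p (heckeTerm p k F (some b))
      (PowerSeries.rescale (Complex.exp (2 * Real.pi * Complex.I / p) ^ b.val) f) := by
  have hp : (p : ℂ) ≠ 0 := by exact_mod_cast (Fact.out : p.Prime).ne_zero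
  have h := hF.comp (φ := heckePoint p (some b)) (h' := p) one_ne_zero
    (ζ := Complex.exp (2 * Real.pi * Complex.I / p) ^ b.val) fun τ => by
      rw [coe_heckePoint_some, pow_one, qParam, qParam, ← Complex.exp_nat_mul, ← Complex.exp_add]
      congr 1
      push_cast
      field_simp
      ring
  rw [PowerSeries.expand_one_apply] at h
  intro τ
  simpa [heckeTerm] using h τ

end HeckeNorm

section HeckeNormReduction

open UpperHalfPlane hiding I
open Function.Periodic Filter Topology ModularForm
open scoped Manifold MatrixGroups

theorem map_intCast_pow_eq_expand {κ : Type*} [CommRing κ] (p : ℕ) [ExpChar κ p] (hp : p ≠ 0)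
    (v : PowerSeries ℤ) : PowerSeries.map (Int.castRingHom κ) v ^ p =
      PowerSeries.expand p hp (PowerSeries.map (Int.castRingHom κ) v) := by
  rw [← MvPowerSeries.map_frobenius_expand p hp]
  change PowerSeries.map _ (PowerSeries.expand p hp _) = _
  rw [PowerSeries.map_expand]
  congr 1
  ext n
  simp

/-- The norm of the correlation `u(τ) v(Mτ) + u'(τ) v'(Mτ)` over the integral matrices `M` of
determinant `p`, as an isobaric polynomial in the Eisenstein series, and its reduction
modulo `p`. -/
theorem exists_homPoly_heckeNorm (p : ℕ) [Fact p.Prime] {R : Type} [CommRing R] {ι : R →+* ℂ}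
    (hι : Function.Injective ι) (h6 : IsUnit (6 : R)) {ζ : R}
    (hζ : ι ζ = Complex.exp (2 * Real.pi * Complex.I / p)) {k k' l l' w : ℕ}
    (hw : k + l = w) (hw' : k' + l' = w) {U U' V V' : ℍ → ℂ} {u u' : PowerSeries R}
    {v v' : PowerSeries ℤ}
    (hU : IsLevelOne k U (PowerSeries.map ι u)) (hU' : IsLevelOne k' U' (PowerSeries.map ι u'))
    (hV : IsLevelOne l V (PowerSeries.map (Int.castRingHom ℂ) v))
    (hV' : IsLevelOne l' V' (PowerSeries.map (Int.castRingHom ℂ) v'))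
    (hp : p ≠ 0) {d : R} (hd : d ≠ 0) {ψ : PowerSeries R}
    (hψ : PowerSeries.C ((p : R) ^ l) * u *
          PowerSeries.expand p hp (PowerSeries.map (Int.castRingHom R) v) +
        PowerSeries.C ((p : R) ^ l') * u' *
          PowerSeries.expand p hp (PowerSeries.map (Int.castRingHom R) v') =
      PowerSeries.C d * ψ) :
    ∃ P ∈ homPoly R (w * (p + 1)),
      (∀ τ, MvPolynomial.eval₂ ι ![E₄ τ, E₆ τ] P = 0 ↔
        ∃ i, U τ * heckeTerm p l V i τ + U' τ * heckeTerm p l' V' i τ = 0) ∧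
      ∀ (κ : Type) [Field κ] [CharP κ p] (π : R →+* κ),
        MvPolynomial.aeval ![eisSeries κ 240 3, eisSeries κ (-504) 5] (MvPolynomial.map π P) =
          (PowerSeries.map π u ^ p * PowerSeries.map (Int.castRingHom κ) v +
            PowerSeries.map π u' ^ p * PowerSeries.map (Int.castRingHom κ) v') *
          PowerSeries.map π ψ := by
  have hpC : (p : ℂ) ≠ 0 := by exact_mod_cast hp
  have hdC : ι d ≠ 0 := (map_ne_zero_iff ι hι).mpr hd
  have hcomp (S : Type) [CommRing S] (φ : R →+* S) (v : PowerSeries ℤ) :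
      PowerSeries.map φ (PowerSeries.map (Int.castRingHom R) v) =
        PowerSeries.map (Int.castRingHom S) v := by
    ext n
    simp
  set φ : Option (ZMod p) → ℍ → ℂ :=
    fun i τ => U τ * heckeTerm p l V i τ + U' τ * heckeTerm p l' V' i τ with hφ
  set ψb : ZMod p → PowerSeries R := fun b =>
    PowerSeries.expand p hp u *
        PowerSeries.rescale (ζ ^ b.val) (PowerSeries.map (Int.castRingHom R) v) +
      PowerSeries.expand p hp u' *
        PowerSeries.rescale (ζ ^ b.val) (PowerSeries.map (Int.castRingHom R) v') with hψb
  set N : ℍ → ℂ := fun τ => (ι d)⁻¹ * φ none τ * ∏ b, φ (some b) τ with hN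
  have hNφ (τ : ℍ) : ι d * N τ = ∏ i, φ i τ := by
    rw [Fintype.prod_option, hN]
    field_simp
  have hnone : HasQSeries 1 (fun τ => (ι d)⁻¹ * φ none τ) (PowerSeries.map ι ψ) := by
    have h1 := ((hU.1.mul (hV.1.heckeTerm_none p (k := l) hp)).add
      (hU'.1.mul (hV'.1.heckeTerm_none p (k := l') hp))).const_mul (ι d)⁻¹
    have h2 := congrArg (PowerSeries.map ι) hψ
    simp only [map_add, map_mul, PowerSeries.map_expand, hcomp, PowerSeries.map_C, map_pow,
      map_natCast] at h2
    have h3 : PowerSeries.C (ι d)⁻¹ * PowerSeries.C (ι d) = 1 := by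
      rw [← map_mul, inv_mul_cancel₀ hdC, map_one]
    have h4 : PowerSeries.map ι ψ = PowerSeries.C (ι d)⁻¹ * (PowerSeries.map ι u *
          ((p : PowerSeries ℂ) ^ l *
            PowerSeries.expand p hp (PowerSeries.map (Int.castRingHom ℂ) v)) +
        PowerSeries.map ι u' * ((p : PowerSeries ℂ) ^ l' *
          PowerSeries.expand p hp (PowerSeries.map (Int.castRingHom ℂ) v'))) := by
      linear_combination (PowerSeries.map ι ψ) * (-h3) - PowerSeries.C (ι d)⁻¹ * h2
    rw [h4]
    simpa only [map_pow, map_natCast] using! h1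
  have hsome (b : ZMod p) : HasQSeries p (φ (some b)) (PowerSeries.map ι (ψb b)) := by
    have h1 := ((hU.1.expand p hp).mul (hV.1.heckeTerm_some p (k := l) b)).add
      ((hU'.1.expand p hp).mul (hV'.1.heckeTerm_some p (k := l') b))
    have h2 (v : PowerSeries ℤ) : PowerSeries.map ι (PowerSeries.rescale (ζ ^ b.val)
        (PowerSeries.map (Int.castRingHom R) v)) =
        PowerSeries.rescale (Complex.exp (2 * Real.pi * Complex.I / p) ^ b.val)
          (PowerSeries.map (Int.castRingHom ℂ) v) := by
      ext n
      simp [PowerSeries.coeff_rescale, hζ]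
    simp only [← h2, ← PowerSeries.map_expand, ← map_mul, ← map_add] at h1
    exact h1
  have hNq : HasQSeries p N
      (PowerSeries.map ι (PowerSeries.expand p hp ψ * ∏ b, ψb b)) := by
    have h1 := (hnone.expand p hp).mul (HasQSeries.prod Finset.univ fun b _ => hsome b)
    rw [map_mul, map_prod, PowerSeries.map_expand]
    convert h1 using 1
    funext τ
    rw [Pi.mul_apply, Finset.prod_apply]
  have hTU {k : ℕ} {U : ℍ → ℂ} {u : PowerSeries ℂ} (hU : IsLevelOne k U u) (τ : ℍ) :
      U (ModularGroup.T • τ) = U τ :=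
    hU.1.apply_eq_of_qParam_eq (qParam_eq_of_eq_add_intCast 1 (by
      rw [modular_T_smul, UpperHalfPlane.coe_vadd]; push_cast; ring))
  have hNT (τ : ℍ) : N (ModularGroup.T • τ) = N τ := by
    simp only [hN, hφ]
    rw [hTU hU, hTU hU', heckeTerm_none_smul_T p hV, heckeTerm_none_smul_T p hV']
    congr 1
    refine Fintype.prod_equiv (Equiv.addRight (1 : ZMod p)) _ _ fun b => ?_
    rw [heckeTerm_some_smul_T p hV, heckeTerm_some_smul_T p hV', Equiv.coe_addRight]
  have hNS (τ : ℍ) : N (ModularGroup.S • τ) = (τ : ℂ) ^ (w * (p + 1)) * N τ := by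
    apply mul_left_cancel₀ hdC
    rw [hNφ, mul_left_comm, hNφ τ]
    have h1 (i : Option (ZMod p)) : φ i (ModularGroup.S • τ) =
        (τ : ℂ) ^ w * φ (heckeInv p i) τ := by
      simp only [hφ]
      rw [hU.2, hU'.2, heckeTerm_smul_S p hV, heckeTerm_smul_S p hV']
      linear_combination U τ * heckeTerm p l V (heckeInv p i) τ *
          (by rw [← hw, pow_add] : (τ : ℂ) ^ k * (τ : ℂ) ^ l = (τ : ℂ) ^ w) +
        U' τ * heckeTerm p l' V' (heckeInv p i) τ *
          (by rw [← hw', pow_add] : (τ : ℂ) ^ k' * (τ : ℂ) ^ l' = (τ : ℂ) ^ w)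
    simp only [h1, Finset.prod_mul_distrib, Finset.prod_const, Finset.card_univ]
    rw [Fintype.card_option, ZMod.card, ← pow_mul]
    congr 1
    exact Equiv.prod_comp (heckeInv_involutive p).toPerm fun i => φ i τ
  obtain ⟨g, hg, hNg⟩ := hNq.exists_expand p hι hp hNT
  obtain ⟨P, hP, hgP⟩ := IsLevelOne.exists_homPoly hι h6 _ (⟨hNg, hNS⟩ : IsLevelOne _ _ _)
  refine ⟨P, hP, fun τ => ?_, fun κ _ _ π => ?_⟩
  · rw [hgP] at hNg
    rw [← hNg.eq_eval₂ τ]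
    rw [← mul_eq_zero_iff_left hdC, hNφ, Finset.prod_eq_zero_iff]
    simp [hφ]
  · have hexp : Function.Injective (PowerSeries.expand p hp (R := κ)) := fun f g h => by
      ext n
      have := congrArg (PowerSeries.coeff (p * n)) h
      simpa using this
    have hPg : MvPolynomial.aeval ![eisSeries κ 240 3, eisSeries κ (-504) 5]
        (MvPolynomial.map π P) = PowerSeries.map π g := by
      rw [hgP]
      clear * -
      induction P using MvPolynomial.induction_on with
      | C c => simp
      | add P Q hP hQ => simp only [map_add, hP, hQ]
      | mul_X P i hP =>
        simp only [map_mul, hP, MvPolynomial.map_X, MvPolynomial.aeval_X]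
        fin_cases i <;> simp [map_eisSeries]
    have : ExpChar κ p := .prime Fact.out
    have hfrob (v : PowerSeries ℤ) := map_intCast_pow_eq_expand (κ := κ) p hp v
    have hζ1 : π ζ = 1 := by
      have h1 : ζ ^ p = 1 := hι (by
        rw [map_pow, hζ, map_one, (Complex.isPrimitiveRoot_exp p hp).pow_eq_one])
      have h2 : (π ζ - 1) ^ p = 0 := by
        rw [sub_pow_expChar, one_pow, ← map_pow, h1, map_one, sub_self]
      exact sub_eq_zero.mp (pow_eq_zero_iff hp |>.mp h2)
    apply hexp
    rw [hPg, ← PowerSeries.map_expand, ← hg, map_mul, map_prod]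
    have h1 (b : ZMod p) : PowerSeries.map π (ψb b) =
        PowerSeries.expand p hp (PowerSeries.map π u) * PowerSeries.map (Int.castRingHom κ) v +
        PowerSeries.expand p hp (PowerSeries.map π u') *
          PowerSeries.map (Int.castRingHom κ) v' := by
      simp only [hψb, map_add, map_mul, PowerSeries.map_expand]
      congr 2 <;>
      · ext n
        simp [PowerSeries.coeff_rescale, hζ1]
    simp only [h1, Finset.prod_const, Finset.card_univ, ZMod.card]
    have : ExpChar (PowerSeries κ) p :=
      expChar_of_injective_ringHom (PowerSeries.C_injective (R := κ)) p
    rw [add_pow_expChar, mul_pow, mul_pow, hfrob, hfrob, map_mul, map_add, map_mul, map_mul,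
      map_pow, map_pow, PowerSeries.map_expand, mul_comm]

end HeckeNormReduction

section IsogenyPolynomials

open UpperHalfPlane hiding I
open ModularForm

section CharP

variable {κ : Type*} [Field κ] (p : ℕ) [Fact p.Prime] [CharP κ p]

theorem isUnit_six_of_charP (hp : 5 ≤ p) : IsUnit (6 : κ) := by
  rw [isUnit_iff_ne_zero]
  intro h
  have h1 : ((6 : ℕ) : κ) = 0 := by exact_mod_cast h
  rw [CharP.cast_eq_zero_iff κ p] at h1
  rcases (Fact.out : p.Prime).dvd_mul.mp (show p ∣ 2 * 3 from h1) with h | h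
  · exact absurd (Nat.le_of_dvd (by norm_num) h) (by omega)
  · exact absurd (Nat.le_of_dvd (by norm_num) h) (by omega)

theorem homPoly.eq_of_X_pow_dvd_aeval_sub (hp : 5 ≤ p) {k m : ℕ} (hkm : k < 12 * m)
    {P Q : MvPolynomial (Fin 2) κ} (hP : P ∈ homPoly κ k) (hQ : Q ∈ homPoly κ k)
    (h : PowerSeries.X ^ m ∣ MvPolynomial.aeval ![eisSeries κ 240 3, eisSeries κ (-504) 5] P -
      MvPolynomial.aeval ![eisSeries κ 240 3, eisSeries κ (-504) 5] Q) : P = Q := by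
  obtain ⟨u, hu, hdu⟩ := exists_eisSeries_disc (isUnit_six_of_charP (κ := κ) p hp)
  rw [← map_sub] at h
  exact sub_eq_zero.mp (homPoly.eq_zero_of_X_pow_dvd (constantCoeff_eisSeries _ _)
    (constantCoeff_eisSeries _ _) hu.ne_zero hdu hkm (sub_mem hP hQ) h)

end CharP

theorem exists_homPoly_isogenous (p : ℕ) [Fact p.Prime] (hp : 5 ≤ p) {R : Type} [CommRing R]
    {ι : R →+* ℂ} (hι : Function.Injective ι) (h6 : IsUnit (6 : R)) {ζ : R}
    (hζ : ι ζ = Complex.exp (2 * Real.pi * Complex.I / p)) : ∃ P ∈ homPoly R (24 * (p + 1)),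
    (∀ τ, MvPolynomial.eval₂ ι ![E₄ τ, E₆ τ] P = 0 ↔ ∃ i : Option (ZMod p),
      E₄ τ ^ 3 * E₆ (heckePoint p i τ) ^ 2 = E₄ (heckePoint p i τ) ^ 3 * E₆ τ ^ 2) ∧
    ∀ (κ : Type) [Field κ] [CharP κ p] (π : R →+* κ), MvPolynomial.map π P =
      -(MvPolynomial.X 0 ^ (3 * p) * MvPolynomial.X 1 ^ 2 -
        MvPolynomial.X 0 ^ 3 * MvPolynomial.X 1 ^ (2 * p)) ^ 2 := by
  have hp0 : p ≠ 0 := by omega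
  have hpC : (p : ℂ) ≠ 0 := by exact_mod_cast hp0
  have hpR : ((p : R) ^ 12) ≠ 0 := fun h => hpC (by simpa using congrArg ι h)
  have hE₄ : IsLevelOne 12 (E₄ ^ 3) (PowerSeries.map ι (eisSeries R 240 3 ^ 3)) := by
    rw [map_pow, map_eisSeries]; exact isLevelOne_E₄.pow 3
  have hE₆ : IsLevelOne 12 (fun τ => (-1) * (E₆ ^ 2 : ℍ → ℂ) τ)
      (PowerSeries.map ι (-eisSeries R (-504) 5 ^ 2)) := by
    have := (isLevelOne_E₆.pow 2).const_mul (-1)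
    rwa [map_neg, map_one, neg_one_mul, ← map_eisSeries ι, ← map_pow, ← map_neg] at this
  have hE₄' : IsLevelOne 12 (E₄ ^ 3)
      (PowerSeries.map (Int.castRingHom ℂ) (eisSeries ℤ 240 3 ^ 3)) := by
    rw [map_pow, map_eisSeries]; exact isLevelOne_E₄.pow 3
  have hE₆' : IsLevelOne 12 (E₆ ^ 2)
      (PowerSeries.map (Int.castRingHom ℂ) (eisSeries ℤ (-504) 5 ^ 2)) := by
    rw [map_pow, map_eisSeries]; exact isLevelOne_E₆.pow 2
  obtain ⟨P, hP, hP0, hPπ⟩ := exists_homPoly_heckeNorm p hι h6 hζ rfl rfl hE₄ hE₆ hE₆' hE₄' hp0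
    hpR (ψ := eisSeries R 240 3 ^ 3 * PowerSeries.expand p hp0 (eisSeries R (-504) 5 ^ 2) -
      eisSeries R (-504) 5 ^ 2 * PowerSeries.expand p hp0 (eisSeries R 240 3 ^ 3))
    (by simp only [map_pow, map_eisSeries]; ring)
  refine ⟨P, hP, fun τ => ?_, fun κ _ _ π => ?_⟩
  · rw [hP0]
    refine exists_congr fun i => ?_
    have hi : (i.elim (p : ℂ) fun _ => 1) ^ 12 ≠ 0 := by
      rcases i with _ | b
      · exact pow_ne_zero _ hpC
      · simp
    simp only [heckeTerm, Pi.pow_apply]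
    rw [← sub_eq_zero (a := E₄ τ ^ 3 * _)]
    refine (Eq.congr ?_ rfl).trans (mul_eq_zero_iff_left hi)
    ring
  · have hX0 := homPoly.X0_mem (R := κ)
    have hX1 := homPoly.X1_mem (R := κ)
    have hQ : MvPolynomial.X 0 ^ (3 * p) * MvPolynomial.X 1 ^ 2 -
        MvPolynomial.X 0 ^ 3 * MvPolynomial.X 1 ^ (2 * p) ∈ homPoly κ (12 * (p + 1)) := by
      refine sub_mem ?_ ?_
      · exact homPoly.monomial_mem _ _ (by ring)
      · exact homPoly.monomial_mem _ _ (by ring)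
    refine homPoly.eq_of_X_pow_dvd_aeval_sub p hp (m := 3 * (p + 1)) (by omega)
      (homPoly.map_mem π hP) (neg_mem ?_) ?_
    · have := homPoly.pow_mem hQ 2
      rwa [← mul_assoc] at this
    · have : ExpChar (PowerSeries κ) p :=
        have : ExpChar κ p := .prime Fact.out
        expChar_of_injective_ringHom (PowerSeries.C_injective (R := κ)) p
      rw [hPπ]
      have hexp (c : ℤ) (s : ℕ) : PowerSeries.expand p hp0 (eisSeries κ c s) =
          eisSeries κ c s ^ p := by
        rw [← map_eisSeries (Int.castRingHom κ), map_intCast_pow_eq_expand]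
      convert dvd_zero _ using 1
      simp only [map_sub, map_mul, map_neg, map_pow, PowerSeries.map_expand, map_eisSeries, hexp,
        MvPolynomial.aeval_X, Matrix.cons_val_zero, Matrix.cons_val_one, Matrix.cons_val_fin_one]
      rw [neg_pow, neg_one_pow_expChar]
      ring

/-- The norm of `c E₄(τ) - E₄(M)(τ)` over the integral matrices `M` of determinant `p`, divided
by the common factor `d` of `c` and `p ^ 4`. -/
theorem exists_homPoly_E₄ (p : ℕ) [Fact p.Prime] (hp : 5 ≤ p) {R : Type} [CommRing R]
    {ι : R →+* ℂ} (hι : Function.Injective ι) (h6 : IsUnit (6 : R)) {ζ : R}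
    (hζ : ι ζ = Complex.exp (2 * Real.pi * Complex.I / p)) (c d e : R) (hde : d * (p * e) = p ^ 4) :
    ∃ P ∈ homPoly R (4 * (p + 1)),
    (∀ τ, MvPolynomial.eval₂ ι ![E₄ τ, E₆ τ] P = 0 ↔ ∃ i : Option (ZMod p),
      ι (d * c) * E₄ τ = heckeTerm p 4 E₄ i τ) ∧
    ∀ (κ : Type) [Field κ] [CharP κ p] (π : R →+* κ), MvPolynomial.map π P =
      MvPolynomial.C (π c) * MvPolynomial.X 0 *
        (MvPolynomial.C (π (d * c)) ^ p * MvPolynomial.X 0 ^ p -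
          hasse ((p - 1) / 2) (MvPolynomial.X 0) (MvPolynomial.X 1) ^ 4 * MvPolynomial.X 0) := by
  have hp0 : p ≠ 0 := by omega
  have hpC : (p : ℂ) ≠ 0 := by exact_mod_cast hp0
  have hd : d ≠ 0 := by
    rintro rfl
    rw [zero_mul] at hde
    exact pow_ne_zero 4 hpC (by simpa using (congrArg ι hde).symm)
  have hU : IsLevelOne 4 (fun τ => ι (d * c) * E₄ τ)
      (PowerSeries.map ι (PowerSeries.C (d * c) * eisSeries R 240 3)) := by
    have := isLevelOne_E₄.const_mul (ι (d * c))
    rwa [← map_eisSeries ι, ← PowerSeries.map_C, ← map_mul] at this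
  have hU' : IsLevelOne 0 (fun _ => ι (-1)) (PowerSeries.map ι (PowerSeries.C (-1))) := by
    rw [PowerSeries.map_C]
    exact .const _
  have hV : IsLevelOne 0 (fun _ => Int.castRingHom ℂ 1)
      (PowerSeries.map (Int.castRingHom ℂ) (PowerSeries.C 1)) := by
    rw [PowerSeries.map_C]
    exact .const _
  have hV' : IsLevelOne 4 E₄ (PowerSeries.map (Int.castRingHom ℂ) (eisSeries ℤ 240 3)) := by
    rw [map_eisSeries]
    exact isLevelOne_E₄
  obtain ⟨P, hP, hP0, hPπ⟩ := exists_homPoly_heckeNorm p hι h6 hζ (w := 4) rfl rfl hU hU' hV hV'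
    hp0 hd
    (ψ := PowerSeries.C c * eisSeries R 240 3 -
      PowerSeries.C (p * e) * PowerSeries.expand p hp0 (eisSeries R 240 3))
    (by
      rw [← hde]
      simp only [map_mul, map_eisSeries, map_one, map_neg, pow_zero]
      ring)
  refine ⟨P, hP, fun τ => ?_, fun κ _ _ π => ?_⟩
  · rw [hP0]
    refine exists_congr fun i => ?_
    rw [← sub_eq_zero (a := ι (d * c) * _)]
    refine Eq.congr ?_ rfl
    simp [heckeTerm]
    ring
  · have hm : 2 * ((p - 1) / 2) = p - 1 := by
      have : p % 2 = 1 := (Fact.out : p.Prime).eq_two_or_odd.resolve_left (by omega)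
      omega
    have hQ : MvPolynomial.C (π c) * MvPolynomial.X 0 *
        (MvPolynomial.C (π (d * c)) ^ p * MvPolynomial.X 0 ^ p -
          hasse ((p - 1) / 2) (MvPolynomial.X 0) (MvPolynomial.X 1) ^ 4 * MvPolynomial.X 0) ∈
          homPoly κ (4 + (4 * p)) := by
      refine homPoly.mul_mem (homPoly.C_mul_mem homPoly.X0_mem _) (sub_mem ?_ ?_)
      · rw [← map_pow]
        exact homPoly.C_mul_mem (mul_comm p 4 ▸ homPoly.pow_mem homPoly.X0_mem p) _
      · have := homPoly.mul_mem (homPoly.pow_mem (hasse_mem_homPoly κ ((p - 1) / 2)) 4)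
          homPoly.X0_mem
        rwa [hm, show 4 * (p - 1) + 4 = 4 * p by omega] at this
    refine homPoly.eq_of_X_pow_dvd_aeval_sub p hp (m := p) (by omega)
      (homPoly.map_mem π hP) (by rwa [show 4 * (p + 1) = 4 + 4 * p by ring]) ?_
    have : ExpChar (PowerSeries κ) p :=
      have : ExpChar κ p := .prime Fact.out
      expChar_of_injective_ringHom (PowerSeries.C_injective (R := κ)) p
    obtain ⟨g, hg⟩ := X_pow_dvd_hasse_pow_four_sub_one p hp (constantCoeff_eisSeries (R := κ) 240 3)
      (constantCoeff_eisSeries (-504) 5) (ramanujan_E₄ κ) (ramanujan_E₆ κ) (ramanujan_E2 κ)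
    rw [hPπ]
    refine ⟨PowerSeries.C (π c) * eisSeries κ 240 3 * g * eisSeries κ 240 3, ?_⟩
    have hmap : MvPolynomial.aeval ![eisSeries κ 240 3, eisSeries κ (-504) 5]
        (hasse ((p - 1) / 2) (MvPolynomial.X 0 : MvPolynomial (Fin 2) κ) (MvPolynomial.X 1)) =
        hasse ((p - 1) / 2) (eisSeries κ 240 3) (eisSeries κ (-504) 5) := by
      have := map_hasse (MvPolynomial.aeval (R := κ)
        ![eisSeries κ 240 3, eisSeries κ (-504) 5]).toRingHom ((p - 1) / 2)
        (MvPolynomial.X 0) (MvPolynomial.X 1)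
      simpa using! this
    have hCC (x : κ) : algebraMap κ (PowerSeries κ) x = PowerSeries.C x := rfl
    have hpκ : ((p : ℕ) : PowerSeries κ) = 0 := by
      rw [← map_natCast PowerSeries.C, CharP.cast_eq_zero, map_zero]
    simp only [map_sub, map_mul, map_pow, MvPolynomial.aeval_C, PowerSeries.map_C, map_eisSeries,
      hmap, MvPolynomial.aeval_X, Matrix.cons_val_zero, map_natCast, hpκ, hCC, map_neg, map_one]
    rw [neg_one_pow_expChar]
    linear_combination (PowerSeries.C (π c) * eisSeries κ 240 3 ^ 2) * hg

end IsogenyPolynomials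

section LatticeUniqueness

open UpperHalfPlane hiding I
open ModularForm PeriodPair
open scoped PeriodPair Topology MatrixGroups

namespace PeriodPair

theorem weierstrassP_eq_of_G_eq {L L' : PeriodPair} {c : ℂ} (hc0 : c ≠ 0)
    (h : ∀ k, 3 ≤ k → L.G k = c ^ k * L'.G k) :
    ∀ᶠ z in 𝓝[≠] (0 : ℂ), L.weierstrassP z = c ^ 2 * L'.weierstrassP (c * z) := by
  have hsum (M : PeriodPair) : ∀ᶠ z in 𝓝 (0 : ℂ), HasSum
      (fun n : ℕ => if n = 0 then 0 else (n + 1) * M.G (n + 2) * z ^ n)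
      (M.weierstrassPExcept 0 z) := by
    filter_upwards [(M.hasFPowerSeriesAt_weierstrassPExcept 0).eventually_hasSum] with z hz
    rw [zero_add] at hz
    refine hz.congr_fun fun n => ?_
    rw [FormalMultilinearSeries.ofScalars_apply_eq]
    rcases eq_or_ne n 0 with rfl | hn
    · have h0 : M.weierstrassPExcept 0 0 = 0 := by
        simp [M.weierstrassPExcept_def ⟨0, M.lattice.zero_mem⟩]
      simp [h0]
    · simp [hn]
  have hc : Filter.Tendsto (fun z => c * z) (𝓝 0) (𝓝 0) :=
    Continuous.tendsto' (by fun_prop) _ _ (mul_zero c)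
  filter_upwards [nhdsWithin_le_nhds (hsum L), nhdsWithin_le_nhds (hc.eventually (hsum L')),
    self_mem_nhdsWithin] with z h1 h2 hz
  have hE : L.weierstrassPExcept 0 z = c ^ 2 * L'.weierstrassPExcept 0 (c * z) := by
    refine h1.unique ((h2.mul_left (c ^ 2)).congr_fun fun n => ?_)
    rcases eq_or_ne n 0 with rfl | hn
    · simp
    · simp only [hn, if_false]
      rw [h (n + 2) (by omega)]
      ring
  rw [← L.weierstrassPExcept_add ⟨0, L.lattice.zero_mem⟩,
    ← L'.weierstrassPExcept_add ⟨0, L'.lattice.zero_mem⟩]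
  simp only [hE, mul_add]
  have hz' : z ≠ 0 := hz
  field_simp
  simp only [sub_zero]
  ring

theorem mul_mem_lattice_of_G_eq {L L' : PeriodPair} {c : ℂ} (hc : c ≠ 0)
    (h : ∀ k, 3 ≤ k → L.G k = c ^ k * L'.G k) {l : ℂ} (hl : l ∈ L.lattice) :
    c * l ∈ L'.lattice := by
  by_contra hcl
  have hmer : Meromorphic fun z => c ^ 2 * L'.weierstrassP (c * z) := fun z =>
    (MeromorphicAt.const _ _).mul
      ((L'.meromorphic_weierstrassP (c * z)).comp_analyticAt (g := fun z => c * z) (by fun_prop))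
  have hsub : MeromorphicOn (fun z => L.weierstrassP z - c ^ 2 * L'.weierstrassP (c * z))
      Set.univ := fun z _ => (L.meromorphic_weierstrassP z).sub (hmer z)
  have htop : meromorphicOrderAt
      (fun z => L.weierstrassP z - c ^ 2 * L'.weierstrassP (c * z)) l = ⊤ := by
    by_contra hne
    refine hsub.meromorphicOrderAt_ne_top_of_isPreconnected (x := l) (y := 0) isPreconnected_univ
      trivial trivial hne ?_
    rw [meromorphicOrderAt_eq_top_iff]
    filter_upwards [weierstrassP_eq_of_G_eq hc h] with z hz using sub_eq_zero.mpr hz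
  rw [meromorphicOrderAt_eq_top_iff] at htop
  have horder : meromorphicOrderAt (fun z => c ^ 2 * L'.weierstrassP (c * z)) l = -2 := by
    rw [← L.order_weierstrassP l hl]
    refine (meromorphicOrderAt_congr ?_).symm
    filter_upwards [htop] with z hz using sub_eq_zero.mp hz
  have han : AnalyticAt ℂ (fun z => c ^ 2 * L'.weierstrassP (c * z)) l := by
    have := L'.analyticOnNhd_weierstrassP (c * l) hcl
    exact analyticAt_const.mul (this.fun_comp (f := fun z => c * z) (by fun_prop))
  have := han.meromorphicOrderAt_nonneg
  rw [horder] at this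
  exact absurd this (by decide)

/-- The periods `τ` and `1`. -/
def ofUpperHalfPlane (τ : ℍ) : PeriodPair where
  ω₁ := τ
  ω₂ := 1
  indep := by
    rw [LinearIndependent.pair_iff]
    intro s t h
    have him := congrArg Complex.im h
    have hs : s = 0 := by simpa [τ.im_ne_zero] using him
    subst hs
    simpa using h

theorem mem_lattice_ofUpperHalfPlane {τ : ℍ} {x : ℂ} :
    x ∈ (ofUpperHalfPlane τ).lattice ↔ ∃ m n : ℤ, m * (τ : ℂ) + n = x := by
  simp [mem_lattice, ofUpperHalfPlane]

theorem G_ofUpperHalfPlane {k : ℕ} (hk : 3 ≤ k) (τ : ℍ) :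
    (ofUpperHalfPlane τ).G k = 2 * riemannZeta k * ModularForm.E hk τ := by
  have h := tsum_eisSummand_eq_riemannZeta_mul_eisensteinSeries hk τ
  have hE : ModularForm.E hk τ = 1 / 2 * _root_.eisensteinSeries (N := 1) 0 k τ := rfl
  rw [hE, G, show 2 * riemannZeta k * (1 / 2 * _root_.eisensteinSeries (N := 1) 0 k τ) =
    riemannZeta k * _root_.eisensteinSeries (N := 1) 0 k τ by ring, ← h,
    ← ((ofUpperHalfPlane τ).latticeEquivProd.toEquiv.trans (finTwoArrowEquiv ℤ).symm).symm.tsum_eq]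
  refine tsum_congr fun v => ?_
  simp [EisensteinSeries.eisSummand, latticeEquiv_symm_apply, zpow_neg]
  simp [ofUpperHalfPlane]

end PeriodPair

theorem E_eq_pow_mul {τ τ' : ℍ} {c : ℂ} (h4 : E₄ τ = c ^ 4 * E₄ τ') (h6 : E₆ τ = c ^ 6 * E₆ τ')
    {k : ℕ} (hk : 3 ≤ k) : ModularForm.E hk τ = c ^ k * ModularForm.E hk τ' := by
  have hE := IsLevelOne.of_modularForm (ModularForm.E hk)
  obtain ⟨P, hP, h⟩ := IsLevelOne.exists_homPoly (ι := RingHom.id ℂ) Function.injective_id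
    (by norm_num) k (F := ModularForm.E hk)
    (f := UpperHalfPlane.qExpansion 1 (ModularForm.E hk)) (by simpa using hE)
  have hq : HasQSeries 1 (ModularForm.E hk) (PowerSeries.map (RingHom.id ℂ)
      (MvPolynomial.aeval ![eisSeries ℂ 240 3, eisSeries ℂ (-504) 5] P)) := by
    simpa [← h] using hE.hasQSeries
  rw [hq.eq_eval₂, hq.eq_eval₂, h4, h6, homPoly.eval₂_scale _ hP]

theorem exists_smul_eq_of_E_eq {τ τ' : ℍ} {c : ℂ} (h4 : E₄ τ = c ^ 4 * E₄ τ')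
    (h6 : E₆ τ = c ^ 6 * E₆ τ') (hc : c ≠ 0) : ∃ γ : Matrix.SpecialLinearGroup (Fin 2) ℤ,
    γ • τ' = τ := by
  have hG (k : ℕ) (hk : 3 ≤ k) :
      (ofUpperHalfPlane τ).G k = c ^ k * (ofUpperHalfPlane τ').G k := by
    rw [G_ofUpperHalfPlane hk, G_ofUpperHalfPlane hk, E_eq_pow_mul h4 h6 hk]
    ring
  have hG' (k : ℕ) (hk : 3 ≤ k) :
      (ofUpperHalfPlane τ').G k = c⁻¹ ^ k * (ofUpperHalfPlane τ).G k := by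
    rw [hG k hk, ← mul_assoc, ← mul_pow, inv_mul_cancel₀ hc, one_pow, one_mul]
  have key (x : ℂ) (hx : ∃ m n : ℤ, m * (τ : ℂ) + n = x) :
      ∃ m n : ℤ, m * (τ' : ℂ) + n = c * x := by
    rw [← mem_lattice_ofUpperHalfPlane] at hx ⊢
    exact mul_mem_lattice_of_G_eq hc hG hx
  have key' (x : ℂ) (hx : ∃ m n : ℤ, m * (τ' : ℂ) + n = x) :
      ∃ m n : ℤ, m * (τ : ℂ) + n = c⁻¹ * x := by
    rw [← mem_lattice_ofUpperHalfPlane] at hx ⊢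
    exact mul_mem_lattice_of_G_eq (inv_ne_zero hc) hG' hx
  obtain ⟨a, b, hab⟩ := key τ ⟨1, 0, by simp⟩
  obtain ⟨r, s, hrs⟩ := key 1 ⟨0, 1, by simp⟩
  obtain ⟨a', b', hab'⟩ := key' τ' ⟨1, 0, by simp⟩
  obtain ⟨r', s', hrs'⟩ := key' 1 ⟨0, 1, by simp⟩
  have hlin (x y x' y' : ℤ) (h : x * (τ' : ℂ) + y = x' * τ' + y') : x = x' ∧ y = y' := by
    have him := congrArg Complex.im h
    have hx : x = x' := by simpa [τ'.im_ne_zero] using him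
    subst hx
    exact ⟨rfl, by simpa using h⟩
  obtain ⟨h11, h12⟩ := hlin (a' * a + b' * r) (a' * b + b' * s) 1 0 (by
    push_cast
    linear_combination a' * hab + b' * hrs + c * hab' + τ' * mul_inv_cancel₀ hc)
  obtain ⟨h21, h22⟩ := hlin (r' * a + s' * r) (r' * b + s' * s) 0 1 (by
    push_cast
    linear_combination r' * hab + s' * hrs + c * hrs' + mul_inv_cancel₀ hc)
  have hdet : (a * s - b * r) * (a' * s' - b' * r') = 1 := by
    linear_combination (r' * b + s' * s) * h11 + h22 - (r' * a + s' * r) * h12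
  have him : Complex.normSq c * τ.im = (a * s - b * r : ℤ) * τ'.im := by
    have h1 : c * τ * (starRingEnd ℂ) c = (a * τ' + b) * (starRingEnd ℂ) (r * τ' + s) := by
      rw [hab, hrs, mul_one]
    have h2 := congrArg Complex.im h1
    rw [mul_right_comm, Complex.mul_conj] at h2
    simp only [Complex.im_ofReal_mul] at h2
    rw [show τ.im = (τ : ℂ).im from rfl, h2]
    simp
    ring
  have hpos : 0 < a * s - b * r := by
    have : (0 : ℝ) < (a * s - b * r : ℤ) * τ'.im := by
      rw [← him]
      exact mul_pos (Complex.normSq_pos.mpr hc) τ.im_pos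
    exact_mod_cast pos_of_mul_pos_left this τ'.im_pos.le
  have hdet1 : a * s - b * r = 1 := by
    rcases Int.isUnit_iff.mp (IsUnit.of_mul_eq_one _ hdet) with h | h
    · exact h
    · omega
  let γ : Matrix.SpecialLinearGroup (Fin 2) ℤ :=
    ⟨!![a, b; r, s], by rw [Matrix.det_fin_two_of, hdet1]⟩
  refine ⟨γ, UpperHalfPlane.ext ?_⟩
  rw [coe_smul_eq]
  simp [γ, hab, hrs, hc]

theorem IsLevelOne.tendsto_atImInfty {k : ℕ} {F : ℍ → ℂ} {f : PowerSeries ℂ}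
    (hF : IsLevelOne k F f) : Filter.Tendsto F atImInfty (𝓝 (PowerSeries.coeff 0 f)) := by
  obtain ⟨M, rfl, rfl⟩ := hF.exists_modularForm
  have han := ModularFormClass.analyticAt_cuspFunction_zero M one_pos one_mem_strictPeriods_SL
  have hM : (UpperHalfPlane.cuspFunction 1 M ∘ fun τ : ℍ => Function.Periodic.qParam 1 τ) = M := by
    funext τ
    exact SlashInvariantFormClass.eq_cuspFunction M τ one_mem_strictPeriods_SL one_ne_zero
  have := han.continuousAt.tendsto.comp (qParam_tendsto_atImInfty one_pos)
  rw [hM] at this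
  simpa [qExpansion_coeff] using this

/-- The `j`-invariant is surjective. -/
theorem exists_E₄_E₆_eq {x y : ℂ} (hx : x ≠ 0) (hy : y ≠ 0) (hxy : x ^ 3 ≠ y ^ 2) :
    ∃ (τ : ℍ) (c : ℂ), c ≠ 0 ∧ x = c ^ 4 * E₄ τ ∧ y = c ^ 6 * E₆ τ := by
  let F : ℍ → ℂ := fun τ => y ^ 2 * E₄ τ ^ 3 - x ^ 3 * E₆ τ ^ 2
  have hF : IsLevelOne 12 F
      (PowerSeries.C (y ^ 2) * eisSeries ℂ 240 3 ^ 3 -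
        PowerSeries.C (x ^ 3) * eisSeries ℂ (-504) 5 ^ 2) :=
    ((isLevelOne_E₄.pow 3).const_mul (y ^ 2)).sub ((isLevelOne_E₆.pow 2).const_mul (x ^ 3))
  obtain ⟨τ, hτ⟩ : ∃ τ, F τ = 0 := by
    by_contra! hne
    have hinv : IsBoundedAtImInfty fun τ => (F τ)⁻¹ := by
      have h0 : PowerSeries.coeff 0 (PowerSeries.C (y ^ 2) * eisSeries ℂ 240 3 ^ 3 -
          PowerSeries.C (x ^ 3) * eisSeries ℂ (-504) 5 ^ 2) ≠ 0 := by
        simp [constantCoeff_eisSeries, sub_eq_zero, hxy.symm]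
      have := (hF.tendsto_atImInfty).inv₀ h0
      exact this.isBigO_one ℝ
    have hslash (γ : Matrix.SpecialLinearGroup (Fin 2) ℤ) :
        (fun τ => (F τ)⁻¹) ∣[(-12 : ℤ)] γ = fun τ => (F τ)⁻¹ := by
      funext τ
      rw [SL_slash_apply, hF.apply_smul, mul_inv, neg_neg, mul_right_comm, ← zpow_natCast,
        ← zpow_neg, ← zpow_add₀ (denom_ne_zero _ _)]
      simp
    let N : ModularForm 𝒮ℒ (-12) :=
      { toFun := fun τ => (F τ)⁻¹
        slash_action_eq' := fun _ ⟨γ, hγ⟩ ↦ hγ ▸ hslash γ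
        holo' := fun τ => by
          have := mdifferentiableAt_iff.mp (hF.hasQSeries.mdifferentiable one_pos τ)
          refine mdifferentiableAt_iff.mpr (this.inv ?_)
          simpa using hne τ
        bdd_at_cusps' := fun {c} hc => by
          rw [Subgroup.IsArithmetic.isCusp_iff_isCusp_SL2Z] at hc
          rw [OnePoint.isBoundedAt_iff_forall_SL2Z hc]
          intro γ _
          rw [hslash γ]
          exact hinv }
    have h0 := congrFun (ModularFormClass.levelOne_neg_weight_eq_zero (k := -12) (by norm_num) N)
      UpperHalfPlane.I
    exact hne UpperHalfPlane.I (inv_eq_zero.mp h0)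
  simp only [F] at hτ
  have hdisc : E₄ τ ^ 3 ≠ E₆ τ ^ 2 := fun h => ModularForm.discriminant_ne_zero τ (by
    rw [discriminant_eq_E₄_cube_sub_E₆_sq, h, sub_self, zero_div])
  have h4 : E₄ τ ≠ 0 := fun h => by
    simp only [h, ne_eq, OfNat.ofNat_ne_zero, not_false_eq_true, zero_pow, mul_zero, zero_sub,
      neg_eq_zero, mul_eq_zero, hx, pow_eq_zero_iff, false_or] at hτ
    exact hdisc (by simp [h, hτ])
  have h6 : E₆ τ ≠ 0 := fun h => by
    simp only [h, ne_eq, OfNat.ofNat_ne_zero, not_false_eq_true, zero_pow, mul_zero, sub_zero,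
      mul_eq_zero, hy, pow_eq_zero_iff, false_or] at hτ
    exact h4 hτ
  obtain ⟨c, hc⟩ := IsAlgClosed.exists_pow_nat_eq (y * E₄ τ / (x * E₆ τ)) zero_lt_two
  refine ⟨τ, c, fun h => ?_, ?_, ?_⟩
  · rw [h, zero_pow two_ne_zero, eq_comm, div_eq_zero_iff] at hc
    simp [hx, hy, h4, h6] at hc
  · rw [show c ^ 4 = (c ^ 2) ^ 2 by ring, hc]
    field_simp
    linear_combination -hτ
  · rw [show c ^ 6 = (c ^ 2) ^ 3 by ring, hc]
    field_simp
    linear_combination -hτ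

end LatticeUniqueness

section ComplexMultiplication

open UpperHalfPlane hiding I
open ModularForm
open scoped MatrixGroups

/-- The action of the integer matrix `M` by fractional linear transformations fixes `τ`. -/
def FixesPoint (M : Matrix (Fin 2) (Fin 2) ℤ) (τ : ℍ) : Prop :=
  (M 0 0 : ℂ) * τ + M 0 1 = τ * (M 1 0 * τ + M 1 1)

namespace FixesPoint

variable {M : Matrix (Fin 2) (Fin 2) ℤ} {τ : ℍ}

theorem two_mul_re (h : FixesPoint M τ) : 2 * (M 1 0 : ℝ) * τ.re = M 0 0 - M 1 1 := by
  have h1 := congrArg Complex.im h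
  simp only [Complex.add_im, Complex.mul_im, Complex.intCast_re, Complex.intCast_im, coe_im,
    coe_re, Complex.add_re, Complex.mul_re, zero_mul, add_zero, sub_zero] at h1
  have := τ.im_ne_zero
  apply mul_right_cancel₀ this
  linear_combination -h1

theorem mul_normSq (h : FixesPoint M τ) : (M 1 0 : ℝ) * (τ.re ^ 2 + τ.im ^ 2) = -M 0 1 := by
  have h1 := congrArg Complex.re h
  simp only [Complex.add_im, Complex.mul_im, Complex.intCast_re, Complex.intCast_im, coe_im,
    coe_re, Complex.add_re, Complex.mul_re, zero_mul, add_zero, sub_zero] at h1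
  linear_combination h1 + τ.re * h.two_mul_re

theorem trace_sq_sub (h : FixesPoint M τ) :
    (M.trace : ℝ) ^ 2 - 4 * M.det = -4 * (M 1 0 : ℝ) ^ 2 * τ.im ^ 2 := by
  rw [Matrix.trace_fin_two, Matrix.det_fin_two]
  push_cast
  linear_combination (-(M 0 0 : ℝ) + M 1 1 - 2 * (M 1 0 : ℝ) * τ.re) * h.two_mul_re
    + 4 * (M 1 0 : ℝ) * h.mul_normSq

theorem apply_one_zero_ne_zero (h : FixesPoint M τ) {p : ℕ} [Fact p.Prime] (hM : M.det = p) :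
    M 1 0 ≠ 0 := fun h0 => by
  have h1 := h.two_mul_re
  have h2 := h.mul_normSq
  simp only [h0, Int.cast_zero, mul_zero, zero_mul] at h1 h2
  have h3 : M 0 0 = M 1 1 := by exact_mod_cast sub_eq_zero.mp h1.symm
  have h4 : M 0 1 = 0 := by exact_mod_cast neg_eq_zero.mp h2.symm
  rw [Matrix.det_fin_two, h0, h3, mul_zero, sub_zero] at hM
  exact (Nat.prime_iff_prime_int.mp (Fact.out : p.Prime)).irreducible.not_isSquare ⟨_, hM.symm⟩

theorem trace_sq_lt (h : FixesPoint M τ) {p : ℕ} [Fact p.Prime] (hM : M.det = p) :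
    M.trace ^ 2 < 4 * p := by
  have h1 := h.trace_sq_sub
  have h2 : (0 : ℝ) < (M 1 0 : ℝ) ^ 2 * τ.im ^ 2 := by
    have := h.apply_one_zero_ne_zero hM
    have := τ.im_pos
    positivity
  have h3 : (M.trace : ℝ) ^ 2 < 4 * p := by
    rw [hM] at h1
    push_cast at h1
    linarith
  exact_mod_cast h3

theorem adjugate (h : FixesPoint M τ) : FixesPoint M.adjugate τ := by
  simp only [FixesPoint, Matrix.adjugate_fin_two, Matrix.of_apply, Matrix.cons_val',
    Matrix.cons_val, Int.cast_neg] at h ⊢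
  linear_combination -h

theorem denom_mul_denom_adjugate (h : FixesPoint M τ) :
    ((M 1 0 : ℂ) * τ + M 1 1) * (M.adjugate 1 0 * τ + M.adjugate 1 1) = M.det := by
  simp only [FixesPoint, Matrix.adjugate_fin_two, Matrix.det_fin_two, Matrix.of_apply,
    Matrix.cons_val', Matrix.cons_val, Int.cast_neg, Int.cast_sub, Int.cast_mul] at h ⊢
  linear_combination (M 1 0 : ℂ) * h

theorem denom_add_denom_adjugate (M : Matrix (Fin 2) (Fin 2) ℤ) (τ : ℍ) :
    ((M 1 0 : ℂ) * τ + M 1 1) + (M.adjugate 1 0 * τ + M.adjugate 1 1) = M.trace := by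
  simp [Matrix.adjugate_fin_two, Matrix.trace_fin_two]
  ring

theorem conj (h : FixesPoint M τ) (γ : SL(2, ℤ)) {N : Matrix (Fin 2) (Fin 2) ℤ}
    (hN : N * γ = γ * M) : FixesPoint N (γ • τ) := by
  have e (i j : Fin 2) := congrArg (Int.cast : ℤ → ℂ) (congrFun (congrFun hN i) j)
  simp only [Matrix.mul_apply, Fin.sum_univ_two, Int.cast_add, Int.cast_mul] at e
  have hd : ((γ 1 0 : ℤ) : ℂ) * τ + (γ 1 1 : ℤ) ≠ 0 := by
    have := denom_ne_zero γ τ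
    rwa [ModularGroup.denom_apply] at this
  rw [FixesPoint] at h ⊢
  have k1 : (N 0 0 : ℂ) * ((γ 0 0 : ℤ) * τ + (γ 0 1 : ℤ)) +
      N 0 1 * ((γ 1 0 : ℤ) * τ + (γ 1 1 : ℤ)) =
      (M 1 0 * τ + M 1 1) * ((γ 0 0 : ℤ) * τ + (γ 0 1 : ℤ)) := by
    linear_combination τ * e 0 0 + e 0 1 + (γ 0 0 : ℤ) * h
  have k2 : (N 1 0 : ℂ) * ((γ 0 0 : ℤ) * τ + (γ 0 1 : ℤ)) +
      N 1 1 * ((γ 1 0 : ℤ) * τ + (γ 1 1 : ℤ)) =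
      (M 1 0 * τ + M 1 1) * ((γ 1 0 : ℤ) * τ + (γ 1 1 : ℤ)) := by
    linear_combination τ * e 1 0 + e 1 1 + (γ 1 0 : ℤ) * h
  rw [coe_smul_eq]
  set D := ((γ 1 0 : ℤ) : ℂ) * τ + (γ 1 1 : ℤ)
  set W := ((γ 0 0 : ℤ) : ℂ) * τ + (γ 0 1 : ℤ)
  field_simp
  linear_combination D * k1 - W * k2

theorem ext_of_eq {τ' : ℍ} (h : FixesPoint M τ) (h' : FixesPoint M τ') (h0 : M 1 0 ≠ 0) :
    τ = τ' := by
  have h0' : (M 1 0 : ℝ) ≠ 0 := by exact_mod_cast h0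
  have hre : τ.re = τ'.re :=
    mul_left_cancel₀ (mul_ne_zero two_ne_zero h0') (h.two_mul_re.trans h'.two_mul_re.symm)
  have him := mul_left_cancel₀ h0' (h.mul_normSq.trans h'.mul_normSq.symm)
  rw [hre, add_right_inj, sq_eq_sq₀ τ.im_pos.le τ'.im_pos.le] at him
  exact UpperHalfPlane.ext (Complex.ext hre him)

theorem abs_le_of_mem_fd (h : FixesPoint M τ) (hτ : τ ∈ ModularGroup.fd) :
    |M 0 0 - M 1 1| ≤ |M 1 0| ∧ |M 1 0| ≤ |M 0 1| := by
  have h1 := h.two_mul_re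
  have h2 := h.mul_normSq
  obtain ⟨hn, hre⟩ := hτ
  constructor
  · have : |(M 0 0 - M 1 1 : ℝ)| ≤ |(M 1 0 : ℝ)| := by
      rw [← h1, abs_mul, abs_mul, abs_two]
      nlinarith [abs_nonneg (M 1 0 : ℝ)]
    exact_mod_cast this
  · have h3 : 1 ≤ τ.re ^ 2 + τ.im ^ 2 := by
      rw [Complex.normSq_apply] at hn
      simpa [sq] using hn
    have : |(M 1 0 : ℝ)| ≤ |(M 0 1 : ℝ)| := by
      rw [← abs_neg (M 0 1 : ℝ), ← h2, abs_mul, abs_of_nonneg (zero_le_one.trans h3)]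
      exact le_mul_of_one_le_right (abs_nonneg _) h3
    exact_mod_cast this

end FixesPoint

variable (p : ℕ) [Fact p.Prime]

/-- The matrices defining `heckePoint`. -/
def heckeMatrix : Option (ZMod p) → Matrix (Fin 2) (Fin 2) ℤ
  | none => !![p, 0; 0, 1]
  | some b => !![1, b.val; 0, p]

theorem exists_mul_eq_heckeMatrix {M : Matrix (Fin 2) (Fin 2) ℤ} (hM : M.det = p) :
    ∃ (γ : SL(2, ℤ)) (i : Option (ZMod p)), γ * M = heckeMatrix p i := by
  have hp : p.Prime := Fact.out
  rw [Matrix.det_fin_two] at hM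
  obtain ⟨a', ha⟩ := Int.gcd_dvd_left (M 0 0) (M 1 0)
  obtain ⟨c', hc⟩ := Int.gcd_dvd_right (M 0 0) (M 1 0)
  have huv := Int.gcd_eq_gcd_ab (M 0 0) (M 1 0)
  set g := Int.gcd (M 0 0) (M 1 0)
  set u := Int.gcdA (M 0 0) (M 1 0)
  set v := Int.gcdB (M 0 0) (M 1 0)
  have hgn : (g : ℤ) * (a' * M 1 1 - c' * M 0 1) = p := by
    rw [← hM]
    linear_combination -M 1 1 * ha + M 0 1 * hc
  have hg0 : (g : ℤ) ≠ 0 := left_ne_zero_of_mul (hgn.trans_ne (by exact_mod_cast hp.ne_zero))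
  have hdet : u * a' + v * c' = 1 := by
    apply mul_left_cancel₀ hg0
    linear_combination -huv - u * ha - v * hc
  set B := u * M 0 1 + v * M 1 1
  set n := a' * M 1 1 - c' * M 0 1
  have key (k : ℤ) : ∃ γ : SL(2, ℤ), γ * M = !![(g : ℤ), B - k * n; 0, n] := by
    let γ : SL(2, ℤ) := ⟨!![u + k * c', v - k * a'; -c', a'], by
      rw [Matrix.det_fin_two_of]
      linear_combination hdet⟩
    refine ⟨γ, ?_⟩
    ext i j
    fin_cases i <;> fin_cases j <;>
      simp only [γ, Matrix.mul_apply, Fin.sum_univ_two, Fin.zero_eta, Fin.mk_one, Matrix.of_apply,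
        Matrix.cons_val', Matrix.cons_val]
    · linear_combination -huv + k * c' * ha - k * a' * hc
    · simp only [B, n]
      ring
    · linear_combination -c' * ha + a' * hc
    · simp only [n]
      ring
  rcases (Nat.dvd_prime hp).mp (Int.natCast_dvd_natCast.mp ⟨_, hgn.symm⟩) with h1 | h1
  · have hn : n = p := by simpa [h1] using hgn
    obtain ⟨γ, hγ⟩ := key (B / p)
    refine ⟨γ, some (B : ZMod p), ?_⟩
    rw [hγ, heckeMatrix, ZMod.val_intCast, hn, h1]
    congr
    linear_combination -Int.ediv_mul_add_emod B p
  · have hn : n = 1 := by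
      rw [h1] at hgn
      exact mul_left_cancel₀ (by exact_mod_cast hp.ne_zero) (hgn.trans (mul_one _).symm)
    obtain ⟨γ, hγ⟩ := key B
    exact ⟨γ, none, by rw [hγ, heckeMatrix, hn, h1, mul_one, sub_self]⟩

variable {p}

theorem heckeMatrix_apply_coe_eq (i : Option (ZMod p)) (τ : ℍ) :
    (heckeMatrix p i 0 0 : ℂ) * τ + heckeMatrix p i 0 1 =
      heckePoint p i τ * heckeMatrix p i 1 1 := by
  have hp : (p : ℂ) ≠ 0 := by exact_mod_cast (Fact.out : p.Prime).ne_zero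
  cases i
  · simp [heckeMatrix, coe_heckePoint_none]
  · simp [heckeMatrix, coe_heckePoint_some, hp]

/-- An integer matrix of determinant `p` fixing `τ` multiplies modular forms at `τ` by a power of
the associated complex multiplication. -/
theorem FixesPoint.exists_heckeTerm_eq {M : Matrix (Fin 2) (Fin 2) ℤ} {τ : ℍ}
    (h : FixesPoint M τ) (hM : M.det = p) {k : ℕ} {F : ℍ → ℂ} {f : PowerSeries ℂ}
    (hF : IsLevelOne k F f) :
    ∃ i, (M.adjugate 1 0 * (τ : ℂ) + M.adjugate 1 1) ^ k * F τ = heckeTerm p k F i τ := by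
  have hp : (p : ℂ) ≠ 0 := by exact_mod_cast (Fact.out : p.Prime).ne_zero
  obtain ⟨γ, i, hγ⟩ := exists_mul_eq_heckeMatrix p hM
  have e (i j : Fin 2) := congrArg (Int.cast : ℤ → ℂ) (congrFun (congrFun hγ i) j)
  simp only [Matrix.mul_apply, Fin.sum_univ_two, Int.cast_add, Int.cast_mul] at e
  have hj := h.denom_mul_denom_adjugate
  rw [hM, Int.cast_natCast] at hj
  set α := (M 1 0 : ℂ) * τ + M 1 1 with hα
  set β := (M.adjugate 1 0 : ℂ) * τ + M.adjugate 1 1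
  have hα0 : α ≠ 0 := left_ne_zero_of_mul (hj.trans_ne hp)
  have hd := denom_ne_zero γ τ
  have hdenom : denom γ τ = (γ 1 0 : ℤ) * τ + (γ 1 1 : ℤ) := ModularGroup.denom_apply γ τ
  rw [hdenom] at hd
  have h10 : heckeMatrix p i 1 0 = 0 := by cases i <;> simp [heckeMatrix]
  have e10 := e 1 0
  rw [h10, Int.cast_zero] at e10
  rw [FixesPoint, ← hα] at h
  have hcoc : ((γ 1 0 : ℤ) * (τ : ℂ) + (γ 1 1 : ℤ)) * α = heckeMatrix p i 1 1 := by
    linear_combination -(γ 1 0 : ℤ) * h + τ * e10 + e 1 1 + (γ 1 1 : ℤ) * hα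
  have hpt : γ • τ = heckePoint p i τ := by
    apply UpperHalfPlane.ext
    rw [coe_smul_eq, div_eq_iff hd]
    apply mul_right_cancel₀ hα0
    linear_combination -(γ 0 0 : ℤ) * h + τ * e 0 0 + e 0 1 + (γ 0 1 : ℤ) * hα +
      heckeMatrix_apply_coe_eq i τ - heckePoint p i τ * hcoc
  refine ⟨i, ?_⟩
  rw [heckeTerm, ← hpt, hF.apply_smul, hdenom, ← mul_assoc, ← mul_pow]
  congr 2
  apply mul_right_cancel₀ hα0
  rw [mul_comm _ α, hj, mul_assoc, hcoc]
  cases i <;> simp [heckeMatrix]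

theorem exists_fixesPoint {τ : ℍ} (h4 : E₄ τ ≠ 0) (h6 : E₆ τ ≠ 0)
    (h : ∃ i, E₄ τ ^ 3 * E₆ (heckePoint p i τ) ^ 2 = E₄ (heckePoint p i τ) ^ 3 * E₆ τ ^ 2) :
    ∃ M : Matrix (Fin 2) (Fin 2) ℤ, M.det = p ∧ FixesPoint M τ := by
  obtain ⟨i, hi⟩ := h
  set τ' := heckePoint p i τ with hτ'
  have hdisc : E₄ τ' ^ 3 ≠ E₆ τ' ^ 2 := fun h => ModularForm.discriminant_ne_zero τ' (by
    rw [discriminant_eq_E₄_cube_sub_E₆_sq, h, sub_self, zero_div])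
  have h4' : E₄ τ' ≠ 0 := fun h => by
    simp only [h, ne_eq, OfNat.ofNat_ne_zero, not_false_eq_true, zero_pow, zero_mul,
      mul_eq_zero, h4, pow_eq_zero_iff, false_or] at hi
    exact hdisc (by simp [h, hi])
  have h6' : E₆ τ' ≠ 0 := fun h => by
    simp only [h, ne_eq, OfNat.ofNat_ne_zero, not_false_eq_true, zero_pow, mul_zero,
      zero_eq_mul, h4', h6, pow_eq_zero_iff, or_self] at hi
  obtain ⟨c, hc⟩ := IsAlgClosed.exists_pow_nat_eq (E₆ τ' * E₄ τ / (E₄ τ' * E₆ τ)) zero_lt_two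
  obtain ⟨γ, hγ⟩ := exists_smul_eq_of_E_eq (τ := τ') (τ' := τ) (c := c)
    (by
      rw [show c ^ 4 = (c ^ 2) ^ 2 by ring, hc]
      field_simp
      linear_combination -hi)
    (by
      rw [show c ^ 6 = (c ^ 2) ^ 3 by ring, hc]
      field_simp
      linear_combination -hi)
    (fun h => by
      rw [h, zero_pow two_ne_zero, eq_comm, div_eq_zero_iff] at hc
      simp [h4, h6, h4', h6'] at hc)
  refine ⟨(γ⁻¹ : SL(2, ℤ)) * heckeMatrix p i, ?_, ?_⟩
  · rw [Matrix.det_mul, Matrix.SpecialLinearGroup.det_coe, one_mul]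
    cases i <;> simp [heckeMatrix]
  · have hd := denom_ne_zero γ τ
    rw [ModularGroup.denom_apply] at hd
    have h1 := heckeMatrix_apply_coe_eq i τ
    rw [← hτ', ← hγ, coe_smul_eq] at h1
    have h10 : heckeMatrix p i 1 0 = 0 := by cases i <;> simp [heckeMatrix]
    simp only [FixesPoint, Matrix.SpecialLinearGroup.coe_inv, Matrix.adjugate_fin_two,
      Matrix.mul_apply, Fin.sum_univ_two, Matrix.of_apply, Matrix.cons_val', Matrix.cons_val, h10]
    push_cast
    rw [div_mul_eq_mul_div, eq_div_iff hd] at h1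
    linear_combination h1

end ComplexMultiplication

section RootLifting

namespace ValuationSubring

variable {K : Type*} [Field K] (V : ValuationSubring K)

/-- A scalar multiple of `X - r` having coefficients in `V` and nonzero reduction. -/
def rootFactor (r : K) : V[X] :=
  if h : r ∈ V then X - C ⟨r, h⟩ else C ⟨r⁻¹, (V.mem_or_inv_mem r).resolve_left h⟩ * X - 1

theorem exists_map_rootFactor (r : K) :
    ∃ u : K, X - C r = C u * (V.rootFactor r).map V.subtype := by
  rw [rootFactor]
  split_ifs with h
  · exact ⟨1, by simp⟩
  · have hr : r ≠ 0 := fun h0 => h (h0 ▸ V.zero_mem)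
    refine ⟨r, ?_⟩
    simp [mul_sub, ← mul_assoc, ← C_mul, hr]

theorem map_residue_rootFactor (r : K) :
    (∃ h : r ∈ V, (V.rootFactor r).map (IsLocalRing.residue V) =
      X - C (IsLocalRing.residue V ⟨r, h⟩)) ∨
    (V.rootFactor r).map (IsLocalRing.residue V) = -1 := by
  rw [rootFactor]
  split_ifs with h
  · exact Or.inl ⟨h, by simp⟩
  · have hr : r ≠ 0 := fun h0 => h (h0 ▸ V.zero_mem)
    have h0 : IsLocalRing.residue V ⟨r⁻¹, (V.mem_or_inv_mem r).resolve_left h⟩ = 0 := by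
      rw [IsLocalRing.residue_eq_zero_iff, ← V.coe_mem_nonunits_iff]
      exact V.inv_mem_nonunits_iff.mpr (Or.inr h)
    exact Or.inr (by simp [h0])

/-- Over an algebraically closed valued field, roots of the reduction of a polynomial lift. -/
theorem exists_root_lift [IsAlgClosed K] {Q : V[X]}
    (hQ : Q.map (IsLocalRing.residue V) ≠ 0) {y : IsLocalRing.ResidueField V}
    (hy : (Q.map (IsLocalRing.residue V)).eval y = 0) :
    ∃ x : V, IsLocalRing.residue V x = y ∧ Q.eval x = 0 := by
  set f := Q.map V.subtype with hf
  have hinj : Function.Injective V.subtype := Subtype.val_injective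
  have hsplit := (IsAlgClosed.splits f).eq_prod_roots
  choose u hu using V.exists_map_rootFactor
  set G := (f.roots.map V.rootFactor).prod with hG
  have hprod (s : Multiset K) : (s.map fun r => X - C r).prod =
      C (s.map u).prod * (s.map V.rootFactor).prod.map V.subtype := by
    induction s using Multiset.induction_on with
    | empty => simp
    | cons r s ih =>
      simp only [Multiset.map_cons, Multiset.prod_cons, ih, hu r, C_mul, Polynomial.map_mul]
      ring
  have hres (s : Multiset K) : (s.map V.rootFactor).prod.map (IsLocalRing.residue V) ≠ 0 := by
    rw [Polynomial.map_multiset_prod, Multiset.map_map]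
    refine Multiset.prod_ne_zero fun h => ?_
    obtain ⟨r, -, hr⟩ := Multiset.mem_map.mp h
    rcases V.map_residue_rootFactor r with ⟨hV, h1⟩ | h1
    · exact X_sub_C_ne_zero _ (h1.symm.trans hr)
    · exact neg_ne_zero.mpr one_ne_zero (h1.symm.trans hr)
  rw [hprod, ← mul_assoc, ← C_mul] at hsplit
  set c := f.leadingCoeff * (f.roots.map u).prod
  obtain ⟨n, hn⟩ : ∃ n, IsUnit (G.coeff n) := by
    by_contra! h
    refine hres f.roots (Polynomial.ext fun n => ?_)
    rw [Polynomial.coeff_map, coeff_zero, IsLocalRing.residue_eq_zero_iff]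
    exact h n
  obtain ⟨w, hw⟩ := hn
  have hc : c ∈ V := by
    have h1 := congrArg (coeff · n) hsplit
    simp only [hf, coeff_map, coeff_C_mul] at h1
    have h2 : c = V.subtype (Q.coeff n * ↑w⁻¹) := by
      rw [map_mul, h1, mul_assoc, ← map_mul, ← hG, ← hw, Units.mul_inv, map_one, mul_one]
    exact h2 ▸ (Q.coeff n * ((w⁻¹ : Vˣ) : V)).2
  have hQG : Q = C ⟨c, hc⟩ * G := by
    apply Polynomial.map_injective _ hinj
    rw [Polynomial.map_mul, map_C]
    exact hsplit
  rw [hQG, Polynomial.map_mul, map_C] at hQ hy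
  rw [eval_mul, eval_C] at hy
  have hGy := (mul_eq_zero.mp hy).resolve_left fun h => hQ (by rw [h, C_0, zero_mul])
  rw [hG, Polynomial.map_multiset_prod, Multiset.map_map, eval_multiset_prod, Multiset.map_map,
    Multiset.prod_eq_zero_iff] at hGy
  obtain ⟨r, hr, h0⟩ := Multiset.mem_map.mp hGy
  simp only [Function.comp_apply] at h0
  rcases V.map_residue_rootFactor r with ⟨hV, h1⟩ | h1
  · rw [h1, eval_sub, eval_X, eval_C, sub_eq_zero] at h0
    refine ⟨⟨r, hV⟩, h0.symm, hinj ?_⟩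
    rw [map_zero, ← eval_map_apply]
    exact (mem_roots'.mp hr).2
  · rw [h1] at h0
    simp at h0

theorem exists_charP_residueField (p : ℕ) [Fact p.Prime] :
    ∃ V : ValuationSubring ℂ, CharP (IsLocalRing.ResidueField V) p := by
  have hp : p.Prime := Fact.out
  let A : Subring ℂ := (Int.castRingHom ℂ).range
  let e : ℤ ≃+* A := RingEquiv.ofBijective (Int.castRingHom ℂ).rangeRestrict
    ⟨fun a b h => Int.cast_injective (α := ℂ) (congrArg Subtype.val h),
      (Int.castRingHom ℂ).rangeRestrict_surjective⟩
  have hI : Ideal.span {(p : A)} ≠ ⊤ := by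
    rw [Ne, Ideal.span_singleton_eq_top]
    intro h
    have h1 := h.map e.symm
    rw [map_natCast] at h1
    exact (Nat.prime_iff_prime_int.mp hp).not_isUnit h1
  obtain ⟨V, -, hV⟩ := Ideal.image_subset_nonunits_valuationSubring _ hI
  have h1 : ((p : V) : ℂ) ∈ V.nonunits := hV ⟨(p : A), Ideal.mem_span_singleton_self _, by simp⟩
  refine ⟨V, (CharP.charP_iff_prime_eq_zero hp).mpr ?_⟩
  rw [V.coe_mem_nonunits_iff, ← IsLocalRing.residue_eq_zero_iff, map_natCast] at h1
  exact h1

theorem mem_of_pow_eq_one {x : K} {n : ℕ} (hn : n ≠ 0) (hx : x ^ n = 1) : x ∈ V := by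
  rcases V.mem_or_inv_mem x with h | h
  · exact h
  · have : x = x⁻¹ ^ (n - 1) := by
      have hx0 : x ≠ 0 := fun h0 => by simp [h0, hn] at hx
      rw [inv_pow, ← mul_eq_one_iff_eq_inv₀ (pow_ne_zero _ hx0), ← pow_succ',
        Nat.sub_add_cancel (Nat.one_le_iff_ne_zero.mpr hn), hx]
    exact this ▸ pow_mem h _

theorem mem_of_add_mem_of_mul_mem {x y : K} (hadd : x + y ∈ V) (hmul : x * y ∈ V) : x ∈ V := by
  rcases V.mem_or_inv_mem x with h | h
  · exact h
  · rcases eq_or_ne x 0 with rfl | hx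
    · exact V.zero_mem
    · have hy : y ∈ V := by
        have := V.mul_mem _ _ h hmul
        rwa [inv_mul_cancel_left₀ hx] at this
      simpa using sub_mem hadd hy

end ValuationSubring

end RootLifting

section CanonicalLift

open UpperHalfPlane hiding I
open ModularForm

namespace MvPolynomial

theorem map_eval_pair {R S : Type*} [CommRing R] [CommRing S] (φ : R →+* S) (x y : R)
    (P : MvPolynomial (Fin 2) R) : φ (eval ![x, y] P) = eval₂ φ ![φ x, φ y] P := by
  rw [eval, coe_eval₂Hom, eval₂_comp_left, RingHom.comp_id]
  congr 1
  funext i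
  fin_cases i <;> rfl

end MvPolynomial

theorem eval_eq_zero_iff_eval₂_E_eq_zero {V : ValuationSubring ℂ} {k : ℕ}
    {P : MvPolynomial (Fin 2) V} (hP : P ∈ homPoly V k) {x y : V} {τ : ℍ} {c : ℂ} (hc : c ≠ 0)
    (hx : (x : ℂ) = c ^ 4 * E₄ τ) (hy : (y : ℂ) = c ^ 6 * E₆ τ) :
    MvPolynomial.eval ![x, y] P = 0 ↔ MvPolynomial.eval₂ V.subtype ![E₄ τ, E₆ τ] P = 0 := by
  have hinj : Function.Injective V.subtype := Subtype.val_injective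
  have h : V.subtype (MvPolynomial.eval ![x, y] P) =
      c ^ k * MvPolynomial.eval₂ V.subtype ![E₄ τ, E₆ τ] P := by
    rw [MvPolynomial.map_eval_pair, ← homPoly.eval₂_scale _ hP, ← hx, ← hy]
    rfl
  rw [← map_eq_zero_iff _ hinj, h, mul_eq_zero, or_iff_right (pow_ne_zero _ hc)]

theorem eval_map_residue_eq_zero {V : ValuationSubring ℂ} {k : ℕ}
    {P : MvPolynomial (Fin 2) V} (hP : P ∈ homPoly V k) {x y : V} {τ : ℍ} {c : ℂ} (hc : c ≠ 0)
    (hx : (x : ℂ) = c ^ 4 * E₄ τ) (hy : (y : ℂ) = c ^ 6 * E₆ τ)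
    (h : MvPolynomial.eval₂ V.subtype ![E₄ τ, E₆ τ] P = 0) :
    MvPolynomial.eval ![IsLocalRing.residue V x, IsLocalRing.residue V y]
      (MvPolynomial.map (IsLocalRing.residue V) P) = 0 := by
  rw [MvPolynomial.eval_map, ← MvPolynomial.map_eval_pair,
    (eval_eq_zero_iff_eval₂_E_eq_zero hP hc hx hy).mpr h, map_zero]

variable {p : ℕ} [Fact p.Prime] {V : ValuationSubring ℂ} [CharP (IsLocalRing.ResidueField V) p]

theorem isUnit_six_of_charP_residueField (hp : 5 ≤ p) : IsUnit (6 : V) := by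
  rw [← IsLocalRing.residue_ne_zero_iff_isUnit, map_ofNat]
  exact (isUnit_six_of_charP p hp).ne_zero

theorem exp_mem (V : ValuationSubring ℂ) : Complex.exp (2 * Real.pi * Complex.I / p) ∈ V :=
  have hp0 : p ≠ 0 := (Fact.out : p.Prime).ne_zero
  V.mem_of_pow_eq_one hp0 (Complex.isPrimitiveRoot_exp p hp0).pow_eq_one

theorem exists_lift_E₄_E₆ (hp : 5 ≤ p) {x y : IsLocalRing.ResidueField V} (hx : x ≠ 0)
    (hy : y ≠ 0) (hxy : x ^ 3 ≠ y ^ 2) (hxp : x ^ p = x) (hyp : y ^ p = y) :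
    ∃ (τ : ℍ) (c : ℂ) (X Y : V) (M : Matrix (Fin 2) (Fin 2) ℤ), IsLocalRing.residue V X = x ∧
      IsLocalRing.residue V Y = y ∧ c ≠ 0 ∧ (X : ℂ) = c ^ 4 * E₄ τ ∧ (Y : ℂ) = c ^ 6 * E₆ τ ∧
      M.det = p ∧ FixesPoint M τ := by
  have hinj : Function.Injective V.subtype := Subtype.val_injective
  obtain ⟨P, hP, hP0, hPπ⟩ := exists_homPoly_isogenous p hp hinj
    (isUnit_six_of_charP_residueField hp) (ζ := ⟨_, exp_mem V⟩) rfl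
  obtain ⟨X, rfl⟩ := IsLocalRing.residue_surjective (R := V) x
  set x := IsLocalRing.residue V X
  set Q : V[X] := MvPolynomial.eval₂ Polynomial.C ![Polynomial.C X, Polynomial.X] P with hQ
  have hQY (Y : V) : Q.eval Y = MvPolynomial.eval ![X, Y] P := by
    rw [hQ, ← Polynomial.coe_evalRingHom, MvPolynomial.eval₂_comp_left, MvPolynomial.eval,
      MvPolynomial.coe_eval₂Hom]
    congr 1
    · ext; simp
    · funext i
      fin_cases i <;> simp
  have hQπ : Q.map (IsLocalRing.residue V) =
      -(Polynomial.C x ^ (3 * p) * Polynomial.X ^ 2 -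
        Polynomial.C x ^ 3 * Polynomial.X ^ (2 * p)) ^ 2 := by
    have h1 : Q.map (IsLocalRing.residue V) = MvPolynomial.eval₂ Polynomial.C
        ![Polynomial.C x, Polynomial.X] (MvPolynomial.map (IsLocalRing.residue V) P) := by
      rw [hQ, ← Polynomial.coe_mapRingHom, MvPolynomial.eval₂_comp_left, MvPolynomial.eval₂_map]
      congr 1
      · ext; simp
      · funext i
        fin_cases i <;> simp [x]
    rw [h1, hPπ]
    simp
  have hp1 : p ≠ 1 := (Fact.out : p.Prime).ne_one
  obtain ⟨Y, rfl, hY⟩ := V.exists_root_lift (Q := Q) (y := y)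
    (by
      rw [hQπ]
      refine neg_ne_zero.mpr (pow_ne_zero _ fun h => ?_)
      have := congrArg (coeff · 2) h
      simp only [← C_pow, coeff_sub, coeff_C_mul, coeff_X_pow] at this
      simp [hp1, hx] at this)
    (by
      rw [hQπ]
      simp only [eval_neg, eval_pow, eval_sub, eval_mul, eval_C, eval_X]
      rw [mul_comm 3 p, mul_comm 2 p, pow_mul, pow_mul, hxp, hyp]
      simp)
  rw [hQY] at hY
  have hne (Z : V) (hZ : IsLocalRing.residue V Z ≠ 0) : (Z : ℂ) ≠ 0 := fun h =>
    hZ (by rw [show Z = 0 from Subtype.ext h, map_zero])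
  obtain ⟨τ, c, hc, h4, h6⟩ := exists_E₄_E₆_eq (hne X hx) (hne Y hy) fun h => hxy (by
    rw [← map_pow, ← map_pow]
    exact congrArg _ (Subtype.ext h))
  rw [eval_eq_zero_iff_eval₂_E_eq_zero hP hc h4 h6, hP0] at hY
  obtain ⟨M, hM, hMτ⟩ := exists_fixesPoint
    (fun h => hne X hx (by rw [h4, h, mul_zero])) (fun h => hne Y hy (by rw [h6, h, mul_zero])) hY
  exact ⟨τ, c, X, Y, M, rfl, rfl, hc, h4, h6, hM, hMτ⟩

theorem trace_pow_four_eq_hasse (hp : 5 ≤ p) {τ : ℍ} {c : ℂ} {X Y : V}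
    {M : Matrix (Fin 2) (Fin 2) ℤ} (hx : IsLocalRing.residue V X ≠ 0)
    (hxp : IsLocalRing.residue V X ^ p = IsLocalRing.residue V X)
    (hyp : IsLocalRing.residue V Y ^ p = IsLocalRing.residue V Y) (hc : c ≠ 0)
    (h4 : (X : ℂ) = c ^ 4 * E₄ τ) (h6 : (Y : ℂ) = c ^ 6 * E₆ τ) (hM : M.det = p)
    (hMτ : FixesPoint M τ) : (M.trace : IsLocalRing.ResidueField V) ^ 4 =
      hasse ((p - 1) / 2) (IsLocalRing.residue V X) (IsLocalRing.residue V Y) ^ 4 := by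
  have hinj : Function.Injective V.subtype := Subtype.val_injective
  have h6u := isUnit_six_of_charP_residueField (V := V) hp
  have hpκ : (p : IsLocalRing.ResidueField V) = 0 := CharP.cast_eq_zero _ p
  have hp0 : p ≠ 0 := (Fact.out : p.Prime).ne_zero
  set H := hasse ((p - 1) / 2) (IsLocalRing.residue V X) (IsLocalRing.residue V Y) with hH
  have hHp : H ^ p = H := by
    rw [hH, ← frobenius_def, map_hasse, frobenius_def, frobenius_def, hxp, hyp]
  have hH4 : (H ^ 4) ^ p = H ^ 4 := by rw [pow_right_comm, hHp]
  have heval (c d : IsLocalRing.ResidueField V) :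
      MvPolynomial.eval ![IsLocalRing.residue V X, IsLocalRing.residue V Y]
        (MvPolynomial.C c * MvPolynomial.X 0 * (MvPolynomial.C d ^ p * MvPolynomial.X 0 ^ p -
          hasse ((p - 1) / 2) (MvPolynomial.X 0) (MvPolynomial.X 1) ^ 4 * MvPolynomial.X 0)) =
      c * (d ^ p - H ^ 4) * IsLocalRing.residue V X ^ 2 := by
    simp only [map_mul, map_sub, map_pow, map_hasse, MvPolynomial.eval_C, MvPolynomial.eval_X,
      Matrix.cons_val_zero, Matrix.cons_val_one, hxp, hH]
    ring
  have hadd := FixesPoint.denom_add_denom_adjugate M τ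
  have hmul := hMτ.denom_mul_denom_adjugate
  rw [hM, Int.cast_natCast] at hmul
  have hterm := hMτ.adjugate.exists_heckeTerm_eq (p := p)
    (by rw [Matrix.det_adjugate, hM]; simp) isLevelOne_E₄
  have hterm' := hMτ.exists_heckeTerm_eq hM isLevelOne_E₄
  rw [show M.adjugate.adjugate = M by simp [Matrix.adjugate_adjugate']] at hterm
  set α := (M 1 0 : ℂ) * τ + M 1 1
  set β := (M.adjugate 1 0 : ℂ) * τ + M.adjugate 1 1
  have hαV : α ∈ V := V.mem_of_add_mem_of_mul_mem (y := β) (by rw [hadd]; exact intCast_mem _ _)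
    (by rw [hmul]; exact natCast_mem _ _)
  have hβV : β ∈ V := V.mem_of_add_mem_of_mul_mem (y := α)
    (by rw [add_comm, hadd]; exact intCast_mem _ _)
    (by rw [mul_comm, hmul]; exact natCast_mem _ _)
  have key (γ : V) (hγ : ∃ i : Option (ZMod p), (γ : ℂ) ^ 4 * E₄ τ = heckeTerm p 4 E₄ i τ) :
      IsLocalRing.residue V γ = 0 ∨ IsLocalRing.residue V γ ^ 4 = H ^ 4 := by
    obtain ⟨P, hP, hP0, hPπ⟩ := exists_homPoly_E₄ p hp hinj h6u (ζ := ⟨_, exp_mem V⟩) rfl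
      (γ ^ 4) 1 (p ^ 3) (by ring)
    have h0 := eval_map_residue_eq_zero hP hc h4 h6 ((hP0 τ).mpr (by simpa using hγ))
    rw [hPπ, heval, one_mul, map_pow, ← hH4, ← sub_pow_char]
      at h0
    simpa [hx, sub_eq_zero, hp0] using h0
  have key' (hγ : ∃ i : Option (ZMod p), (p : ℂ) ^ 2 * E₄ τ = heckeTerm p 4 E₄ i τ) : H = 0 := by
    obtain ⟨P, hP, hP0, hPπ⟩ := exists_homPoly_E₄ p hp hinj h6u (ζ := ⟨_, exp_mem V⟩) rfl
      1 (p ^ 2) p (by ring)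
    have h0 := eval_map_residue_eq_zero hP hc h4 h6 ((hP0 τ).mpr (by simpa using hγ))
    rw [hPπ, heval] at h0
    simpa [hx, hpκ, hp0] using h0
  have hab : IsLocalRing.residue V ⟨α, hαV⟩ * IsLocalRing.residue V ⟨β, hβV⟩ = 0 := by
    rw [← map_mul, show (⟨α, hαV⟩ * ⟨β, hβV⟩ : V) = p from Subtype.ext (by simpa using hmul),
      map_natCast, hpκ]
  have hab' : IsLocalRing.residue V ⟨α, hαV⟩ + IsLocalRing.residue V ⟨β, hβV⟩ = M.trace := by
    rw [← map_add, show (⟨α, hαV⟩ + ⟨β, hβV⟩ : V) = M.trace from Subtype.ext (by simpa using hadd),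
      map_intCast]
  have ha := key ⟨α, hαV⟩ hterm
  have hb := key ⟨β, hβV⟩ hterm'
  rw [← hab']
  by_cases ha0 : IsLocalRing.residue V ⟨α, hαV⟩ = 0
  · by_cases hb0 : IsLocalRing.residue V ⟨β, hβV⟩ = 0
    · have htr0 : M.trace = 0 := by
        rw [ha0, hb0, add_zero, eq_comm, CharP.intCast_eq_zero_iff _ p] at hab'
        have := hMτ.trace_sq_lt hM
        by_contra h
        have h1 := Int.le_of_dvd (abs_pos.mpr h) ((dvd_abs _ _).mpr hab')
        rw [← sq_abs] at this
        nlinarith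
      have hβ2 : β ^ 4 = p ^ 2 := by
        rw [htr0, Int.cast_zero] at hadd
        rw [← hmul]
        linear_combination (α * β ^ 2 - β ^ 3) * -hadd
      rw [ha0, hb0, key' (hβ2 ▸ hterm'), add_zero]
    · rw [ha0, zero_add]
      exact hb.resolve_left hb0
  · rw [(mul_eq_zero.mp hab).resolve_left ha0, add_zero]
    exact ha.resolve_left ha0

end CanonicalLift

section TraceClasses

open UpperHalfPlane hiding I
open ModularForm

theorem exists_isReducedMatrix {p : ℕ} [Fact p.Prime] (hp : 5 ≤ p) (V : ValuationSubring ℂ)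
    [CharP (IsLocalRing.ResidueField V) p] {a : ℤ} {z : ZMod p} (hz : z ∈ traceClasses p a) :
    ∃ (M : Matrix (Fin 2) (Fin 2) ℤ) (τ : ℍ) (v : V), IsReducedMatrix p a M ∧ FixesPoint M τ ∧
      E₆ τ ≠ 0 ∧ E₄ τ ^ 3 = v * E₆ τ ^ 2 ∧ 27 * IsLocalRing.residue V v =
        -4 * ZMod.castHom dvd_rfl (IsLocalRing.ResidueField V) z := by
  simp only [traceClasses, Finset.mem_filter, Finset.mem_univ, true_and] at hz
  obtain ⟨A, B, hA, hB, hAB, ha, hz⟩ := hz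
  have h6 : (6 : ZMod p) ≠ 0 := (isUnit_six_of_charP p hp).ne_zero
  have h2 : (2 : ZMod p) ≠ 0 := fun h => h6 (by linear_combination 3 * h)
  have h3 : (3 : ZMod p) ≠ 0 := fun h => h6 (by linear_combination 2 * h)
  obtain ⟨x, rfl⟩ : ∃ x, A = -3 * x := ⟨-A / 3, by field_simp⟩
  obtain ⟨y, rfl⟩ : ∃ y, B = -2 * y := ⟨-B / 2, by field_simp⟩
  have hx : x ≠ 0 := right_ne_zero_of_mul hA
  have hy : y ≠ 0 := right_ne_zero_of_mul hB
  have hxy : x ^ 3 ≠ y ^ 2 := fun h => hAB (by linear_combination -108 * h)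
  have hhasse : (a : ZMod p) = hasse ((p - 1) / 2) x y := by
    have hodd := (Fact.out : p.Prime).eq_two_or_odd
    rw [← ha, frobTrace_cast p (by omega), hasse, weierstrassCubic,
      show 2 * ((p - 1) / 2) = p - 1 by omega]
    congr 2
    simp only [neg_mul, C_neg]
    ring
  set ι := ZMod.castHom dvd_rfl (IsLocalRing.ResidueField V) with hι
  have hinj : Function.Injective ι := ι.injective
  obtain ⟨τ, c, X, Y, M, hX, hY, hc, h4, h6, hM, hMτ⟩ := exists_lift_E₄_E₆ hp
    ((map_ne_zero ι).mpr hx) ((map_ne_zero ι).mpr hy)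
    (by rw [← map_pow, ← map_pow]; exact hinj.ne hxy)
    (by rw [← map_pow, ZMod.pow_card]) (by rw [← map_pow, ZMod.pow_card])
  have htrace := trace_pow_four_eq_hasse hp (by rw [hX]; exact (map_ne_zero ι).mpr hx)
    (by rw [hX, ← map_pow, ZMod.pow_card]) (by rw [hY, ← map_pow, ZMod.pow_card]) hc h4 h6 hM hMτ
  rw [hX, hY, ← map_hasse, ← hhasse, ← map_intCast ι, ← map_pow, ← map_pow] at htrace
  obtain ⟨γ, hγ⟩ := ModularGroup.exists_smul_mem_fd τ
  have hinv : (γ⁻¹ : Matrix.SpecialLinearGroup (Fin 2) ℤ).1 * γ.1 = 1 :=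
    congrArg Subtype.val (inv_mul_cancel γ)
  have hconj : γ.1 * M * (γ⁻¹).1 * γ.1 = γ.1 * M := by rw [mul_assoc, hinv, mul_one]
  have hN : FixesPoint (γ.1 * M * (γ⁻¹).1) (γ • τ) := hMτ.conj γ hconj
  have hdet : (γ.1 * M * (γ⁻¹).1).det = p := by
    rw [Matrix.det_mul, Matrix.det_mul, γ.2, (γ⁻¹).2, hM, one_mul, mul_one]
  have htr : (γ.1 * M * (γ⁻¹).1).trace = M.trace := by
    rw [Matrix.trace_mul_comm, ← mul_assoc, hinv, one_mul]
  obtain ⟨u, hu⟩ : IsUnit Y := by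
    rw [← IsLocalRing.residue_ne_zero_iff_isUnit, hY]
    exact (map_ne_zero ι).mpr hy
  have hv : X ^ 3 = X ^ 3 * (u⁻¹ : Vˣ) ^ 2 * Y ^ 2 := by
    rw [mul_assoc, ← mul_pow, ← hu, Units.inv_mul, one_pow, mul_one]
  have hden := denom_ne_zero γ τ
  have hY0 : (Y : ℂ) ≠ 0 := by
    rw [← hu]
    exact_mod_cast u.ne_zero
  have h60 : E₆ τ ≠ 0 := fun h => hY0 (by rw [h6, h, mul_zero])
  refine ⟨γ.1 * M * (γ⁻¹).1, γ • τ, X ^ 3 * (u⁻¹ : Vˣ) ^ 2,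
    ⟨hdet, hN.trace_sq_lt hdet, hinj ?_, hN.abs_le_of_mem_fd hγ⟩, hN, ?_, ?_, ?_⟩
  · rw [htr, htrace]
  · rw [isLevelOne_E₆.apply_smul]
    exact mul_ne_zero (pow_ne_zero _ hden) h60
  · rw [isLevelOne_E₆.apply_smul, isLevelOne_E₄.apply_smul]
    generalize X ^ 3 * (u⁻¹ : Vˣ) ^ 2 = v at hv
    have hv' := congrArg (Subtype.val : V → ℂ) hv
    push_cast at hv'
    rw [h4, h6] at hv'
    refine mul_left_cancel₀ (pow_ne_zero 12 hc) ?_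
    linear_combination denom γ τ ^ 12 * hv'
  · generalize X ^ 3 * (u⁻¹ : Vˣ) ^ 2 = v at hv
    have hv' := congrArg (IsLocalRing.residue V) hv
    rw [map_mul, map_pow, map_pow, hX, hY] at hv'
    have hz' := congrArg ι hz
    simp only [map_mul, map_pow, map_neg, map_ofNat] at hz'
    refine mul_right_cancel₀ (pow_ne_zero 2 ((map_ne_zero ι).mpr hy)) ?_
    linear_combination -27 * hv' - hz'

theorem card_traceClasses_le_ncard {p : ℕ} [Fact p.Prime] (hp : 5 ≤ p) (a : ℤ)
    (hfin : {M | IsReducedMatrix p a M}.Finite) :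
    (traceClasses p a).card ≤ {M | IsReducedMatrix p a M}.ncard := by
  obtain ⟨V, _⟩ := ValuationSubring.exists_charP_residueField p
  choose! M τ v hM hMτ h6 h4 hv using
    fun z (hz : z ∈ traceClasses p a) => exists_isReducedMatrix hp V hz
  rw [← Set.ncard_coe_finset]
  refine Set.ncard_le_ncard_of_injOn M hM (fun z hz w hw h => ?_) hfin
  have hτ : τ z = τ w := (hMτ z hz).ext_of_eq (h ▸ hMτ w hw)
    ((hMτ z hz).apply_one_zero_ne_zero (hM z hz).1)
  have hvw : v z = v w := by
    have := (h4 z hz).symm.trans (hτ ▸ h4 w hw)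
    exact Subtype.ext (mul_right_cancel₀ (pow_ne_zero 2 (h6 z hz)) this)
  have hκ : (4 : IsLocalRing.ResidueField V) ≠ 0 := by
    have h6 : (6 : IsLocalRing.ResidueField V) ≠ 0 := (isUnit_six_of_charP p hp).ne_zero
    exact fun h => pow_ne_zero 2 h6 (by linear_combination 9 * h)
  refine (ZMod.castHom dvd_rfl (IsLocalRing.ResidueField V)).injective
    (mul_left_cancel₀ (neg_ne_zero.mpr hκ) ?_)
  rw [← hv z hz, ← hv w hw, hvw]

theorem exists_card_traceClasses_le (ε : ℝ) (hε : 0 < ε) :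
    ∃ C : ℝ, 0 < C ∧ ∃ P : ℕ, ∀ (p : ℕ) [Fact p.Prime], P ≤ p → ∀ a : ℤ,
      ((traceClasses p a).card : ℝ) ≤ C * (p : ℝ) ^ (1 / 2 + ε) := by
  obtain ⟨C, hC, h⟩ := exists_ncard_isReducedMatrix_le ε hε
  refine ⟨C, hC, 17, fun p _ hp a => ?_⟩
  obtain ⟨hfin, hcard⟩ := h p hp a
  exact (Nat.cast_le.mpr (card_traceClasses_le_ncard (by omega) a hfin)).trans hcard

end TraceClasses

/-- Theorem 1.7 (Lang–Trotter on average over `I(T) = {1, …, T}`). -/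
theorem LT_average_IT (f g : Polynomial ℤ) (hfg : Nondeg f g) (ε : ℝ) (hε : 0 < ε) :
    ∃ C : ℝ, 0 < C ∧ ∀ T : ℕ, 0 < T → ∀ x : ℝ, 2 ≤ x → ∀ a : ℕ → ℤ,
      (∑ t ∈ (Finset.Icc 1 T).filter fun t => aeval (t : ℚ) (Dpoly f g) ≠ 0,
          (piSeq f g a (t : ℚ) x : ℝ)) ≤
        C * ((T : ℝ) ^ 2 + (T : ℝ) ^ ((1 : ℝ) / 2) * x ^ (5 / 4 + ε)) := by
  exact sum_piSeq_le_of_card_traceClasses_le exists_card_traceClasses_le f g hfg ε hε
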